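/- arXiv:1006.0129 — 2 statements merged into one kernel-verified Lean document; each statement's English description precedes it below -/
import Mathlib

section
/- Let k be a ring, G a group, and M a kG-module. Assume G has a finite-index normal subgroup H such that M admits a finite-length resolution by finitely generated projective kH-modules. Let d be the largest rank of an elementary abelian p-subgroup of G/H over primes p not invertible in k. Then cds_{kG}(M) ≤ f, where f(n) = (n+1)^{d−1}. -/
open CategoryTheory

noncomputable section

/-- `f : ℕ → ℝ≥0` is a proper complexity function. -/
def IsProperComplexityFunction (f : ℕ → NNReal) : Prop :=
  ∀ n : ℤ, ∃ c : NNReal, ∀ m : ℕ, 0 ≤ (m : ℤ) + n → f ((m : ℤ) + n).toNat < c * f m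

/-- The module `P` can be generated by at most `b` elements over `R`. -/
def RankLE (R : Type) [Ring R] (P : Type) [AddCommGroup P] [Module R P] (b : NNReal) : Prop :=
  ∃ s : Finset P, Submodule.span R (s : Set P) = ⊤ ∧ (s.card : NNReal) ≤ b

/-- `c_R(M) ≤ f` : `M` has a projective resolution whose `n`-th term has rank at most
`d * f n` for some constant `d`. -/
def ComplexityLE (R : Type) [Ring R] (M : ModuleCat.{0} R) (f : ℕ → NNReal) : Prop :=
  ∃ (P : ProjectiveResolution M) (d : NNReal),
    ∀ n : ℕ, RankLE R (P.complex.X n) (d * f n)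

/-- `cds_R(M) ≤ f` : complexity at most `f` up to a direct summand. -/
def CdsLE (R : Type) [Ring R] (M : ModuleCat.{0} R) (f : ℕ → NNReal) : Prop :=
  ∃ N : ModuleCat.{0} R, ComplexityLE R (ModuleCat.of R (M × N)) f

/-- The ring homomorphism `k[H] →+* k[G]` induced by the inclusion of a subgroup `H ≤ G`. -/
def subgroupRingHom (k : Type) [Ring k] {G : Type} [Group G] (H : Subgroup G) :
    MonoidAlgebra k H →+* MonoidAlgebra k G :=
  MonoidAlgebra.mapDomainRingHom k H.subtype

/-- Restriction of a `k[G]`-module to a `k[H]`-module, `H ≤ G`. -/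
def resMod (k : Type) [Ring k] {G : Type} [Group G] (H : Subgroup G)
    (M : ModuleCat.{0} (MonoidAlgebra k G)) : ModuleCat.{0} (MonoidAlgebra k H) :=
  (ModuleCat.restrictScalars (subgroupRingHom k H)).obj M

/-- A group is elementary abelian if it is isomorphic to `(ℤ/p)^r` for a prime `p`. -/
def IsElementaryAbelian (Q : Type) [Group Q] : Prop :=
  ∃ (p r : ℕ), p.Prime ∧ Nonempty (Q ≃* Multiplicative (Fin r → ZMod p))

/-- A group is `p`-elementary abelian if it is isomorphic to `(ℤ/p)^r`. -/
def IsPElementaryAbelian (p : ℕ) (Q : Type) [Group Q] : Prop :=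
  ∃ r : ℕ,
  Nonempty (Q ≃* Multiplicative (Fin r → ZMod p))

open MonoidAlgebra (single)

set_option linter.unusedSectionVars false

/-- `P` is a finitely generated projective module with at most `n` generators. -/
def IsProjGen (R : Type) [Ring R] (P : Type) [AddCommGroup P] [Module R P] (n : ℕ) : Prop :=
  Module.Projective R P ∧ ∃ h : (Fin n → R) →ₗ[R] P, Function.Surjective h

/-- `N` is covered by a projective module on `n` generators, with kernel satisfying `S`. -/
def CoverStep (R : Type) [Ring R]
    (S : ∀ (N : Type) [AddCommGroup N] [Module R N], (ℕ → ℕ) → Prop)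
    (N : Type) [AddCommGroup N] [Module R N] (c : ℕ → ℕ) : Prop :=
  ∃ (P : Type) (_ : AddCommGroup P) (_ : Module R P) (f : P →ₗ[R] N),
    IsProjGen R P (c 0) ∧ Function.Surjective f ∧ S (LinearMap.ker f) (fun n => c (n + 1))

/-- `M` has a projective resolution whose `n`-th term has at most `b n` generators
(a coinductive formulation through iterated syzygies). -/
def HasRes (R : Type) [Ring R] (M : Type) [AddCommGroup M] [Module R M] (b : ℕ → ℕ) : Prop :=
  ∃ S : ∀ (N : Type) [AddCommGroup N] [Module R N], (ℕ → ℕ) → Prop,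
    S M b ∧ ∀ (N : Type) [AddCommGroup N] [Module R N] (c : ℕ → ℕ), S N c → CoverStep R S N c

section HasRes

variable {R : Type} [Ring R]

theorem CoverStep.mono {S S' : ∀ (N : Type) [AddCommGroup N] [Module R N], (ℕ → ℕ) → Prop}
    (h : ∀ (N : Type) [AddCommGroup N] [Module R N] (c : ℕ → ℕ), S N c → S' N c)
    {N : Type} [AddCommGroup N] [Module R N] {c : ℕ → ℕ} (hN : CoverStep R S N c) :
    CoverStep R S' N c := by
  obtain ⟨P, i1, i2, f, hP, hf, hS⟩ := hN
  exact ⟨P, i1, i2, f, hP, hf, h _ _ hS⟩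

theorem HasRes.step {M : Type} [AddCommGroup M] [Module R M] {b : ℕ → ℕ} (h : HasRes R M b) :
    CoverStep R (HasRes R) M b := by
  obtain ⟨S, hM, hS⟩ := h
  exact (hS _ _ hM).mono fun N _ _ c hN => ⟨S, hN, hS⟩

theorem HasRes.of_step {M : Type} [AddCommGroup M] [Module R M] {b : ℕ → ℕ}
    (h : CoverStep R (HasRes R) M b) : HasRes R M b :=
  ⟨CoverStep R (HasRes R), h, fun _ _ _ _ hN => hN.mono fun _ _ _ _ h => h.step⟩

theorem HasRes.of_equiv {M M' : Type} [AddCommGroup M] [Module R M] [AddCommGroup M'] [Module R M']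
    {b : ℕ → ℕ} (e : M ≃ₗ[R] M') (h : HasRes R M b) : HasRes R M' b := by
  obtain ⟨P, i1, i2, f, hP, hf, hS⟩ := h.step
  refine HasRes.of_step ⟨P, i1, i2, e.toLinearMap ∘ₗ f, hP, e.surjective.comp hf, ?_⟩
  rwa [LinearEquiv.ker_comp]

theorem IsProjGen.mono {P : Type} [AddCommGroup P] [Module R P] {m n : ℕ} (hmn : m ≤ n)
    (h : IsProjGen R P m) : IsProjGen R P n := by
  obtain ⟨hP, h, hh⟩ := h
  refine ⟨hP, h ∘ₗ LinearMap.funLeft R R (Fin.castLE hmn), hh.comp ?_⟩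
  exact LinearMap.funLeft_surjective_of_injective R R _ (Fin.castLE_injective hmn)

theorem HasRes.mono {M : Type} [AddCommGroup M] [Module R M] {b b' : ℕ → ℕ}
    (hb : ∀ n, b n ≤ b' n) (h : HasRes R M b) : HasRes R M b' := by
  refine ⟨fun N _ _ c' => ∃ c : ℕ → ℕ, (∀ n, c n ≤ c' n) ∧ HasRes R N c, ⟨b, hb, h⟩, ?_⟩
  rintro N _ _ c' ⟨c, hc, hN⟩
  obtain ⟨P, i1, i2, f, hP, hf, hS⟩ := hN.step
  exact ⟨P, i1, i2, f, hP.mono (hc 0), hf, _, fun n => hc (n + 1), hS⟩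

theorem IsProjGen.of_retract {P P' : Type} [AddCommGroup P] [Module R P] [AddCommGroup P']
    [Module R P'] {n : ℕ} (h : IsProjGen R P n) (i : P' →ₗ[R] P) (s : P →ₗ[R] P')
    (hs : s ∘ₗ i = LinearMap.id) : IsProjGen R P' n := by
  obtain ⟨hP, h, hh⟩ := h
  have hs' : Function.LeftInverse s i := fun x => LinearMap.congr_fun hs x
  exact ⟨Module.Projective.of_split i s hs, s ∘ₗ h, hs'.surjective.comp hh⟩

theorem IsProjGen.prod {P P' : Type} [AddCommGroup P] [Module R P] [AddCommGroup P']
    [Module R P'] {m n : ℕ} (h : IsProjGen R P m) (h' : IsProjGen R P' n) :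
    IsProjGen R (P × P') (m + n) := by
  obtain ⟨hP, h, hh⟩ := h
  obtain ⟨hP', h', hh'⟩ := h'
  refine ⟨inferInstance, (h ∘ₗ LinearMap.funLeft R R (Fin.castAdd n)).prod
    (h' ∘ₗ LinearMap.funLeft R R (Fin.natAdd m)), ?_⟩
  rintro ⟨x, y⟩
  obtain ⟨a, rfl⟩ := hh x
  obtain ⟨a', rfl⟩ := hh' y
  refine ⟨Fin.append a a', ?_⟩
  refine Prod.ext (congrArg h ?_) (congrArg h' ?_) <;> ext i <;> simp [LinearMap.funLeft]

theorem isProjGen_of_subsingleton {P : Type} [AddCommGroup P] [Module R P] [Subsingleton P] :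
    IsProjGen R P 0 :=
  ⟨inferInstance, 0, fun _ => ⟨0, Subsingleton.elim _ _⟩⟩

theorem HasRes.of_subsingleton {M : Type} [AddCommGroup M] [Module R M] [Subsingleton M]
    (b : ℕ → ℕ) : HasRes R M b := by
  refine ⟨fun N _ _ _ => Subsingleton N, ‹_›, fun N _ _ c hN => ?_⟩
  exact ⟨N, _, _, LinearMap.id, isProjGen_of_subsingleton.mono (Nat.zero_le _),
    Function.surjective_id, inferInstance⟩

/-- The horseshoe lemma in degree zero. -/
theorem exists_horseshoe {A B C P Q : Type} [AddCommGroup A] [Module R A] [AddCommGroup B]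
    [Module R B] [AddCommGroup C] [Module R C] [AddCommGroup P] [Module R P] [AddCommGroup Q]
    [Module R Q] [Module.Projective R Q] {i : A →ₗ[R] B} {q : B →ₗ[R] C}
    (hi : Function.Injective i) (hq : Function.Surjective q) (hiq : Function.Exact i q)
    {f : P →ₗ[R] A} (hf : Function.Surjective f) {g : Q →ₗ[R] C} (hg : Function.Surjective g) :
    ∃ F : P × Q →ₗ[R] B, Function.Surjective F ∧
      ∃ (i' : LinearMap.ker f →ₗ[R] LinearMap.ker F)
        (q' : LinearMap.ker F →ₗ[R] LinearMap.ker g),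
        Function.Injective i' ∧ Function.Surjective q' ∧ Function.Exact i' q' := by
  obtain ⟨l, hl⟩ := Module.projective_lifting_property q g hq
  have hl' : ∀ y, q (l y) = g y := fun y => LinearMap.congr_fun hl y
  have hqi : ∀ a, q (i a) = 0 := fun a => (hiq (i a)).2 ⟨a, rfl⟩
  let F : P × Q →ₗ[R] B := (i ∘ₗ f).coprod l
  have hF : ∀ x y, F (x, y) = i (f x) + l y := fun x y => by simp [F]
  refine ⟨F, ?_, ?_⟩
  · intro b
    obtain ⟨y, hy⟩ := hg (q b)
    obtain ⟨a, ha⟩ := (hiq (b - l y)).1 (by rw [map_sub, hl', hy, sub_self])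
    obtain ⟨x, rfl⟩ := hf a
    exact ⟨(x, y), by rw [hF, ha]; abel⟩
  · refine ⟨((LinearMap.inl R P Q) ∘ₗ (LinearMap.ker f).subtype).codRestrict _ ?_,
      ((LinearMap.snd R P Q) ∘ₗ (LinearMap.ker F).subtype).codRestrict _ ?_, ?_, ?_, ?_⟩
    · rintro ⟨x, hx⟩
      have hx' : f x = 0 := hx
      simp [F, hx']
    · rintro ⟨⟨x, y⟩, hxy⟩
      have h1 : i (f x) + l y = 0 := by rw [← hF]; exact hxy
      have h2 := congrArg q h1
      rw [map_add, hqi, hl', zero_add, map_zero] at h2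
      simpa using h2
    · intro x x' h
      have := congrArg (fun z => z.1.1) h
      exact Subtype.ext this
    · rintro ⟨y, hy⟩
      have hy' : g y = 0 := hy
      obtain ⟨a, ha⟩ := (hiq (l y)).1 (by rw [hl', hy'])
      obtain ⟨x, rfl⟩ := hf a
      refine ⟨⟨(-x, y), ?_⟩, rfl⟩
      rw [LinearMap.mem_ker, hF, map_neg, map_neg, ha, neg_add_cancel]
    · rintro ⟨⟨x, y⟩, hxy⟩
      constructor
      · intro h
        have hy : y = 0 := congrArg Subtype.val h
        subst hy
        have h1 : i (f x) + l 0 = 0 := by rw [← hF]; exact hxy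
        rw [map_zero, add_zero] at h1
        exact ⟨⟨x, hi (by rw [h1, map_zero])⟩, rfl⟩
      · rintro ⟨x', h⟩
        have := congrArg (fun z => z.1.2) h
        exact Subtype.ext this.symm

theorem HasRes.ext {A B C : Type} [AddCommGroup A] [Module R A] [AddCommGroup B]
    [Module R B] [AddCommGroup C] [Module R C] {i : A →ₗ[R] B} {q : B →ₗ[R] C}
    (hi : Function.Injective i) (hq : Function.Surjective q) (hiq : Function.Exact i q)
    {a c : ℕ → ℕ} (hA : HasRes R A a) (hC : HasRes R C c) : HasRes R B (a + c) := by
  refine ⟨fun B _ _ b => ∃ (A C : Type) (_ : AddCommGroup A) (_ : Module R A)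
      (_ : AddCommGroup C) (_ : Module R C) (i : A →ₗ[R] B) (q : B →ₗ[R] C) (a c : ℕ → ℕ),
      Function.Injective i ∧ Function.Surjective q ∧ Function.Exact i q ∧ HasRes R A a ∧
      HasRes R C c ∧ b = a + c, ⟨A, C, _, _, _, _, i, q, a, c, hi, hq, hiq, hA, hC, rfl⟩, ?_⟩
  rintro B _ _ _ ⟨A, C, _, _, _, _, i, q, a, c, hi, hq, hiq, hA, hC, rfl⟩
  obtain ⟨P, _, _, f, hP, hf, hS⟩ := hA.step
  obtain ⟨Q, _, _, g, hQ, hg, hT⟩ := hC.step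
  have := hQ.1
  obtain ⟨F, hF, i', q', hi', hq', hiq'⟩ := exists_horseshoe hi hq hiq hf hg
  exact ⟨P × Q, _, _, F, hP.prod hQ, hF, _, _, _, _, _, _, i', q', _, _, hi', hq', hiq', hS, hT,
    rfl⟩

/-- If every module in a class `𝒲` is a quotient of a module with resolution bounded by `x`, with
kernel again in `𝒲`, then members of `𝒲` have resolutions bounded by the partial sums of `x`. -/
theorem HasRes.of_class (𝒲 : ∀ (N : Type) [AddCommGroup N] [Module R N], Prop) (x : ℕ → ℕ)
    (h𝒲 : ∀ (N : Type) [AddCommGroup N] [Module R N], 𝒲 N →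
      ∃ (X : Type) (_ : AddCommGroup X) (_ : Module R X) (W : Type) (_ : AddCommGroup W)
        (_ : Module R W) (j : W →ₗ[R] X) (p : X →ₗ[R] N), 𝒲 W ∧ HasRes R X x ∧
        Function.Injective j ∧ Function.Surjective p ∧ Function.Exact j p)
    {M : Type} [AddCommGroup M] [Module R M] (hM : 𝒲 M) :
    HasRes R M (fun n => ∑ i ∈ Finset.range (n + 1), x i) := by
  refine ⟨fun Z _ _ c => ∃ (Y W : Type) (_ : AddCommGroup Y) (_ : Module R Y)
      (_ : AddCommGroup W) (_ : Module R W) (i : Y →ₗ[R] Z) (q : Z →ₗ[R] W) (y : ℕ → ℕ),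
      Function.Injective i ∧ Function.Surjective q ∧ Function.Exact i q ∧ HasRes R Y y ∧
      𝒲 W ∧ c = fun n => y n + ∑ i ∈ Finset.range (n + 1), x i, ?_, ?_⟩
  · refine ⟨PUnit, M, _, inferInstance, _, inferInstance, 0, LinearMap.id, 0,
      fun _ _ _ => rfl, Function.surjective_id, ?_, HasRes.of_subsingleton _, hM, by simp⟩
    intro m
    simp [eq_comm]
  · rintro Z _ _ _ ⟨Y, W, _, _, _, _, i, q, y, hi, hq, hiq, hY, hW, rfl⟩
    obtain ⟨P, _, _, f, hP, hf, hS⟩ := hY.step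
    obtain ⟨X, _, _, W', _, _, j, p, hW', hX, hj, hp, hjp⟩ := h𝒲 W hW
    obtain ⟨Q, _, _, g, hQ, hg, hT⟩ := hX.step
    have := hQ.1
    obtain ⟨F, hF, i', q', hi', hq', hiq'⟩ :=
      exists_horseshoe hi hq hiq hf (g := p ∘ₗ g) (hp.comp hg)
    let e := LinearEquiv.ofInjective j hj
    let v : LinearMap.ker (p ∘ₗ g) →ₗ[R] LinearMap.range j :=
      (g ∘ₗ (LinearMap.ker (p ∘ₗ g)).subtype).codRestrict _
        (fun z => (hjp _).1 (LinearMap.mem_ker.1 z.2))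
    have hv : ∀ z, (v z : X) = g z := fun z => rfl
    have hvs : Function.Surjective v := by
      rintro ⟨_, w, rfl⟩
      obtain ⟨t, ht⟩ := hg (j w)
      have : t ∈ LinearMap.ker (p ∘ₗ g) := by
        rw [LinearMap.mem_ker, LinearMap.comp_apply, ht]
        exact (hjp _).2 ⟨w, rfl⟩
      exact ⟨⟨t, this⟩, Subtype.ext ht⟩
    let u : LinearMap.ker F →ₗ[R] W' := e.symm.toLinearMap ∘ₗ v ∘ₗ q'
    have hu : ∀ z, u z = 0 ↔ g (q' z) = 0 := fun z => by
      simp only [u, LinearMap.comp_apply, LinearEquiv.coe_coe,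
        LinearEquiv.map_eq_zero_iff, ← hv, Submodule.coe_eq_zero]
    have hqi' : ∀ a, q' (i' a) = 0 := fun a => (hiq' _).2 ⟨a, rfl⟩
    refine ⟨P × Q, _, _, F, ?_, hF, LinearMap.ker u, W', inferInstance, inferInstance,
      inferInstance, inferInstance, (LinearMap.ker u).subtype,
      u, (fun n => y (n + 1)) + fun n => x (n + 1), ?_,
      e.symm.surjective.comp (hvs.comp hq'), ?_, ?_, hW', ?_⟩
    · simpa using hP.prod hQ
    · exact Submodule.subtype_injective _
    · intro z
      simp
    · refine HasRes.ext (i := i'.codRestrict _ ?_) (q := ((LinearMap.ker (p ∘ₗ g)).subtype ∘ₗ q' ∘ₗ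
        (LinearMap.ker u).subtype).codRestrict (LinearMap.ker g) ?_) ?_ ?_ ?_ hS hT
      · intro a
        rw [LinearMap.mem_ker, hu, hqi']
        simp
      · rintro ⟨z, hz⟩
        exact (hu z).1 hz
      · intro a a' h
        exact hi' (congrArg Subtype.val h)
      · rintro ⟨t, ht⟩
        have ht' : g t = 0 := ht
        obtain ⟨z, hz⟩ := hq' ⟨t, by simp [ht']⟩
        have hz' : (q' z : Q) = t := congrArg Subtype.val hz
        exact ⟨⟨z, (hu z).2 (by rw [hz']; exact ht')⟩, Subtype.ext hz'⟩
      · rintro ⟨z, hz⟩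
        constructor
        · intro h
          have h' : (q' z : Q) = 0 := congrArg Subtype.val h
          obtain ⟨a, ha⟩ := (hiq' z).1 (Subtype.ext h')
          exact ⟨a, Subtype.ext ha⟩
        · rintro ⟨a, ha⟩
          have : z = i' a := (congrArg Subtype.val ha).symm
          subst this
          have h' : (q' (i' a) : Q) = 0 := congrArg Subtype.val (hqi' a)
          exact Subtype.ext h'
    · funext n
      simp only [Pi.add_apply, Finset.sum_range_succ _ (n + 1)]
      ring

end HasRes

section GroupRing

variable {k : Type} [Ring k] {G : Type} [Group G]

/-- A `k[G]`-module structure from commuting actions of `k` and `G`. -/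
@[reducible]
def groupRingModule {V : Type} [AddCommGroup V] (α : k →+* AddMonoid.End V)
    (ρ : G →* AddMonoid.End V) (h : ∀ a g, Commute (α a) (ρ g)) :
    Module (MonoidAlgebra k G) V :=
  Module.compHom V (MonoidAlgebra.liftNCRingHom α ρ h)

theorem groupRingModule_single_smul {V : Type} [AddCommGroup V] (α : k →+* AddMonoid.End V)
    (ρ : G →* AddMonoid.End V) (h : ∀ a g, Commute (α a) (ρ g)) (g : G) (a : k) (v : V) :
    letI := groupRingModule α ρ h
    single g a • v = α a (ρ g v) := by
  change MonoidAlgebra.liftNCRingHom α ρ h (single g a) v = _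
  rw [MonoidAlgebra.liftNCRingHom_single]
  rfl

theorem single_smul_eq {M : Type} [AddCommGroup M] [Module (MonoidAlgebra k G) M] (g : G) (a : k)
    (m : M) : single g a • m = single (1 : G) a • single g (1 : k) • m := by
  rw [smul_smul, MonoidAlgebra.single_mul_single, one_mul, mul_one]

theorem single_smul_comm {M : Type} [AddCommGroup M] [Module (MonoidAlgebra k G) M] (g : G) (a : k)
    (m : M) : single g (1 : k) • single (1 : G) a • m = single (1 : G) a • single g (1 : k) • m := by
  simp only [smul_smul, MonoidAlgebra.single_mul_single, one_mul, mul_one]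

theorem single_one_one_smul {M : Type} [AddCommGroup M] [Module (MonoidAlgebra k G) M] (m : M) :
    single (1 : G) (1 : k) • m = m := by
  rw [← MonoidAlgebra.one_def, one_smul]

theorem single_mul_smul {M : Type} [AddCommGroup M] [Module (MonoidAlgebra k G) M] (g h : G)
    (m : M) : single (g * h) (1 : k) • m = single g (1 : k) • single h (1 : k) • m := by
  rw [smul_smul, MonoidAlgebra.single_mul_single, mul_one]

/-- An additive map compatible with scalars and group elements is linear over the group ring. -/
def groupRingLinear {V W : Type} [AddCommGroup V] [Module (MonoidAlgebra k G) V]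
    [AddCommGroup W] [Module (MonoidAlgebra k G) W] (f : V →+ W)
    (hk : ∀ (a : k) v, f (single (1 : G) a • v) = single (1 : G) a • f v)
    (hG : ∀ (g : G) v, f (single g (1 : k) • v) = single g (1 : k) • f v) :
    V →ₗ[MonoidAlgebra k G] W where
  toFun := f
  map_add' := f.map_add
  map_smul' r v := by
    induction r using MonoidAlgebra.induction_linear with
    | zero => simp
    | add r s hr hs => simp only [add_smul, map_add, hr, hs]
    | single g a =>
      change f (single g a • v) = single g a • f v
      rw [single_smul_eq, hk, hG, ← single_smul_eq]

/-- The action of `k` on a `k[G]`-module. -/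
def scalarEnd (k G : Type) [Ring k] [Group G] (M : Type) [AddCommGroup M]
    [Module (MonoidAlgebra k G) M] : k →+* AddMonoid.End M :=
  (Module.toAddMonoidEnd (MonoidAlgebra k G) M).comp MonoidAlgebra.singleOneRingHom

/-- Restriction of scalars along a ring homomorphism. -/
def Rst {R S : Type} [Ring R] [Ring S] (_ : R →+* S) (M : Type) : Type := M

instance {R S : Type} [Ring R] [Ring S] (φ : R →+* S) (M : Type) [h : AddCommGroup M] :
    AddCommGroup (Rst φ M) := h

instance {R S : Type} [Ring R] [Ring S] (φ : R →+* S) (M : Type) [AddCommGroup M] [Module S M] :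
    Module R (Rst φ M) := Module.compHom M φ

/-- The underlying group does not change under restriction of scalars. -/
def Rst.equiv {R S : Type} [Ring R] [Ring S] (φ : R →+* S) {M : Type} [AddCommGroup M] :
    M ≃+ Rst φ M := AddEquiv.refl M

/-- The restriction of a `k[G]`-module along a group homomorphism. -/
abbrev GRst (k : Type) [Ring k] {G Γ : Type} [Group G] [Group Γ] (i : Γ →* G) (M : Type) : Type :=
  Rst (MonoidAlgebra.mapDomainRingHom k i) M

theorem GRst.single_smul {Γ : Type} [Group Γ] (i : Γ →* G) {M : Type} [AddCommGroup M]
    [Module (MonoidAlgebra k G) M] (γ : Γ) (a : k) (m : GRst k i M) :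
    single γ a • m = Rst.equiv _ (single (i γ) a • (Rst.equiv _).symm m) := by
  change MonoidAlgebra.mapDomainRingHom k i (single γ a) • (Rst.equiv _).symm m = _
  rw [MonoidAlgebra.mapDomainRingHom_apply, MonoidAlgebra.mapDomain_single]
  rfl

end GroupRing

section Coind

variable {k : Type} [Ring k] {G K : Type} [Group G] [Group K]

/-- The underlying subgroup of the coinduced module. -/
def coindSubgroup (k : Type) [Ring k] {G K : Type} [Group G] [Group K] (i : K →* G)
    (N : Type) [AddCommGroup N] [Module (MonoidAlgebra k K) N] : AddSubgroup (G → N) where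
  carrier := {f | ∀ κ x, f (i κ * x) = single κ (1 : k) • f x}
  add_mem' hf hf' κ x := by simp only [Pi.add_apply, hf κ x, hf' κ x, smul_add]
  zero_mem' κ x := by simp
  neg_mem' hf κ x := by simp only [Pi.neg_apply, hf κ x, smul_neg]

/-- The module coinduced along `i : K →* G`. -/
abbrev Coind (k : Type) [Ring k] {G K : Type} [Group G] [Group K] (i : K →* G)
    (N : Type) [AddCommGroup N] [Module (MonoidAlgebra k K) N] : Type :=
  coindSubgroup k i N

namespace Coind

variable {i : K →* G} {N : Type} [AddCommGroup N] [Module (MonoidAlgebra k K) N]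
  {N' : Type} [AddCommGroup N'] [Module (MonoidAlgebra k K) N']

instance : CoeFun (Coind k i N) (fun _ => G → N) := ⟨Subtype.val⟩

@[ext]
theorem ext {f f' : Coind k i N} (h : ∀ x, f x = f' x) : f = f' := Subtype.ext (funext h)

theorem equivariant (f : Coind k i N) (κ : K) (x : G) : f (i κ * x) = single κ (1 : k) • f x :=
  f.2 κ x

/-- The scalar action on the coinduced module. -/
def scalar (k : Type) [Ring k] {G K : Type} [Group G] [Group K] (i : K →* G)
    (N : Type) [AddCommGroup N] [Module (MonoidAlgebra k K) N] :
    k →+* AddMonoid.End (Coind k i N) where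
  toFun a := 
    { toFun f := ⟨fun x => single (1 : K) a • f x, fun κ x => by
        beta_reduce
        rw [equivariant, single_smul_comm]⟩
      map_zero' := by ext x; simp
      map_add' f f' := by ext x; simp }
  map_one' := by ext f x; exact single_one_one_smul _
  map_mul' a b := by
    ext f x
    change single (1 : K) (a * b) • f x = single (1 : K) a • single (1 : K) b • f x
    rw [smul_smul, MonoidAlgebra.single_mul_single, one_mul]
  map_zero' := by
    ext f x
    change single (1 : K) (0 : k) • f x = 0
    simp
  map_add' a b := by
    ext f x
    change single (1 : K) (a + b) • f x = single (1 : K) a • f x + single (1 : K) b • f x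
    rw [← add_smul, MonoidAlgebra.single_add]

/-- The translation action on the coinduced module. -/
def translation (k : Type) [Ring k] {G K : Type} [Group G] [Group K] (i : K →* G)
    (N : Type) [AddCommGroup N] [Module (MonoidAlgebra k K) N] :
    G →* AddMonoid.End (Coind k i N) where
  toFun g :=
    { toFun f := ⟨fun x => f (x * g), fun κ x => by beta_reduce; rw [mul_assoc, equivariant]⟩
      map_zero' := rfl
      map_add' f f' := rfl }
  map_one' := by
    ext f x
    exact congrArg f (mul_one x)
  map_mul' g h := by
    ext f x
    exact congrArg f (mul_assoc x g h).symm

instance : Module (MonoidAlgebra k G) (Coind k i N) :=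
  groupRingModule (scalar k i N) (translation k i N) fun _ _ => rfl

theorem single_smul_apply (g : G) (a : k) (f : Coind k i N) (x : G) :
    (single g a • f) x = single (1 : K) a • f (x * g) :=
  congrFun (congrArg Subtype.val
    (groupRingModule_single_smul (scalar k i N) (translation k i N) (fun _ _ => rfl) g a f)) x

/-- Functoriality of coinduction. -/
def map (i : K →* G) (φ : N →ₗ[MonoidAlgebra k K] N') :
    Coind k i N →ₗ[MonoidAlgebra k G] Coind k i N' :=
  groupRingLinear
    { toFun f := ⟨fun x => φ (f x), fun κ x => by beta_reduce; rw [equivariant, map_smul]⟩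
      map_zero' := by ext x; exact map_zero φ
      map_add' f f' := by ext x; exact map_add φ _ _ }
    (fun a f => by
      ext x
      change φ _ = _
      rw [single_smul_apply, single_smul_apply, map_smul]
      rfl)
    (fun g f => by
      ext x
      change φ _ = _
      rw [single_smul_apply, single_smul_apply, map_smul]
      rfl)

@[simp]
theorem map_apply (φ : N →ₗ[MonoidAlgebra k K] N') (f : Coind k i N) (x : G) :
    map i φ f x = φ (f x) := rfl

/-- A coinduced function is freely determined by its values on representatives of right cosets. -/
theorem exists_of_representatives (hi : Function.Injective i) (φ : G → N) :
    ∃ (f : Coind k i N) (r : G → G), (∀ x, ∃ κ, i κ * r x = x) ∧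
      ∀ x κ, i κ * r x = x → f x = single κ (1 : k) • φ (r x) := by
  let r : G → G := fun x => (Quotient.out (s := QuotientGroup.rightRel i.range) ⟦x⟧)
  have hr : ∀ x, ∃ κ, i κ * r x = x := by
    intro x
    have h := Quotient.mk_out (s := QuotientGroup.rightRel i.range) x
    obtain ⟨κ, hκ⟩ := QuotientGroup.rightRel_apply.1 h
    exact ⟨κ, by rw [hκ]; simp [r]⟩
  have hr' : ∀ κ x, r (i κ * x) = r x := by
    intro κ x
    refine congrArg (Quotient.out (s := QuotientGroup.rightRel i.range)) (Quotient.sound ?_)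
    exact QuotientGroup.rightRel_apply.2 ⟨κ⁻¹, by simp⟩
  choose κ hκ using hr
  have huniq : ∀ x κ', i κ' * r x = x → κ' = κ x := fun x κ' h =>
    hi (mul_right_cancel (h.trans (hκ x).symm))
  refine ⟨⟨fun x => single (κ x) (1 : k) • φ (r x), fun κ' x => ?_⟩, r, fun x => ⟨_, hκ x⟩, ?_⟩
  · have : κ' * κ x = κ (i κ' * x) := huniq _ _ (by rw [hr', map_mul, mul_assoc, hκ])
    change single (κ (i κ' * x)) (1 : k) • φ (r (i κ' * x)) = _
    rw [hr', ← this, single_mul_smul]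
  · intro x κ' h
    rw [huniq x κ' h]

theorem map_surjective (hi : Function.Injective i) {φ : N →ₗ[MonoidAlgebra k K] N'}
    (hφ : Function.Surjective φ) : Function.Surjective (map i φ) := by
  intro f
  choose s hs using hφ
  obtain ⟨f', r, hr, hf'⟩ := exists_of_representatives (k := k) hi (fun x => s (f x))
  refine ⟨f', ext fun x => ?_⟩
  obtain ⟨κ, hκ⟩ := hr x
  rw [map_apply, hf' x κ hκ, map_smul, hs, ← equivariant, hκ]

/-- Coinduction commutes with kernels. -/
def kerEquiv (i : K →* G) (φ : N →ₗ[MonoidAlgebra k K] N') :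
    Coind k i (LinearMap.ker φ) ≃ₗ[MonoidAlgebra k G] LinearMap.ker (map i φ) := by
  refine LinearEquiv.ofBijective ((map i (LinearMap.ker φ).subtype).codRestrict _ ?_) ⟨?_, ?_⟩
  · intro f
    rw [LinearMap.mem_ker]
    ext x
    exact (f x).2
  · intro f f' h
    ext x
    exact congrFun (congrArg Subtype.val (congrArg Subtype.val h)) x
  · rintro ⟨f, hf⟩
    rw [LinearMap.mem_ker] at hf
    refine ⟨⟨fun x => ⟨f x, congrFun (congrArg Subtype.val hf) x⟩, fun κ x => ?_⟩, rfl⟩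
    exact Subtype.ext (f.2 κ x)

/-- The comparison of a free module with the coinduction of a free module. -/
def ofFree (hi : Function.Injective i) (n : ℕ) :
    (Fin n → MonoidAlgebra k G) →ₗ[MonoidAlgebra k G] Coind k i (Fin n → MonoidAlgebra k K) :=
  groupRingLinear
    { toFun b := ⟨fun x j => MonoidAlgebra.comapDomain (fun κ => x⁻¹ * i κ)
        ((mul_right_injective x⁻¹).comp hi) (b j), fun κ x => by
          ext j l
          simp [mul_assoc]⟩
      map_zero' := by
        ext x j l
        simp
      map_add' b b' := by
        ext x j l
        simp }
    (fun a b => by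
      ext x j l
      rw [single_smul_apply]
      simp)
    (fun g b => by
      ext x j l
      rw [single_smul_apply]
      simp [mul_assoc])

theorem ofFree_coeff (hi : Function.Injective i) (n : ℕ) (b : Fin n → MonoidAlgebra k G) (x : G)
    (j : Fin n) (κ : K) : ((ofFree hi n b) x j).coeff κ = (b j).coeff (x⁻¹ * i κ) := by
  change (MonoidAlgebra.comapDomain (fun κ => x⁻¹ * i κ) ((mul_right_injective x⁻¹).comp hi)
    (b j)).coeff κ = _
  simp

theorem ofFree_bijective (hi : Function.Injective i) [i.range.FiniteIndex] (n : ℕ) :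
    Function.Bijective (ofFree (k := k) hi n) := by
  constructor
  · intro b b' h
    ext j g
    have := ofFree_coeff hi n b g⁻¹ j 1
    rw [h, ofFree_coeff] at this
    simpa using this.symm
  · intro f
    have hfin : ∀ j, (Function.support fun g => (f g⁻¹ j).coeff 1).Finite := by
      intro j
      have hT : (Set.range fun q : Quotient (QuotientGroup.rightRel i.range) => q.out).Finite := by
        have : Finite (Quotient (QuotientGroup.rightRel i.range)) :=
          Finite.of_equiv _ (QuotientGroup.quotientRightRelEquivQuotientLeftRel i.range).symm
        exact Set.finite_range _
      refine (hT.biUnion (t := fun t => (fun κ => t⁻¹ * i κ) '' ((f t j).coeff.support : Set K))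
        fun t _ => (Finset.finite_toSet _).image _).subset fun g hg => ?_
      let t : G := (Quotient.out (s := QuotientGroup.rightRel i.range) ⟦g⁻¹⟧)
      have h := Quotient.mk_out (s := QuotientGroup.rightRel i.range) g⁻¹
      obtain ⟨κ, hκ⟩ := QuotientGroup.rightRel_apply.1 h
      have hκ' : i κ * t = g⁻¹ := by rw [hκ]; simp [t]
      refine Set.mem_biUnion (x := t) ⟨_, rfl⟩ ⟨κ⁻¹, ?_, ?_⟩
      · have hg' : (f g⁻¹ j).coeff 1 ≠ 0 := hg
        rw [← hκ', equivariant] at hg'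
        simpa using hg'
      · change t⁻¹ * i κ⁻¹ = g
        rw [← inv_inv g, ← hκ']
        simp
    refine ⟨fun j => .ofCoeff (Finsupp.ofSupportFinite _ (hfin j)), ?_⟩
    ext x j κ
    rw [ofFree_coeff]
    change (f (x⁻¹ * i κ)⁻¹ j).coeff 1 = _
    rw [mul_inv_rev, inv_inv, ← map_inv, equivariant]
    simp

theorem isProjGen (hi : Function.Injective i) [i.range.FiniteIndex] {n : ℕ}
    (h : IsProjGen (MonoidAlgebra k K) N n) : IsProjGen (MonoidAlgebra k G) (Coind k i N) n := by
  obtain ⟨hP, h, hh⟩ := h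
  obtain ⟨s, hs⟩ := Module.projective_lifting_property h LinearMap.id hh
  let e := LinearEquiv.ofBijective _ (ofFree_bijective (k := k) hi n)
  have hF : IsProjGen (MonoidAlgebra k G) (Coind k i (Fin n → MonoidAlgebra k K)) n :=
    ⟨Module.Projective.of_equiv e, e.toLinearMap, e.surjective⟩
  refine hF.of_retract (map i s) (map i h) ?_
  ext f x
  exact LinearMap.congr_fun hs (f x)

end Coind

theorem HasRes.coind {i : K →* G} (hi : Function.Injective i) [i.range.FiniteIndex]
    {N : Type} [AddCommGroup N] [Module (MonoidAlgebra k K) N] {b : ℕ → ℕ}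
    (h : HasRes (MonoidAlgebra k K) N b) : HasRes (MonoidAlgebra k G) (Coind k i N) b := by
  refine ⟨fun X _ _ c => ∃ (N : Type) (_ : AddCommGroup N) (_ : Module (MonoidAlgebra k K) N)
    (_ : X ≃ₗ[MonoidAlgebra k G] Coind k i N), HasRes (MonoidAlgebra k K) N c,
    ⟨N, _, _, LinearEquiv.refl _ _, h⟩, ?_⟩
  rintro X _ _ c ⟨N, _, _, e, hN⟩
  obtain ⟨P, _, _, f, hP, hf, hS⟩ := hN.step
  refine ⟨Coind k i P, _, inferInstance, e.symm.toLinearMap ∘ₗ Coind.map i f, Coind.isProjGen hi hP,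
    e.symm.surjective.comp (Coind.map_surjective hi hf), _, _, inferInstance, ?_, hS⟩
  exact (LinearEquiv.ofEq _ _ (LinearEquiv.ker_comp _ _)).trans (Coind.kerEquiv i f).symm

/-- The unit of the adjunction between restriction and coinduction. -/
def toCoind (k : Type) [Ring k] (i : K →* G) (M : Type) [AddCommGroup M]
    [Module (MonoidAlgebra k G) M] :
    M →ₗ[MonoidAlgebra k G] Coind k i (GRst k i M) :=
  groupRingLinear
    { toFun m := ⟨fun x => Rst.equiv _ (single x (1 : k) • m), fun κ x => by
        rw [GRst.single_smul]
        beta_reduce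
        rw [single_mul_smul]
        rfl⟩
      map_zero' := by
        ext x
        simp
      map_add' m m' := by
        ext x
        simp }
    (fun a m => by
      ext x
      rw [Coind.single_smul_apply, GRst.single_smul]
      refine congrArg (Rst.equiv _) ?_
      change _ = _ • (Rst.equiv _).symm (Rst.equiv _ _)
      rw [AddEquiv.symm_apply_apply, map_one, mul_one, single_smul_comm])
    (fun g m => by
      ext x
      rw [Coind.single_smul_apply, single_one_one_smul]
      exact congrArg (Rst.equiv _) (single_mul_smul x g m).symm)

theorem toCoind_apply (i : K →* G) {M : Type} [AddCommGroup M] [Module (MonoidAlgebra k G) M]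
    (m : M) (x : G) : (toCoind k i M m) x = Rst.equiv _ (single x (1 : k) • m) := rfl

/-- Resolutions descend along bijective group homomorphisms. -/
theorem HasRes.of_bijective {i : K →* G} (hi : Function.Bijective i)
    {M : Type} [AddCommGroup M] [Module (MonoidAlgebra k G) M] {b : ℕ → ℕ}
    (h : HasRes (MonoidAlgebra k K) (GRst k i M) b) : HasRes (MonoidAlgebra k G) M b := by
  have : i.range.FiniteIndex := by
    rw [MonoidHom.range_eq_top.2 hi.2]
    infer_instance
  refine HasRes.of_equiv (LinearEquiv.ofBijective (toCoind k i M) ⟨?_, ?_⟩).symm (h.coind hi.1)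
  · intro m m' h
    have h1 := congrFun (congrArg Subtype.val h) 1
    rw [toCoind_apply, toCoind_apply, single_one_one_smul, single_one_one_smul] at h1
    exact (Rst.equiv _).injective h1
  · intro f
    refine ⟨(Rst.equiv _).symm (f.1 1), Coind.ext fun x => ?_⟩
    obtain ⟨κ, rfl⟩ := hi.2 x
    have := Coind.equivariant f κ 1
    rw [mul_one, GRst.single_smul] at this
    rw [toCoind_apply, this]

end Coind

/-- An integral multiplicative cocycle on a set with a group action. -/
structure SignCocycle (Q Λ : Type) [Group Q] [MulAction Q Λ] where
  /-- The underlying function. -/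
  toFun : Q → Λ → ℤ
  map_one : ∀ l, toFun 1 l = 1
  map_mul : ∀ g h l, toFun (g * h) l = toFun g (h • l) * toFun h l

namespace SignCocycle

variable {Q Λ : Type} [Group Q] [MulAction Q Λ]

instance : CoeFun (SignCocycle Q Λ) (fun _ => Q → Λ → ℤ) := ⟨toFun⟩

instance : One (SignCocycle Q Λ) := ⟨⟨fun _ _ => 1, fun _ => rfl, fun _ _ _ => rfl⟩⟩

theorem one_apply (g : Q) (l : Λ) : (1 : SignCocycle Q Λ) g l = 1 := rfl

theorem inv_mul (χ : SignCocycle Q Λ) (g : Q) (l : Λ) : χ g⁻¹ (g • l) * χ g l = 1 := by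
  rw [← χ.map_mul, inv_mul_cancel, χ.map_one]

theorem smul_eq_zero_iff (χ : SignCocycle Q Λ) (g : Q) (l : Λ) {A : Type} [AddCommGroup A] (x : A) :
    χ g l • x = 0 ↔ x = 0 := by
  refine ⟨fun h => ?_, fun h => by rw [h, smul_zero]⟩
  have h' := congrArg (fun y => χ g⁻¹ (g • l) • y) h
  simpa only [smul_smul, χ.inv_mul, one_smul, smul_zero] using h'

end SignCocycle

/-- Functions `Λ → M`, with group action twisted by the cocycle `χ`. -/
@[ext]
structure TwFun {G Q Λ : Type} [Group G] [Group Q] [MulAction Q Λ] (π : G →* Q)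
    (χ : SignCocycle Q Λ) (M : Type) where
  /-- The underlying function. -/
  toFun : Λ → M

namespace TwFun

variable {k : Type} [Ring k] {G Q Λ : Type} [Group G] [Group Q] [MulAction Q Λ] {π : G →* Q}
  {χ : SignCocycle Q Λ} {M : Type} [AddCommGroup M]

instance : CoeFun (TwFun π χ M) (fun _ => Λ → M) := ⟨toFun⟩

theorem toFun_injective {M : Type} : Function.Injective (toFun : TwFun π χ M → Λ → M) :=
  fun _ _ h => TwFun.ext h

instance : Zero (TwFun π χ M) := ⟨⟨0⟩⟩
instance : Add (TwFun π χ M) := ⟨fun φ ψ => ⟨φ.toFun + ψ.toFun⟩⟩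
instance : Neg (TwFun π χ M) := ⟨fun φ => ⟨-φ.toFun⟩⟩
instance : Sub (TwFun π χ M) := ⟨fun φ ψ => ⟨φ.toFun - ψ.toFun⟩⟩
instance : SMul ℕ (TwFun π χ M) := ⟨fun n φ => ⟨n • φ.toFun⟩⟩
instance : SMul ℤ (TwFun π χ M) := ⟨fun n φ => ⟨n • φ.toFun⟩⟩

instance : AddCommGroup (TwFun π χ M) :=
  toFun_injective.addCommGroup toFun rfl (fun _ _ => rfl) (fun _ => rfl) (fun _ _ => rfl)
    (fun _ _ => rfl) (fun _ _ => rfl)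

@[simp] theorem zero_apply (l : Λ) : (0 : TwFun π χ M) l = 0 := rfl
@[simp] theorem add_apply (φ ψ : TwFun π χ M) (l : Λ) : (φ + ψ) l = φ l + ψ l := rfl
@[simp] theorem neg_apply (φ : TwFun π χ M) (l : Λ) : (-φ) l = -φ l := rfl

variable [Module (MonoidAlgebra k G) M]

/-- The scalar action. -/
def scalar (k : Type) [Ring k] (π : G →* Q) (χ : SignCocycle Q Λ) (M : Type) [AddCommGroup M]
    [Module (MonoidAlgebra k G) M] : k →+* AddMonoid.End (TwFun π χ M) where
  toFun a :=
    { toFun φ := ⟨fun l => single (1 : G) a • φ l⟩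
      map_zero' := by ext l; simp
      map_add' φ ψ := by ext l; simp }
  map_one' := by ext φ l; exact single_one_one_smul _
  map_mul' a b := by
    ext φ l
    change single (1 : G) (a * b) • φ l = single (1 : G) a • single (1 : G) b • φ l
    rw [smul_smul, MonoidAlgebra.single_mul_single, one_mul]
  map_zero' := by
    ext φ l
    change single (1 : G) (0 : k) • φ l = 0
    simp
  map_add' a b := by
    ext φ l
    change single (1 : G) (a + b) • φ l = single (1 : G) a • φ l + single (1 : G) b • φ l
    rw [← add_smul, MonoidAlgebra.single_add]

/-- The twisted translation action. -/
def translation (k : Type) [Ring k] (π : G →* Q) (χ : SignCocycle Q Λ) (M : Type) [AddCommGroup M]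
    [Module (MonoidAlgebra k G) M] : G →* AddMonoid.End (TwFun π χ M) where
  toFun g :=
    { toFun φ := ⟨fun l => χ (π g) ((π g)⁻¹ • l) • single g (1 : k) • φ ((π g)⁻¹ • l)⟩
      map_zero' := by ext l; simp
      map_add' φ ψ := by ext l; simp }
  map_one' := by
    ext φ l
    change χ (π 1) ((π 1)⁻¹ • l) • single (1 : G) (1 : k) • φ ((π 1)⁻¹ • l) = φ l
    rw [map_one, inv_one, one_smul, χ.map_one, single_one_one_smul, one_smul]
  map_mul' g h := by
    ext φ l
    change χ (π (g * h)) ((π (g * h))⁻¹ • l) • single (g * h) (1 : k) • φ ((π (g * h))⁻¹ • l) =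
      χ (π g) ((π g)⁻¹ • l) • single g (1 : k) • χ (π h) ((π h)⁻¹ • (π g)⁻¹ • l) •
        single h (1 : k) • φ ((π h)⁻¹ • (π g)⁻¹ • l)
    rw [map_mul, mul_inv_rev, mul_smul, χ.map_mul, smul_inv_smul, single_mul_smul, mul_smul,
      smul_comm (single g (1 : k)) (χ (π h) _)]

theorem commute_scalar_translation (a : k) (g : G) :
    Commute (scalar k π χ M a) (translation k π χ M g) := by
  ext φ l
  change single (1 : G) a • χ (π g) ((π g)⁻¹ • l) • single g (1 : k) • φ ((π g)⁻¹ • l) =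
    χ (π g) ((π g)⁻¹ • l) • single g (1 : k) • single (1 : G) a • φ ((π g)⁻¹ • l)
  rw [single_smul_comm, smul_comm]

instance : Module (MonoidAlgebra k G) (TwFun π χ M) :=
  groupRingModule (scalar k π χ M) (translation k π χ M) commute_scalar_translation

theorem single_smul_apply (g : G) (a : k) (φ : TwFun π χ M) (l : Λ) :
    (single g a • φ) l = χ (π g) ((π g)⁻¹ • l) • single g a • φ ((π g)⁻¹ • l) := by
  refine (congrFun (congrArg toFun (groupRingModule_single_smul (scalar k π χ M)
    (translation k π χ M) commute_scalar_translation g a φ)) l).trans ?_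
  change single (1 : G) a • χ (π g) ((π g)⁻¹ • l) • single g (1 : k) • φ ((π g)⁻¹ • l) = _
  rw [smul_comm, ← single_smul_eq]

theorem scalar_smul_apply (a : k) (φ : TwFun π χ M) (l : Λ) :
    (single (1 : G) a • φ) l = single (1 : G) a • φ l := by
  rw [single_smul_apply, map_one, inv_one, one_smul, χ.map_one, one_smul]

end TwFun

/-- An additive subgroup stable under scalars and group elements is a submodule. -/
def groupRingSubmodule {k : Type} [Ring k] {G : Type} [Group G] {V : Type} [AddCommGroup V]
    [Module (MonoidAlgebra k G) V] (A : AddSubgroup V)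
    (hA : ∀ (g : G) (a : k), ∀ v ∈ A, single g a • v ∈ A) : Submodule (MonoidAlgebra k G) V :=
  { A with
    smul_mem' := fun r v hv => by
      induction r using MonoidAlgebra.induction_linear with
      | zero => rw [zero_smul]; exact A.zero_mem
      | add r s hr hs => rw [add_smul]; exact A.add_mem hr hs
      | single g a => exact hA g a v hv }

namespace TwFun

variable {k : Type} [Ring k] {G Q Λ : Type} [Group G] [Group Q] [MulAction Q Λ]

/-- The submodule of functions supported on an invariant set. -/
def supp (k : Type) [Ring k] (π : G →* Q) (χ : SignCocycle Q Λ) (M : Type) [AddCommGroup M]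
    [Module (MonoidAlgebra k G) M] (s : Set Λ) (hs : ∀ (g : Q), ∀ l ∈ s, g • l ∈ s) :
    Submodule (MonoidAlgebra k G) (TwFun π χ M) :=
  groupRingSubmodule
    { carrier := {φ | ∀ l, l ∉ s → φ l = 0}
      zero_mem' := fun _ _ => rfl
      add_mem' := fun {φ ψ} hφ hψ l hl => by rw [add_apply, hφ l hl, hψ l hl, add_zero]
      neg_mem' := fun {φ} hφ l hl => by rw [neg_apply, hφ l hl, neg_zero] }
    (fun g a φ hφ l hl => by
      rw [single_smul_apply, hφ, smul_zero, smul_zero]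
      intro h
      apply hl
      have := hs (π g) _ h
      rwa [smul_inv_smul] at this)

theorem mem_supp {π : G →* Q} {χ : SignCocycle Q Λ} {M : Type} [AddCommGroup M]
    [Module (MonoidAlgebra k G) M] {s : Set Λ} {hs : ∀ (g : Q), ∀ l ∈ s, g • l ∈ s}
    {φ : TwFun π χ M} : φ ∈ supp k π χ M s hs ↔ ∀ l, l ∉ s → φ l = 0 := Iff.rfl

end TwFun

/-- The value group of `TwFun` at a point `l`, as a module over the stabilizer of `l`. -/
def TwPt {G Q Λ : Type} [Group G] [Group Q] [MulAction Q Λ] (_ : G →* Q)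
    (_ : SignCocycle Q Λ) (_ : Λ) (M : Type) : Type := M

namespace TwPt

variable {k : Type} [Ring k] {G Q Λ : Type} [Group G] [Group Q] [MulAction Q Λ] {π : G →* Q}
  {χ : SignCocycle Q Λ} {l : Λ} {M : Type} [AddCommGroup M]

instance : AddCommGroup (TwPt π χ l M) := inferInstanceAs (AddCommGroup M)

/-- The underlying group of `TwPt`. -/
def equiv (π : G →* Q) (χ : SignCocycle Q Λ) (l : Λ) {M : Type} [AddCommGroup M] :
    M ≃+ TwPt π χ l M := AddEquiv.refl M

variable [Module (MonoidAlgebra k G) M]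

/-- The scalar action. -/
def scalar (k : Type) [Ring k] (π : G →* Q) (χ : SignCocycle Q Λ) (l : Λ) (M : Type)
    [AddCommGroup M] [Module (MonoidAlgebra k G) M] : k →+* AddMonoid.End (TwPt π χ l M) :=
  scalarEnd k G M

/-- The twisted action of the stabilizer. -/
def action (k : Type) [Ring k] (π : G →* Q) (χ : SignCocycle Q Λ) (l : Λ) (M : Type)
    [AddCommGroup M] [Module (MonoidAlgebra k G) M] :
    ((MulAction.stabilizer Q l).comap π) →* AddMonoid.End (TwPt π χ l M) where
  toFun κ :=
    { toFun m := equiv π χ l (χ (π κ) l • single (κ : G) (1 : k) • (equiv π χ l).symm m)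
      map_zero' := by simp
      map_add' φ ψ := by simp }
  map_one' := by
    ext m
    change equiv π χ l (χ (π (1 : G)) l • single (1 : G) (1 : k) • (equiv π χ l).symm m) = m
    rw [map_one, χ.map_one, single_one_one_smul, one_smul, AddEquiv.apply_symm_apply]
  map_mul' κ κ' := by
    ext m
    change equiv π χ l (χ (π (κ * κ')) l • single (κ * κ' : G) (1 : k) • (equiv π χ l).symm m) =
      equiv π χ l (χ (π κ) l • single (κ : G) (1 : k) • (equiv π χ l).symm
        (equiv π χ l (χ (π κ') l • single (κ' : G) (1 : k) • (equiv π χ l).symm m)))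
    have h : π κ' • l = l := κ'.2
    rw [AddEquiv.symm_apply_apply, map_mul, χ.map_mul, h, mul_smul, single_mul_smul,
      smul_comm (single (κ : G) (1 : k)) (χ (π κ') l)]

theorem commute_scalar_action (a : k) (κ : (MulAction.stabilizer Q l).comap π) :
    Commute (scalar k π χ l M a) (action k π χ l M κ) := by
  ext m
  change equiv π χ l (single (1 : G) a • χ (π κ) l • single (κ : G) (1 : k) •
    (equiv π χ l).symm m) = equiv π χ l (χ (π κ) l • single (κ : G) (1 : k) •
      single (1 : G) a • (equiv π χ l).symm m)
  rw [single_smul_comm, smul_comm]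

instance : Module (MonoidAlgebra k ((MulAction.stabilizer Q l).comap π)) (TwPt π χ l M) :=
  groupRingModule (scalar k π χ l M) (action k π χ l M) commute_scalar_action

theorem single_smul (κ : (MulAction.stabilizer Q l).comap π) (a : k) (m : TwPt π χ l M) :
    single κ a • m = equiv π χ l (χ (π κ) l • single (κ : G) a • (equiv π χ l).symm m) := by
  refine (groupRingModule_single_smul (scalar k π χ l M) (action k π χ l M)
    commute_scalar_action κ a m).trans ?_
  change equiv π χ l (single (1 : G) a • χ (π κ) l • single (κ : G) (1 : k) •
    (equiv π χ l).symm m) = _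
  rw [smul_comm, ← single_smul_eq]

/-- Evaluation of twisted functions at the orbit of a point. -/
def eval (k : Type) [Ring k] (π : G →* Q) (χ : SignCocycle Q Λ) (l : Λ) (M : Type)
    [AddCommGroup M] [Module (MonoidAlgebra k G) M] :
    TwFun π χ M →ₗ[MonoidAlgebra k G]
      Coind k ((MulAction.stabilizer Q l).comap π).subtype (TwPt π χ l M) :=
  groupRingLinear
    { toFun φ := ⟨fun x => equiv π χ l ((single x (1 : k) • φ) l), fun κ x => by
        have h : (π (κ : G))⁻¹ • l = l := inv_smul_eq_iff.2 (MulAction.mem_stabilizer_iff.1 κ.2).symm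
        beta_reduce
        rw [single_smul, AddEquiv.symm_apply_apply, Subgroup.subtype_apply, single_mul_smul,
          TwFun.single_smul_apply (κ : G), h]⟩
      map_zero' := by
        ext x
        simp
      map_add' φ ψ := by
        ext x
        simp }
    (fun a φ => by
      ext x
      rw [Coind.single_smul_apply]
      change equiv π χ l ((single x (1 : k) • single (1 : G) a • φ) l) =
        single 1 a • equiv π χ l ((single (x * 1) (1 : k) • φ) l)
      rw [mul_one, single_smul, AddEquiv.symm_apply_apply, single_smul_comm,
        TwFun.scalar_smul_apply]
      change _ = equiv π χ l (χ (π (1 : G)) l • single (1 : G) a • _)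
      rw [map_one, χ.map_one, one_smul])
    (fun g φ => by
      ext x
      rw [Coind.single_smul_apply, single_one_one_smul]
      change equiv π χ l ((single x (1 : k) • single g (1 : k) • φ) l) =
        equiv π χ l ((single (x * g) (1 : k) • φ) l)
      rw [single_mul_smul])

theorem eval_apply (φ : TwFun π χ M) (x : G) :
    (eval k π χ l M φ) x =
      equiv π χ l (χ (π x) ((π x)⁻¹ • l) • single x (1 : k) • φ ((π x)⁻¹ • l)) := by
  rw [← TwFun.single_smul_apply]
  rfl

/-- A function in the kernel of the evaluation vanishes on the orbit. -/
theorem eval_eq_zero_iff (hπ : Function.Surjective π) (φ : TwFun π χ M) :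
    eval k π χ l M φ = 0 ↔ ∀ m ∈ MulAction.orbit Q l, φ m = 0 := by
  constructor
  · rintro h _ ⟨q, rfl⟩
    obtain ⟨g, rfl⟩ := hπ q
    have := congrFun (congrArg Subtype.val h) g⁻¹
    rw [eval_apply, map_inv, inv_inv] at this
    change _ = (0 : TwPt π χ l M) at this
    rw [map_eq_zero_iff _ (equiv π χ l).injective, χ.smul_eq_zero_iff] at this
    have h2 := congrArg (fun m => single g (1 : k) • m) this
    simpa only [← single_mul_smul, mul_inv_cancel, single_one_one_smul, smul_zero] using h2
  · intro h
    ext x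
    rw [eval_apply, h _ ⟨(π x)⁻¹, rfl⟩, smul_zero, smul_zero, map_zero]
    rfl

/-- The evaluation is surjective on functions supported on the orbit. -/
theorem exists_eval_eq (hπ : Function.Surjective π)
    (f : Coind k ((MulAction.stabilizer Q l).comap π).subtype (TwPt π χ l M)) :
    ∃ φ : TwFun π χ M, (∀ m ∉ MulAction.orbit Q l, φ m = 0) ∧ eval k π χ l M φ = f := by
  classical
  have hg : ∀ m : Λ, ∃ g : G, m ∈ MulAction.orbit Q l → π g • l = m := by
    intro m
    by_cases hm : m ∈ MulAction.orbit Q l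
    · obtain ⟨q, rfl⟩ := hm
      obtain ⟨g, rfl⟩ := hπ q
      exact ⟨g, fun _ => rfl⟩
    · exact ⟨1, fun h => absurd h hm⟩
  choose g hg using hg
  refine ⟨⟨fun m => if m ∈ MulAction.orbit Q l then
    χ (π (g m)) l • single (g m) (1 : k) • (equiv π χ l).symm (f (g m)⁻¹) else 0⟩,
    fun m hm => if_neg hm, ?_⟩
  ext x
  set m := (π x)⁻¹ • l with hm
  have hmo : m ∈ MulAction.orbit Q l := ⟨_, rfl⟩
  have hgm := hg m hmo
  have hκ : π (x * g m) • l = l := by rw [map_mul, mul_smul, hgm, hm, smul_inv_smul]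
  let κ : (MulAction.stabilizer Q l).comap π := ⟨x * g m, hκ⟩
  have hx : x = ((MulAction.stabilizer Q l).comap π).subtype κ * (g m)⁻¹ := by
    simp [κ]
  have hfx : f x = single κ (1 : k) • f (g m)⁻¹ := by
    rw [← Coind.equivariant, ← hx]
  rw [eval_apply, hfx, single_smul, ← hm]
  dsimp only
  rw [if_pos hmo]
  change _ = equiv π χ l (χ (π (x * g m)) l • single (x * g m) (1 : k) • _)
  rw [smul_comm (single x (1 : k)), smul_smul, ← single_mul_smul, map_mul, χ.map_mul, hgm]

/-- Over a group in the kernel of `π`, the twist is invisible. -/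
theorem hasRes_restrict {Γ : Type} [Group Γ] {i : Γ →* G} (hi : ∀ γ, π (i γ) = 1)
    (j : Γ →* (MulAction.stabilizer Q l).comap π) (hj : ∀ γ, (j γ : G) = i γ) {a : ℕ → ℕ}
    (h : HasRes (MonoidAlgebra k Γ) (GRst k i M) a) :
    HasRes (MonoidAlgebra k Γ) (GRst k j (TwPt π χ l M)) a := by
  have key : ∀ (γ : Γ) (a : k) (m : GRst k i M),
      (((Rst.equiv (MonoidAlgebra.mapDomainRingHom k i)).symm.trans (equiv π χ l)).trans
        (Rst.equiv (MonoidAlgebra.mapDomainRingHom k j))) (single γ a • m) =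
      single γ a • (((Rst.equiv (MonoidAlgebra.mapDomainRingHom k i)).symm.trans
        (equiv π χ l)).trans (Rst.equiv (MonoidAlgebra.mapDomainRingHom k j))) m := by
    intro γ a m
    rw [GRst.single_smul, GRst.single_smul, single_smul]
    simp only [AddEquiv.trans_apply, AddEquiv.symm_apply_apply, hj, hi, χ.map_one, one_smul]
  refine h.of_equiv (LinearEquiv.ofBijective (groupRingLinear
    (((Rst.equiv (MonoidAlgebra.mapDomainRingHom k i)).symm.trans (equiv π χ l)).trans
      (Rst.equiv (MonoidAlgebra.mapDomainRingHom k j))).toAddMonoidHom ?_ ?_) ?_)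
  · exact fun a m => key 1 a m
  · exact fun g m => key g 1 m
  · exact AddEquiv.bijective _

end TwPt

section Orbits

theorem mk_smul_mem {Q Λ : Type} [Group Q] [MulAction Q Λ]
    (T : Finset (MulAction.orbitRel.Quotient Q Λ)) (g : Q)
    (l : Λ) (hl : (⟦l⟧ : MulAction.orbitRel.Quotient Q Λ) ∈ T) :
    (⟦g • l⟧ : MulAction.orbitRel.Quotient Q Λ) ∈ T := by
  have : (⟦g • l⟧ : MulAction.orbitRel.Quotient Q Λ) = ⟦l⟧ := Quotient.sound ⟨g, rfl⟩
  rwa [this]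

variable {k : Type} [Ring k] {G Q Λ Γ : Type} [Group G] [Group Q] [Finite Q] [MulAction Q Λ]
  [Group Γ]

/-- Every `k[G]`-module whose restriction along `i` has a resolution bounded by `a` has
a resolution bounded by `b`. -/
def Transfers (k : Type) [Ring k] {G Γ : Type} [Group G] [Group Γ] (i : Γ →* G)
    (a b : ℕ → ℕ) : Prop :=
  ∀ (M : Type) [AddCommGroup M] [Module (MonoidAlgebra k G) M],
    HasRes (MonoidAlgebra k Γ) (GRst k i M) a → HasRes (MonoidAlgebra k G) M b

/-- The inclusion of the kernel into the preimage of a subgroup. -/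
def toComap (π : G →* Q) (i : Γ →* G) (hi : ∀ γ, π (i γ) = 1) (K : Subgroup Q) :
    Γ →* K.comap π :=
  i.codRestrict _ fun γ => by
    rw [Subgroup.mem_comap, hi]
    exact K.one_mem

theorem TwFun.hasRes_supp_orbits {π : G →* Q} (hπ : Function.Surjective π) {i : Γ →* G}
    (hi : ∀ γ, π (i γ) = 1) (χ : SignCocycle Q Λ) {a : ℕ → ℕ}
    (b : MulAction.orbitRel.Quotient Q Λ → ℕ → ℕ)
    (T : Finset (MulAction.orbitRel.Quotient Q Λ))
    (hb : ∀ o ∈ T, Transfers k (toComap π i hi (MulAction.stabilizer Q o.out)) a (b o))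
    {M : Type} [AddCommGroup M] [Module (MonoidAlgebra k G) M]
    (hM : HasRes (MonoidAlgebra k Γ) (GRst k i M) a) :
    HasRes (MonoidAlgebra k G)
      (supp k π χ M {l | (⟦l⟧ : MulAction.orbitRel.Quotient Q Λ) ∈ T} (mk_smul_mem T))
      (∑ o ∈ T, b o) := by
  classical
  induction T using Finset.induction_on with
  | empty =>
    have : Subsingleton (supp k π χ M
        {l | (⟦l⟧ : MulAction.orbitRel.Quotient Q Λ) ∈ (∅ : Finset _)} (mk_smul_mem ∅)) := by
      refine subsingleton_of_forall_eq 0 ?_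
      rintro ⟨φ, hφ⟩
      exact Subtype.ext (TwFun.ext (funext fun l => hφ l (Finset.notMem_empty _)))
    exact HasRes.of_subsingleton _
  | insert o T ho ih =>
    rw [Finset.sum_insert ho, add_comm]
    have horb : ∀ m : Λ, m ∈ MulAction.orbit Q o.out ↔
        (⟦m⟧ : MulAction.orbitRel.Quotient Q Λ) = o := by
      intro m
      conv_rhs => rw [← Quotient.out_eq o]
      exact (Quotient.eq (r := MulAction.orbitRel Q Λ) (x := m) (y := o.out)).symm
    have hC : HasRes (MonoidAlgebra k G) (Coind k
        ((MulAction.stabilizer Q o.out).comap π).subtype (TwPt π χ o.out M)) (b o) := by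
      have : ((MulAction.stabilizer Q o.out).comap π).subtype.range.FiniteIndex := by
        rw [Subgroup.range_subtype]
        exact ⟨by rw [Subgroup.index_comap_of_surjective _ hπ]; exact Subgroup.FiniteIndex.index_ne_zero⟩
      refine HasRes.coind (Subgroup.subtype_injective _) (hb o (Finset.mem_insert_self _ _) _ ?_)
      exact TwPt.hasRes_restrict hi _ (fun _ => rfl) hM
    refine HasRes.ext (i := Submodule.inclusion ?_)
      (q := TwPt.eval k π χ o.out M ∘ₗ Submodule.subtype _) ?_ ?_ ?_
      (ih fun o' ho' => hb o' (Finset.mem_insert_of_mem ho')) hC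
    · intro φ hφ l hl
      exact hφ l fun h => hl (Finset.mem_insert_of_mem h)
    · exact Submodule.inclusion_injective _
    · intro f
      obtain ⟨φ, hφ, hf⟩ := TwPt.exists_eval_eq hπ f
      refine ⟨⟨φ, fun l hl => hφ l fun h => hl ?_⟩, hf⟩
      change ⟦l⟧ ∈ insert o T
      rw [(horb l).1 h]
      exact Finset.mem_insert_self _ _
    · rintro ⟨φ, hφ⟩
      change TwPt.eval k π χ o.out M φ = 0 ↔ _
      rw [TwPt.eval_eq_zero_iff hπ]
      constructor
      · intro h
        refine ⟨⟨φ, fun l hl => ?_⟩, rfl⟩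
        by_cases hlo : (⟦l⟧ : MulAction.orbitRel.Quotient Q Λ) = o
        · exact h l ((horb l).2 hlo)
        · exact hφ l fun h => (Finset.mem_insert.1 h).elim hlo hl
      · rintro ⟨⟨ψ, hψ⟩, h⟩ m hm
        obtain rfl : ψ = φ := congrArg Subtype.val h
        refine hψ m fun h' => ho ?_
        rwa [← (horb m).1 hm]

theorem TwFun.hasRes_supp [Finite Λ] {π : G →* Q} (hπ : Function.Surjective π) {i : Γ →* G}
    (hi : ∀ γ, π (i γ) = 1) (χ : SignCocycle Q Λ) {a : ℕ → ℕ}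
    (s : Set Λ) (hs : ∀ (g : Q), ∀ l ∈ s, g • l ∈ s) (P : (ℕ → ℕ) → Prop) (hP0 : P 0)
    (hP : ∀ x y, P x → P y → P (x + y))
    (hb : ∀ l ∈ s, ∃ b, P b ∧ Transfers k (toComap π i hi (MulAction.stabilizer Q l)) a b) :
    ∃ b, P b ∧ ∀ (M : Type) [AddCommGroup M] [Module (MonoidAlgebra k G) M],
      HasRes (MonoidAlgebra k Γ) (GRst k i M) a →
      HasRes (MonoidAlgebra k G) (supp k π χ M s hs) b := by
  classical
  have := Fintype.ofFinite (MulAction.orbitRel.Quotient Q Λ)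
  have hex : ∀ o : MulAction.orbitRel.Quotient Q Λ, ∃ b, P b ∧ (o.out ∈ s →
      Transfers k (toComap π i hi (MulAction.stabilizer Q o.out)) a b) := by
    intro o
    by_cases ho : o.out ∈ s
    · obtain ⟨b, h1, h2⟩ := hb _ ho
      exact ⟨b, h1, fun _ => h2⟩
    · exact ⟨0, hP0, fun h => absurd h ho⟩
  choose b hbP hb' using hex
  let T : Finset (MulAction.orbitRel.Quotient Q Λ) := Finset.univ.filter fun o => o.out ∈ s
  refine ⟨∑ o ∈ T, b o, ?_, ?_⟩
  · exact Finset.sum_induction _ P hP hP0 fun o _ => hbP o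
  · intro M _ _ hM
    have hsT : {l | (⟦l⟧ : MulAction.orbitRel.Quotient Q Λ) ∈ T} = s := by
      ext l
      simp only [T, Finset.mem_filter, Finset.mem_univ, true_and, Set.mem_ofPred_eq]
      obtain ⟨g, hg⟩ : (MulAction.orbitRel Q Λ) (⟦l⟧ : MulAction.orbitRel.Quotient Q Λ).out l :=
        Quotient.mk_out (s := MulAction.orbitRel Q Λ) l
      have hg' : g • l = (⟦l⟧ : MulAction.orbitRel.Quotient Q Λ).out := hg
      rw [← hg']
      refine ⟨fun h => ?_, fun h => hs g l h⟩
      have := hs g⁻¹ _ h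
      rwa [inv_smul_smul] at this
    have h := TwFun.hasRes_supp_orbits hπ hi χ b T
      (fun o ho => hb' o (Finset.mem_filter.1 ho).2) hM
    exact h.of_equiv (LinearEquiv.ofEq _ _ (by ext φ; simp only [mem_supp, hsT]))

end Orbits

/-- A finite set `X` fibred over `Ω` by the orbits of a permutation `z`, with a sign rule on `Ω`. -/
structure CyclicFibration (X Ω : Type) where
  /-- The projection. -/
  q : X → Ω
  q_surjective : Function.Surjective q
  /-- The permutation whose orbits are the fibres. -/
  z : Equiv.Perm X
  q_z : ∀ x, q (z x) = q x
  exists_pow : ∀ x y, q x = q y → ∃ n : ℕ, (z ^ n) x = y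
  /-- The sign rule. -/
  sgn : Ω → Ω → ℤ
  sgn_self : ∀ a, sgn a a = 0
  sgn_swap : ∀ a b, sgn a b = -sgn b a
  sgn_sq : ∀ a b, a ≠ b → sgn a b * sgn a b = 1

namespace CyclicFibration

variable {X Ω : Type} [Fintype X] [DecidableEq X] [Fintype Ω] [DecidableEq Ω]
  (D : CyclicFibration X Ω) {A : Type} [AddCommGroup A]

/-- The sign of moving `a` past all elements of `U`. -/
def eps {X Ω : Type} (D : CyclicFibration X Ω) (a : Ω) (U : Finset Ω) : ℤ := ∏ b ∈ U, D.sgn a b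

section eps

variable {X Ω : Type} [DecidableEq Ω] (D : CyclicFibration X Ω)

theorem eps_of_mem {a : Ω} {U : Finset Ω} (h : a ∈ U) : D.eps a U = 0 :=
  Finset.prod_eq_zero h (D.sgn_self a)

theorem eps_insert {a b : Ω} {U : Finset Ω} (h : b ∉ U) :
    D.eps a (insert b U) = D.sgn a b * D.eps a U := Finset.prod_insert h

theorem eps_sq {a : Ω} {U : Finset Ω} (h : a ∉ U) : D.eps a U * D.eps a U = 1 := by
  rw [eps, ← Finset.prod_mul_distrib]
  exact Finset.prod_eq_one fun b hb => D.sgn_sq a b fun hab => h (hab ▸ hb)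

theorem eps_insert_mul_eps (a b : Ω) (U : Finset Ω) :
    D.eps a (insert b U) * D.eps b U = D.sgn a b * (D.eps a U * D.eps b U) := by
  by_cases hb : b ∈ U
  · rw [D.eps_of_mem hb, mul_zero, mul_zero, mul_zero]
  · rw [D.eps_insert hb, mul_assoc]

theorem eps_insert_mul_eps_insert {a b : Ω} (hab : a ≠ b) (U : Finset Ω) :
    D.eps a (insert b U) * D.eps b (insert a U) = -(D.eps a U * D.eps b U) := by
  by_cases hb : b ∈ U
  · rw [D.eps_of_mem hb, D.eps_of_mem (Finset.mem_insert_of_mem hb), mul_zero, mul_zero, neg_zero]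
  by_cases ha : a ∈ U
  · rw [D.eps_of_mem ha, D.eps_of_mem (Finset.mem_insert_of_mem ha), zero_mul, zero_mul, neg_zero]
  rw [D.eps_insert hb, D.eps_insert ha, D.sgn_swap b a]
  have := D.sgn_sq a b hab
  linear_combination (-(D.eps a U * D.eps b U)) * this

end eps

/-- A finite set meeting every fibre at most once. -/
def Tr {X Ω : Type} (D : CyclicFibration X Ω) (σ : Finset X) : Prop := Set.InjOn D.q σ

/-- The functions supported on partial transversals of cardinality `j`. -/
def Sub {X Ω : Type} (D : CyclicFibration X Ω) {A : Type} [AddCommGroup A] (j : ℕ) :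
    AddSubgroup (Finset X → A) where
  carrier := {φ | ∀ σ, ¬ (D.Tr σ ∧ σ.card = j) → φ σ = 0}
  zero_mem' _ _ := rfl
  add_mem' hφ hψ σ hσ := by rw [Pi.add_apply, hφ σ hσ, hψ σ hσ, add_zero]
  neg_mem' hφ σ hσ := by rw [Pi.neg_apply, hφ σ hσ, neg_zero]

/-- Contraction with `t`. -/
def ins (t : X) : AddMonoid.End (Finset X → A) where
  toFun φ σ := D.eps (D.q t) (σ.image D.q) • φ (insert t σ)
  map_zero' := by ext; simp
  map_add' φ ψ := by ext; simp

/-- Multiplication by `t`. -/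
def del (t : X) : AddMonoid.End (Finset X → A) where
  toFun φ σ := if t ∈ σ then D.eps (D.q t) ((σ.erase t).image D.q) • φ (σ.erase t) else 0
  map_zero' := by ext; simp
  map_add' φ ψ := by
    ext σ
    by_cases h : t ∈ σ <;> simp [h]

theorem ins_apply (t : X) (φ : Finset X → A) (σ : Finset X) :
    D.ins t φ σ = D.eps (D.q t) (σ.image D.q) • φ (insert t σ) := rfl

theorem del_apply (t : X) (φ : Finset X → A) (σ : Finset X) :
    D.del t φ σ = if t ∈ σ then D.eps (D.q t) ((σ.erase t).image D.q) • φ (σ.erase t) else 0 := rfl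

/-- The boundary operator. -/
def bd : AddMonoid.End (Finset X → A) := ∑ t, D.ins t

/-- The coboundary operator. -/
def cobd : AddMonoid.End (Finset X → A) := ∑ t, D.del t

theorem end_sum_apply {ι V : Type} [AddCommGroup V] (s : Finset ι) (f : ι → AddMonoid.End V)
    (v : V) : (∑ t ∈ s, f t) v = ∑ t ∈ s, f t v :=
  map_sum (AddMonoidHom.eval v : (V →+ V) →+ V) f s

theorem end_mul_apply {V : Type} [AddCommGroup V] (f g : AddMonoid.End V) (v : V) :
    (f * g) v = f (g v) := rfl

theorem bd_apply (φ : Finset X → A) : D.bd φ = ∑ t, D.ins t φ := end_sum_apply _ _ _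

theorem cobd_apply (φ : Finset X → A) : D.cobd φ = ∑ t, D.del t φ := end_sum_apply _ _ _

theorem sum_sum_eq_zero_of_antisymm {ι V : Type} [Fintype ι] [AddCommGroup V] (F : ι → ι → V)
    (h0 : ∀ s, F s s = 0) (h : ∀ s t, s ≠ t → F s t + F t s = 0) : ∑ s, ∑ t, F s t = 0 := by
  classical
  rw [← Finset.sum_product']
  refine Finset.sum_involution (fun p _ => p.swap) ?_ ?_ ?_ ?_
  · rintro ⟨s, t⟩ -
    by_cases hst : s = t
    · subst hst
      simp [h0]
    · exact h s t hst
  · rintro ⟨s, t⟩ - hne heq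
    have : t = s := congrArg Prod.fst heq
    subst this
    exact hne (h0 _)
  · intro p _
    exact Finset.mem_univ _
  · intro p _
    rfl

theorem ins_ins (s t : X) (φ : Finset X → A) : D.ins s (D.ins t φ) + D.ins t (D.ins s φ) = 0 := by
  ext σ
  simp only [Pi.add_apply, ins_apply, Finset.image_insert, smul_smul, Pi.zero_apply]
  rw [Finset.insert_comm s t, ← add_smul]
  have h1 := D.eps_insert_mul_eps (D.q t) (D.q s) (σ.image D.q)
  have h2 := D.eps_insert_mul_eps (D.q s) (D.q t) (σ.image D.q)
  rw [D.sgn_swap (D.q s)] at h2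
  convert zero_smul ℤ _
  linear_combination h1 + h2

theorem ins_self (t : X) (φ : Finset X → A) : D.ins t (D.ins t φ) = 0 := by
  ext σ
  simp only [ins_apply, Finset.image_insert, smul_smul, Pi.zero_apply]
  rw [D.eps_of_mem (Finset.mem_insert_self _ _), mul_zero, zero_smul]

theorem bd_bd (φ : Finset X → A) : D.bd (D.bd φ) = 0 := by
  simp only [bd_apply, map_sum]
  exact sum_sum_eq_zero_of_antisymm _ (fun s => D.ins_self s φ) fun s t _ => D.ins_ins t s φ

theorem del_del {s t : X} (hst : s ≠ t) (φ : Finset X → A) :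
    D.del s (D.del t φ) + D.del t (D.del s φ) = 0 := by
  ext σ
  simp only [Pi.add_apply, del_apply, Pi.zero_apply, Finset.mem_erase]
  by_cases hs : s ∈ σ
  swap
  · simp [hs]
  by_cases ht : t ∈ σ
  swap
  · simp [ht]
  simp only [hs, ht, hst, hst.symm, ne_eq, not_false_eq_true, and_self, if_true, smul_smul]
  rw [Finset.erase_right_comm (a := t) (b := s)]
  have h1 : σ.erase s = insert t ((σ.erase s).erase t) :=
    (Finset.insert_erase (Finset.mem_erase.2 ⟨hst.symm, ht⟩)).symm
  have h2 : σ.erase t = insert s ((σ.erase s).erase t) := by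
    rw [Finset.erase_right_comm]
    exact (Finset.insert_erase (Finset.mem_erase.2 ⟨hst, hs⟩)).symm
  rw [← add_smul]
  set τ := (σ.erase s).erase t
  rw [h1, h2, Finset.image_insert, Finset.image_insert, D.eps_insert_mul_eps,
    D.eps_insert_mul_eps, D.sgn_swap (D.q t)]
  convert zero_smul ℤ _
  ring

theorem del_self (t : X) (φ : Finset X → A) : D.del t (D.del t φ) = 0 := by
  ext σ
  simp [del_apply]

theorem cobd_cobd (φ : Finset X → A) : D.cobd (D.cobd φ) = 0 := by
  simp only [cobd_apply, map_sum]
  exact sum_sum_eq_zero_of_antisymm _ (fun s => D.del_self s φ) fun s t h => D.del_del h.symm φ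

theorem ins_del {s t : X} (hst : D.q s ≠ D.q t) (φ : Finset X → A) :
    D.ins s (D.del t φ) + D.del t (D.ins s φ) = 0 := by
  have hne : t ≠ s := fun h => hst (by rw [h])
  ext σ
  simp only [Pi.add_apply, del_apply, ins_apply, Pi.zero_apply, Finset.mem_insert, hne, false_or]
  by_cases ht : t ∈ σ
  swap
  · simp [ht]
  rw [if_pos ht, if_pos ht, Finset.erase_insert_of_ne hne.symm, smul_smul, smul_smul, ← add_smul]
  obtain ⟨τ, hτ⟩ : ∃ τ, τ = σ.erase t := ⟨_, rfl⟩
  have h1 : σ = insert t τ := by rw [hτ, Finset.insert_erase ht]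
  rw [← hτ, h1, Finset.image_insert, Finset.image_insert, D.eps_insert_mul_eps_insert hst]
  convert zero_smul ℤ _
  ring

/-- The contracting homotopy for the boundary. -/
theorem bd_del_add (t : X) (φ : Finset X → A) (σ : Finset X) :
    (D.bd (D.del t φ) + D.del t (D.bd φ)) σ =
      (if D.q t ∈ σ.image D.q then 0 else φ σ) +
        if t ∈ σ then ∑ s with D.q s = D.q t,
          (D.eps (D.q t) ((σ.erase t).image D.q) * D.eps (D.q t) ((σ.erase t).image D.q)) •
            φ (insert s (σ.erase t)) else 0 := by
  have h1 : D.bd (D.del t φ) + D.del t (D.bd φ) =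
      ∑ s with D.q s = D.q t, (D.ins s (D.del t φ) + D.del t (D.ins s φ)) := by
    rw [bd_apply, bd_apply, map_sum, ← Finset.sum_add_distrib]
    symm
    refine Finset.sum_subset (Finset.subset_univ _) fun s _ hs => D.ins_del ?_ φ
    simpa using hs
  rw [h1, Finset.sum_add_distrib, Pi.add_apply, Finset.sum_apply, Finset.sum_apply]
  congr 1
  · split_ifs with h
    · refine Finset.sum_eq_zero fun s hs => ?_
      rw [ins_apply, (Finset.mem_filter.1 hs).2, D.eps_of_mem h, zero_smul]
    · have ht : t ∉ σ := fun ht => h (Finset.mem_image_of_mem _ ht)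
      rw [Finset.sum_eq_single t]
      · rw [ins_apply, del_apply, if_pos (Finset.mem_insert_self _ _), Finset.erase_insert ht,
          smul_smul, D.eps_sq h, one_smul]
      · intro s _ hs
        rw [ins_apply, del_apply, if_neg, smul_zero]
        simp [hs.symm, ht]
      · simp
  · split_ifs with h
    · refine Finset.sum_congr rfl fun s hs => ?_
      rw [del_apply, if_pos h, ins_apply, (Finset.mem_filter.1 hs).2, smul_smul]
    · exact Finset.sum_eq_zero fun s _ => by rw [del_apply, if_neg h]

/-- The contracting homotopy for the coboundary. -/
theorem cobd_ins_add (t : X) (φ : Finset X → A) (σ : Finset X) :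
    (D.cobd (D.ins t φ) + D.ins t (D.cobd φ)) σ =
      (∑ s with D.q s = D.q t, if s ∈ σ then
          (D.eps (D.q t) ((σ.erase s).image D.q) * D.eps (D.q t) ((σ.erase s).image D.q)) •
            φ (insert t (σ.erase s)) else 0) +
        if D.q t ∈ σ.image D.q then 0 else φ σ := by
  have h1 : D.cobd (D.ins t φ) + D.ins t (D.cobd φ) =
      ∑ s with D.q s = D.q t, (D.del s (D.ins t φ) + D.ins t (D.del s φ)) := by
    rw [cobd_apply, cobd_apply, map_sum, ← Finset.sum_add_distrib]
    symm
    refine Finset.sum_subset (Finset.subset_univ _) fun s _ hs => ?_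
    rw [add_comm]
    exact D.ins_del (fun h => hs (by simpa using h.symm)) φ
  rw [h1, Finset.sum_add_distrib, Pi.add_apply, Finset.sum_apply, Finset.sum_apply]
  congr 1
  · refine Finset.sum_congr rfl fun s hs => ?_
    rw [del_apply, ins_apply, (Finset.mem_filter.1 hs).2, smul_smul]
  · split_ifs with h
    · exact Finset.sum_eq_zero fun s _ => by rw [ins_apply, D.eps_of_mem h, zero_smul]
    · have ht : t ∉ σ := fun ht => h (Finset.mem_image_of_mem _ ht)
      rw [Finset.sum_eq_single t]
      · rw [ins_apply, del_apply, if_pos (Finset.mem_insert_self _ _), Finset.erase_insert ht,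
          smul_smul, D.eps_sq h, one_smul]
      · intro s hs hst
        have hsσ : s ∉ σ := fun hsσ =>
          h ((Finset.mem_filter.1 hs).2 ▸ Finset.mem_image_of_mem _ hsσ)
        rw [ins_apply, del_apply, if_neg, smul_zero]
        simp [hst, hsσ]
      · simp

theorem tr_of_ne_zero {j : ℕ} {φ : Finset X → A} (hφ : φ ∈ D.Sub j) {σ : Finset X}
    (h : φ σ ≠ 0) : D.Tr σ ∧ σ.card = j := by
  by_contra hσ
  exact h (hφ σ hσ)

theorem Tr.subset {σ τ : Finset X} {D : CyclicFibration X Ω} (h : D.Tr σ) (hτ : τ ⊆ σ) :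
    D.Tr τ := Set.InjOn.mono (by exact_mod_cast hτ) h

theorem Tr.insert {σ : Finset X} {D : CyclicFibration X Ω} (h : D.Tr σ) {t : X}
    (ht : D.q t ∉ σ.image D.q) : D.Tr (insert t σ) := by
  have hts : t ∉ (σ : Set X) := fun hm => ht (Finset.mem_image_of_mem _ hm)
  rw [Tr, Finset.coe_insert, Set.injOn_insert hts]
  exact ⟨h, by simpa using ht⟩

theorem Tr.image_erase {σ : Finset X} {D : CyclicFibration X Ω} (h : D.Tr σ) {t : X}
    (ht : t ∈ σ) : D.q t ∉ (σ.erase t).image D.q := by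
  intro hm
  obtain ⟨s, hs, hst⟩ := Finset.mem_image.1 hm
  exact (Finset.mem_erase.1 hs).1 (h (Finset.mem_erase.1 hs).2 ht hst)

theorem Tr.card_le {σ : Finset X} {D : CyclicFibration X Ω} (h : D.Tr σ) :
    σ.card ≤ Fintype.card Ω := by
  rw [← Finset.card_image_of_injOn h]
  exact Finset.card_le_univ _

theorem Tr.exists_notMem {σ : Finset X} {D : CyclicFibration X Ω}
    (hc : σ.card < Fintype.card Ω) : ∃ ω, ω ∉ σ.image D.q := by
  by_contra! h
  have h1 : σ.image D.q = Finset.univ := Finset.eq_univ_iff_forall.2 h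
  have h2 : (σ.image D.q).card ≤ σ.card := Finset.card_image_le
  rw [h1, Finset.card_univ] at h2
  omega

theorem Tr.exists_mem {σ : Finset X} {D : CyclicFibration X Ω} (h : D.Tr σ)
    (hc : σ.card = Fintype.card Ω) (ω : Ω) : ∃ x ∈ σ, D.q x = ω := by
  have h2 : (σ.image D.q).card = Fintype.card Ω := by rw [Finset.card_image_of_injOn h, hc]
  have h3 := (Finset.card_eq_iff_eq_univ _).1 h2
  exact Finset.mem_image.1 (h3 ▸ Finset.mem_univ ω)

theorem ins_mem_Sub {j : ℕ} {φ : Finset X → A} (hφ : φ ∈ D.Sub (j + 1)) (t : X) :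
    D.ins t φ ∈ D.Sub j := by
  intro σ hσ
  by_contra h
  rw [ins_apply] at h
  have h1 : D.q t ∉ σ.image D.q := fun hm => h (by rw [D.eps_of_mem hm, zero_smul])
  have h2 := D.tr_of_ne_zero hφ (σ := insert t σ) fun h0 => h (by rw [h0, smul_zero])
  have hts : t ∉ σ := fun hm => h1 (Finset.mem_image_of_mem _ hm)
  rw [Finset.card_insert_of_notMem hts] at h2
  exact hσ ⟨h2.1.subset (Finset.subset_insert _ _), by omega⟩

theorem del_mem_Sub {j : ℕ} {φ : Finset X → A} (hφ : φ ∈ D.Sub j) (t : X) :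
    D.del t φ ∈ D.Sub (j + 1) := by
  intro σ hσ
  by_contra h
  rw [del_apply] at h
  by_cases ht : t ∈ σ
  swap
  · exact h (if_neg ht)
  rw [if_pos ht] at h
  have h1 : D.q t ∉ (σ.erase t).image D.q := fun hm => h (by rw [D.eps_of_mem hm, zero_smul])
  have h2 := D.tr_of_ne_zero hφ (σ := σ.erase t) fun h0 => h (by rw [h0, smul_zero])
  refine hσ ⟨?_, ?_⟩
  · have := h2.1.insert h1
    rwa [Finset.insert_erase ht] at this
  · rw [← Finset.card_erase_add_one ht, h2.2]

theorem bd_mem_Sub {j : ℕ} {φ : Finset X → A} (hφ : φ ∈ D.Sub (j + 1)) : D.bd φ ∈ D.Sub j := by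
  rw [bd_apply]
  exact sum_mem fun t _ => D.ins_mem_Sub hφ t

theorem cobd_mem_Sub {j : ℕ} {φ : Finset X → A} (hφ : φ ∈ D.Sub j) :
    D.cobd φ ∈ D.Sub (j + 1) := by
  rw [cobd_apply]
  exact sum_mem fun t _ => D.del_mem_Sub hφ t

theorem exists_sub_bd_vanishing {j : ℕ} {φ : Finset X → A} (hφ : φ ∈ D.Sub j)
    (h0 : D.bd φ = 0) (W : Finset Ω) :
    ∃ w ∈ (D.Sub (j + 1) : AddSubgroup (Finset X → A)), ∀ σ : Finset X, ∀ ω ∈ W,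
      ω ∉ σ.image D.q → (φ - D.bd w) σ = 0 := by
  induction W using Finset.induction_on with
  | empty => exact ⟨0, zero_mem _, by simp⟩
  | insert ω W _ ih =>
    obtain ⟨w, hw, hv⟩ := ih
    obtain ⟨t, rfl⟩ := D.q_surjective ω
    set y := φ - D.bd w with hy
    have hyS : y ∈ D.Sub j := sub_mem hφ (D.bd_mem_Sub hw)
    have hy0 : D.bd y = 0 := by rw [hy, map_sub, h0, D.bd_bd, sub_zero]
    refine ⟨w + D.del t y, add_mem hw (D.del_mem_Sub hyS t), fun σ ω' hω' hσ => ?_⟩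
    have key := D.bd_del_add t y σ
    rw [hy0, map_zero, add_zero] at key
    rw [map_add, ← sub_sub, ← hy, Pi.sub_apply, key]
    by_cases hq : D.q t ∈ σ.image D.q
    · have hW : ω' ∈ W := (Finset.mem_insert.1 hω').resolve_left fun h => hσ (h ▸ hq)
      rw [hv σ ω' hW hσ, if_pos hq]
      split_ifs with ht
      · rw [Finset.sum_eq_zero, add_zero, sub_zero]
        intro s hs
        rw [hv _ ω' hW, smul_zero]
        rw [Finset.image_insert, (Finset.mem_filter.1 hs).2, Finset.mem_insert, not_or]
        exact ⟨fun h => hσ (h ▸ hq),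
          fun h => hσ (Finset.image_subset_image (Finset.erase_subset _ _) h)⟩
      · simp
    · have ht : t ∉ σ := fun ht => hq (Finset.mem_image_of_mem _ ht)
      rw [if_neg hq, if_neg ht, add_zero, sub_self]

theorem exists_bd_eq {j : ℕ} (hj : j < Fintype.card Ω) {φ : Finset X → A} (hφ : φ ∈ D.Sub j)
    (h0 : D.bd φ = 0) : ∃ w ∈ D.Sub (j + 1), D.bd w = φ := by
  obtain ⟨w, hw, hv⟩ := D.exists_sub_bd_vanishing hφ h0 Finset.univ
  refine ⟨w, hw, (sub_eq_zero.1 ?_).symm⟩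
  ext σ
  by_cases hσ : D.Tr σ ∧ σ.card = j
  · obtain ⟨ω, hω⟩ := Tr.exists_notMem (D := D) (hσ.2.trans_lt hj)
    exact hv σ ω (Finset.mem_univ _) hω
  · exact sub_mem hφ (D.bd_mem_Sub hw) σ hσ

theorem exists_sub_cobd_vanishing {j : ℕ} {φ : Finset X → A} (hφ : φ ∈ D.Sub (j + 1))
    (h0 : D.cobd φ = 0) (t : Ω → X) (ht : ∀ ω, D.q (t ω) = ω) (W : Finset Ω) :
    ∃ w ∈ (D.Sub j : AddSubgroup (Finset X → A)), ∀ σ : Finset X, D.Tr σ → ∀ ω ∈ W, (ω ∉ σ.image D.q ∨ t ω ∈ σ) →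
      (φ - D.cobd w) σ = 0 := by
  induction W using Finset.induction_on with
  | empty => exact ⟨0, zero_mem _, by simp⟩
  | insert ω W _ ih =>
    obtain ⟨w, hw, hv⟩ := ih
    set y := φ - D.cobd w with hy
    have hyS : y ∈ D.Sub (j + 1) := sub_mem hφ (D.cobd_mem_Sub hw)
    have hy0 : D.cobd y = 0 := by rw [hy, map_sub, h0, D.cobd_cobd, sub_zero]
    refine ⟨w + D.ins (t ω) y, add_mem hw (D.ins_mem_Sub hyS _), fun σ hT ω' hω' hσ => ?_⟩
    have key := D.cobd_ins_add (t ω) y σ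
    rw [hy0, map_zero, add_zero] at key
    rw [map_add, ← sub_sub, ← hy, Pi.sub_apply, key]
    simp only [ht]
    by_cases hq : ω ∈ σ.image D.q
    swap
    · rw [if_neg hq, Finset.sum_eq_zero, zero_add, sub_self]
      intro s hs
      rw [if_neg]
      intro hsσ
      exact hq ((Finset.mem_filter.1 hs).2 ▸ Finset.mem_image_of_mem _ hsσ)
    rw [if_pos hq, add_zero]
    by_cases htσ : t ω ∈ σ
    · rw [Finset.sum_eq_single (t ω), if_pos htσ, Finset.insert_erase htσ, D.eps_sq, one_smul,
        sub_self]
      · have := hT.image_erase htσ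
        rwa [ht] at this
      · intro s hs hst
        rw [if_neg]
        exact fun hsσ => hst (hT hsσ htσ (by rw [(Finset.mem_filter.1 hs).2, ht]))
      · intro h
        exact absurd (by simp [ht]) h
    have hne : ω' ≠ ω := by
      rintro rfl
      exact hσ.elim (fun h => h hq) htσ
    have hW : ω' ∈ W := (Finset.mem_insert.1 hω').resolve_left hne
    rw [hv σ hT ω' hW hσ, Finset.sum_eq_zero, sub_zero]
    intro s hs
    have hsω : D.q s = ω := (Finset.mem_filter.1 hs).2
    split_ifs with hsσ
    swap
    · rfl
    rw [hv _ _ ω' hW, smul_zero]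
    · rw [Finset.image_insert, ht, Finset.mem_insert, not_or]
      refine hσ.imp (fun h => ⟨hne, fun h' => h (Finset.image_subset_image
        (Finset.erase_subset _ _) h')⟩) fun h => Finset.mem_insert_of_mem
          (Finset.mem_erase.2 ⟨?_, h⟩)
      rintro rfl
      exact hne (by rw [← hsω, ht])
    · refine (hT.subset (Finset.erase_subset s σ)).insert ?_
      have := hT.image_erase hsσ
      rwa [ht, ← hsω]

theorem exists_cobd_eq {j : ℕ} (hj : j + 1 < Fintype.card Ω) {φ : Finset X → A}
    (hφ : φ ∈ D.Sub (j + 1)) (h0 : D.cobd φ = 0) : ∃ w ∈ D.Sub j, D.cobd w = φ := by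
  obtain ⟨t, ht⟩ := D.q_surjective.hasRightInverse
  obtain ⟨w, hw, hv⟩ := D.exists_sub_cobd_vanishing hφ h0 t ht Finset.univ
  refine ⟨w, hw, (sub_eq_zero.1 ?_).symm⟩
  ext σ
  by_cases hσ : D.Tr σ ∧ σ.card = j + 1
  · obtain ⟨ω, hω⟩ := Tr.exists_notMem (D := D) (hσ.2.trans_lt hj)
    exact hv σ hσ.1 ω (Finset.mem_univ _) (Or.inl hω)
  · exact sub_mem hφ (D.cobd_mem_Sub hw) σ hσ

theorem eq_zero_of_cobd_eq_zero [Nonempty Ω] {φ : Finset X → A} (hφ : φ ∈ D.Sub 0)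
    (h0 : D.cobd φ = 0) : φ = 0 := by
  obtain ⟨t, -⟩ := D.q_surjective (Classical.arbitrary Ω)
  ext σ
  by_cases hσ : D.Tr σ ∧ σ.card = 0
  swap
  · exact hφ σ hσ
  obtain rfl := Finset.card_eq_zero.1 hσ.2
  have h1 : D.ins t φ = 0 := by
    ext τ
    rw [ins_apply, hφ (insert t τ), smul_zero, Pi.zero_apply]
    rintro ⟨-, h⟩
    exact (Finset.insert_ne_empty t τ) (Finset.card_eq_zero.1 h)
  have key := D.cobd_ins_add t φ ∅
  rw [h0, h1, map_zero, map_zero] at key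
  simpa using key.symm

/-- The permutation `z` applied over `U` only. -/
def rho {X Ω : Type} [DecidableEq Ω] (D : CyclicFibration X Ω) (U : Finset Ω) :
    Equiv.Perm X where
  toFun x := if D.q x ∈ U then D.z x else x
  invFun x := if D.q x ∈ U then D.z⁻¹ x else x
  left_inv x := by
    by_cases h : D.q x ∈ U
    · simp [h, D.q_z]
    · simp [h]
  right_inv x := by
    have h0 : D.q (D.z⁻¹ x) = D.q x := by
      conv_rhs => rw [← D.z.apply_symm_apply x, D.q_z]
      rfl
    by_cases h : D.q x ∈ U
    · simp only [h, if_true, h0]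
      exact D.z.apply_symm_apply x
    · simp [h]

theorem rho_apply (U : Finset Ω) (x : X) : D.rho U x = if D.q x ∈ U then D.z x else x := rfl

theorem q_rho (U : Finset Ω) (x : X) : D.q (D.rho U x) = D.q x := by
  rw [rho_apply]
  split_ifs
  · exact D.q_z x
  · rfl

theorem rho_empty : D.rho ∅ = 1 := by
  ext x
  simp [rho_apply]

theorem rho_insert {ω : Ω} {U : Finset Ω} (h : ω ∉ U) :
    D.rho (insert ω U) = D.rho {ω} * D.rho U := by
  ext x
  by_cases h1 : D.q x ∈ U
  · have : D.q x ≠ ω := fun h2 => h (h2 ▸ h1)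
    simp [rho_apply, h1, D.q_z, this]
  · simp [rho_apply, h1]

theorem rho_insert_right {ω : Ω} {U : Finset Ω} (h : ω ∉ U) :
    D.rho (insert ω U) = D.rho U * D.rho {ω} := by
  ext x
  by_cases h1 : D.q x = ω
  · subst h1
    simp [rho_apply, h, D.q_z]
  · simp [rho_apply, h1]

/-- Pullback along `rho`. -/
def pull (U : Finset Ω) : AddMonoid.End (Finset X → A) where
  toFun φ σ := φ (σ.image (D.rho U))
  map_zero' := rfl
  map_add' _ _ := rfl

theorem pull_apply (U : Finset Ω) (φ : Finset X → A) (σ : Finset X) :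
    D.pull U φ σ = φ (σ.image (D.rho U)) := rfl

theorem pull_insert {ω : Ω} {U : Finset Ω} (h : ω ∉ U) :
    (D.pull (insert ω U) : AddMonoid.End (Finset X → A)) = D.pull U * D.pull {ω} := by
  ext φ σ
  rw [end_mul_apply, pull_apply, pull_apply, pull_apply, Finset.image_image,
    D.rho_insert h]
  rfl

theorem pull_insert_right {ω : Ω} {U : Finset Ω} (h : ω ∉ U) :
    (D.pull (insert ω U) : AddMonoid.End (Finset X → A)) = D.pull {ω} * D.pull U := by
  ext φ σ
  rw [end_mul_apply, pull_apply, pull_apply, pull_apply, Finset.image_image,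
    D.rho_insert_right h]
  rfl

/-- The product of the operators `1 - z` over the fibres in `W`. -/
def theta (W : Finset Ω) : AddMonoid.End (Finset X → A) :=
  ∑ U ∈ W.powerset, (-1 : ℤ) ^ U.card • D.pull U

theorem theta_empty : (D.theta ∅ : AddMonoid.End (Finset X → A)) = 1 := by
  ext φ σ
  simp [theta, pull_apply, rho_empty]

theorem theta_insert {ω : Ω} {W : Finset Ω} (h : ω ∉ W) :
    (D.theta (insert ω W) : AddMonoid.End (Finset X → A)) = D.theta W * (1 - D.pull {ω}) := by
  rw [theta, Finset.sum_powerset_insert h, mul_sub, mul_one, sub_eq_add_neg]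
  congr 1
  rw [theta, Finset.sum_mul, ← Finset.sum_neg_distrib]
  refine Finset.sum_congr rfl fun U hU => ?_
  have hωU : ω ∉ U := fun h' => h (Finset.mem_powerset.1 hU h')
  rw [Finset.card_insert_of_notMem hωU, D.pull_insert hωU, smul_mul_assoc, pow_succ, mul_neg_one,
    neg_smul]

theorem theta_insert_right {ω : Ω} {W : Finset Ω} (h : ω ∉ W) :
    (D.theta (insert ω W) : AddMonoid.End (Finset X → A)) = (1 - D.pull {ω}) * D.theta W := by
  rw [theta, Finset.sum_powerset_insert h, sub_mul, one_mul, sub_eq_add_neg]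
  congr 1
  rw [theta, Finset.mul_sum, ← Finset.sum_neg_distrib]
  refine Finset.sum_congr rfl fun U hU => ?_
  have hωU : ω ∉ U := fun h' => h (Finset.mem_powerset.1 hU h')
  rw [Finset.card_insert_of_notMem hωU, D.pull_insert_right hωU, pow_succ, mul_neg_one, neg_smul,
    neg_inj]
  exact AddMonoidHom.ext fun φ => (map_zsmul (D.pull {ω}) ((-1) ^ U.card) (D.pull U φ)).symm

theorem image_rho_image (U : Finset Ω) (σ : Finset X) :
    (σ.image (D.rho U)).image D.q = σ.image D.q := by
  rw [Finset.image_image]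
  exact Finset.image_congr fun x _ => D.q_rho U x

theorem tr_image_rho (U : Finset Ω) (σ : Finset X) : D.Tr (σ.image (D.rho U)) ↔ D.Tr σ := by
  rw [Tr, Tr, ← Finset.card_image_iff, ← Finset.card_image_iff, image_rho_image,
    Finset.card_image_of_injective _ (D.rho U).injective]

theorem pull_mem_Sub {j : ℕ} {φ : Finset X → A} (hφ : φ ∈ D.Sub j) (U : Finset Ω) :
    D.pull U φ ∈ D.Sub j := by
  intro σ hσ
  refine hφ _ ?_
  rwa [tr_image_rho, Finset.card_image_of_injective _ (D.rho U).injective]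

theorem theta_apply (W : Finset Ω) (φ : Finset X → A) :
    D.theta W φ = ∑ U ∈ W.powerset, (-1 : ℤ) ^ U.card • D.pull U φ := end_sum_apply _ _ _

theorem theta_mem_Sub {j : ℕ} {φ : Finset X → A} (hφ : φ ∈ D.Sub j) (W : Finset Ω) :
    D.theta W φ ∈ D.Sub j := by
  rw [theta_apply]
  exact sum_mem fun U _ => zsmul_mem (D.pull_mem_Sub hφ U) _

theorem image_rho_eq_self {U : Finset Ω} {σ : Finset X} (h : ∀ ω ∈ U, ω ∉ σ.image D.q) :
    σ.image (D.rho U) = σ := by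
  conv_rhs => rw [← Finset.image_id (s := σ)]
  refine Finset.image_congr fun x hx => ?_
  rw [rho_apply, if_neg]
  · rfl
  · exact fun hm => h _ hm (Finset.mem_image_of_mem _ hx)

theorem sum_fibre_z (ω : Ω) (f : X → A) :
    ∑ s with D.q s = ω, f (D.z s) = ∑ s with D.q s = ω, f s := by
  refine Finset.sum_equiv D.z (fun s => ?_) fun s _ => rfl
  simp [D.q_z]

theorem theta_univ (ω : Ω) : (D.theta Finset.univ : AddMonoid.End (Finset X → A)) =
    (1 - D.pull {ω}) * D.theta (Finset.univ.erase ω) := by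
  rw [← D.theta_insert_right (Finset.notMem_erase _ _), Finset.insert_erase (Finset.mem_univ _)]

theorem theta_univ_right (ω : Ω) : (D.theta Finset.univ : AddMonoid.End (Finset X → A)) =
    D.theta (Finset.univ.erase ω) * (1 - D.pull {ω}) := by
  rw [← D.theta_insert (Finset.notMem_erase _ _), Finset.insert_erase (Finset.mem_univ _)]

theorem bd_eq_sum_fibres (φ : Finset X → A) (σ : Finset X) :
    D.bd φ σ = ∑ ω, D.eps ω (σ.image D.q) • ∑ s with D.q s = ω, φ (insert s σ) := by
  rw [bd_apply, Finset.sum_apply, ← Finset.sum_fiberwise Finset.univ D.q]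
  refine Finset.sum_congr rfl fun ω _ => ?_
  rw [Finset.smul_sum]
  refine Finset.sum_congr rfl fun s hs => ?_
  rw [ins_apply, (Finset.mem_filter.1 hs).2]

theorem bd_theta (φ : Finset X → A) : D.bd (D.theta Finset.univ φ) = 0 := by
  ext σ
  rw [bd_eq_sum_fibres]
  refine Finset.sum_eq_zero fun ω _ => ?_
  by_cases hω : ω ∈ σ.image D.q
  · rw [D.eps_of_mem hω, zero_smul]
  rw [D.theta_univ ω, end_mul_apply]
  set ψ := D.theta (Finset.univ.erase ω) φ
  have h1 : ∀ s ∈ Finset.univ.filter (fun s => D.q s = ω),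
      ((1 - D.pull {ω} : AddMonoid.End (Finset X → A)) ψ) (insert s σ) =
        ψ (insert s σ) - ψ (insert (D.z s) σ) := by
    intro s hs
    have h2 : σ.image (D.rho {ω}) = σ := D.image_rho_eq_self (by simpa using hω)
    change ψ (insert s σ) - D.pull {ω} ψ (insert s σ) = _
    rw [pull_apply, Finset.image_insert, h2, rho_apply, if_pos]
    simpa using hs
  rw [Finset.sum_congr rfl h1, Finset.sum_sub_distrib,
    D.sum_fibre_z ω (fun s => ψ (insert s σ)), sub_self, smul_zero]

theorem theta_cobd (φ : Finset X → A) : D.theta Finset.univ (D.cobd φ) = 0 := by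
  rw [cobd_apply, ← Finset.sum_fiberwise Finset.univ D.q, map_sum]
  refine Finset.sum_eq_zero fun ω _ => ?_
  rw [D.theta_univ_right ω, end_mul_apply]
  refine Eq.trans (congrArg (D.theta (Finset.univ.erase ω)) ?_)
    (map_zero (D.theta (Finset.univ.erase ω) : AddMonoid.End (Finset X → A)))
  change (∑ i with D.q i = ω, D.del i φ) - D.pull {ω} (∑ i with D.q i = ω, D.del i φ) = 0
  rw [sub_eq_zero, map_sum, eq_comm]
  ext σ
  rw [Finset.sum_apply, Finset.sum_apply, ← D.sum_fibre_z ω]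
  refine Finset.sum_congr rfl fun s hs => ?_
  have hsω : D.q s = ω := (Finset.mem_filter.1 hs).2
  have hz : D.z s = D.rho {ω} s := by rw [rho_apply, if_pos (by simpa using hsω)]
  rw [pull_apply, hz, del_apply, del_apply]
  have h1 : D.rho {ω} s ∈ σ.image (D.rho {ω}) ↔ s ∈ σ :=
    (D.rho {ω}).injective.mem_finset_image
  have h2 : (σ.image (D.rho {ω})).erase (D.rho {ω} s) = (σ.erase s).image (D.rho {ω}) :=
    (Finset.image_erase (D.rho {ω}).injective σ s).symm
  simp only [h1, h2, image_rho_image, q_rho]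
  by_cases hm : D.q s ∈ (σ.erase s).image D.q
  · rw [D.eps_of_mem hm, zero_smul, zero_smul]
  · rw [D.image_rho_eq_self]
    simpa [← hsω] using hm

theorem eq_zero_of_theta_eq_zero {φ : Finset X → A} (hφ : φ ∈ D.Sub (Fintype.card Ω))
    (t : Ω → X) (ht : ∀ ω, D.q (t ω) = ω) (hv : ∀ σ ω, t ω ∈ σ → φ σ = 0) (W : Finset Ω)
    (h0 : D.theta W φ = 0) : φ = 0 := by
  induction W using Finset.induction_on with
  | empty => simpa [theta_empty] using h0
  | insert ω W hω ih =>
    refine ih ?_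
    rw [D.theta_insert_right hω, end_mul_apply] at h0
    have hS := D.theta_mem_Sub hφ W
    have hvan : ∀ σ, t ω ∈ σ → D.theta W φ σ = 0 := by
      intro σ hσ
      rw [theta_apply, Finset.sum_apply]
      refine Finset.sum_eq_zero fun U hU => ?_
      rw [Pi.smul_apply, pull_apply, hv _ ω, smul_zero]
      refine Finset.mem_image.2 ⟨t ω, hσ, ?_⟩
      rw [rho_apply, ht, if_neg fun h => hω (Finset.mem_powerset.1 hU h)]
    set ψ := D.theta W φ
    have hinv : ∀ σ, ψ (σ.image (D.rho {ω})) = ψ σ := by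
      intro σ
      have := congrFun h0 σ
      change ψ σ - ψ (σ.image (D.rho {ω})) = 0 at this
      exact (sub_eq_zero.1 this).symm
    have hiter : ∀ n : ℕ, ∀ σ, ∀ x ∈ σ, D.q x = ω → (D.z ^ n) x = t ω → ψ σ = 0 := by
      intro n
      induction n with
      | zero =>
        intro σ x hx _ hxt
        exact hvan σ (by simpa [← hxt] using hx)
      | succ n ihn =>
        intro σ x hx hq hxt
        rw [← hinv]
        refine ihn _ (D.z x) (Finset.mem_image.2 ⟨x, hx, ?_⟩) (by rw [D.q_z, hq]) ?_
        · rw [rho_apply, if_pos (by simpa using hq)]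
        · rw [← hxt, pow_succ]
          rfl
    ext σ
    by_cases hσ : D.Tr σ ∧ σ.card = Fintype.card Ω
    · obtain ⟨x, hx, hq⟩ := hσ.1.exists_mem hσ.2 ω
      obtain ⟨n, hn⟩ := D.exists_pow x (t ω) (by rw [hq, ht])
      exact hiter n σ x hx hq hn
    · exact hS σ hσ

theorem exists_cobd_eq_of_theta {j : ℕ} (hj : j + 1 = Fintype.card Ω) {φ : Finset X → A}
    (hφ : φ ∈ D.Sub (j + 1)) (h0 : D.theta Finset.univ φ = 0) : ∃ w ∈ D.Sub j, D.cobd w = φ := by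
  obtain ⟨t, ht⟩ := D.q_surjective.hasRightInverse
  have hc : D.cobd φ = 0 := by
    ext σ
    refine D.cobd_mem_Sub hφ σ ?_
    rintro ⟨h1, h2⟩
    have := h1.card_le
    omega
  obtain ⟨w, hw, hv⟩ := D.exists_sub_cobd_vanishing hφ hc t ht Finset.univ
  refine ⟨w, hw, (sub_eq_zero.1 ?_).symm⟩
  have hS := sub_mem hφ (D.cobd_mem_Sub hw)
  refine D.eq_zero_of_theta_eq_zero (hj ▸ hS) t ht (fun σ ω hσ => ?_) Finset.univ ?_
  · by_cases hT : D.Tr σ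
    · exact hv σ hT ω (Finset.mem_univ _) (Or.inr hσ)
    · exact hS σ fun h => hT h.1
  · rw [map_sub, h0, theta_cobd, sub_zero]

open Classical in
/-- The position of `x` in its orbit, counted from `t`. -/
def idx {X Ω : Type} (D : CyclicFibration X Ω) {t x : X} (h : D.q t = D.q x) : ℕ :=
  Nat.find (D.exists_pow t x h)

theorem pow_idx {t x : X} (h : D.q t = D.q x) : (D.z ^ D.idx h) t = x := by
  unfold idx
  convert Nat.find_spec (D.exists_pow t x h)

theorem idx_le {t x : X} (h : D.q t = D.q x) {n : ℕ} (hn : (D.z ^ n) t = x) : D.idx h ≤ n := by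
  unfold idx
  convert Nat.find_min' (D.exists_pow t x h) hn

theorem idx_z {t x : X} (h : D.q t = D.q x) :
    D.idx (h.trans (D.q_z x).symm) = D.idx h + 1 ∨
      D.idx (h.trans (D.q_z x).symm) = 0 ∧ ∀ y (hy : D.q t = D.q y), D.idx hy ≤ D.idx h := by
  have h1 : (D.z ^ (D.idx h + 1)) t = D.z x := by
    rw [pow_succ', Equiv.Perm.mul_apply, D.pow_idx]
  have h2 := D.idx_le (h.trans (D.q_z x).symm) h1
  have h3 := D.pow_idx (h.trans (D.q_z x).symm)
  rcases hk : D.idx (h.trans (D.q_z x).symm) with _ | k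
  · right
    refine ⟨rfl, fun y hy => ?_⟩
    rw [hk, pow_zero] at h3
    rw [← h3, Equiv.Perm.one_apply] at h1
    have hper : ∀ a b : ℕ, (D.z ^ (b + (D.idx h + 1) * a)) t = (D.z ^ b) t := by
      intro a b
      rw [pow_add, pow_mul, Equiv.Perm.mul_apply]
      congr 1
      induction a with
      | zero => rfl
      | succ a ih => rw [pow_succ, Equiv.Perm.mul_apply, h1, ih]
    have h4 := D.pow_idx hy
    rw [← Nat.mod_add_div (D.idx hy) (D.idx h + 1), hper] at h4
    exact (D.idx_le hy h4).trans (Nat.lt_succ_iff.1 (Nat.mod_lt _ (Nat.succ_pos _)))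
  · left
    rw [hk, pow_succ', Equiv.Perm.mul_apply] at h3
    have := D.idx_le h (D.z.injective h3)
    omega

open Classical in
/-- The sum of `f` over the points strictly before `x` in its orbit. -/
def before (t : X) (f : X → A) (x : X) : A :=
  ∑ s, if h : D.q t = D.q s ∧ D.q t = D.q x then
    if D.idx h.1 < D.idx h.2 then f s else 0 else 0

theorem before_z {t x : X} (h : D.q t = D.q x) {f : X → A}
    (h0 : ∑ s with D.q s = D.q t, f s = 0) :
    D.before t f (D.z x) - D.before t f x = f x := by
  classical
  have hz := h.trans (D.q_z x).symm
  have hinj : ∀ s (hs : D.q t = D.q s), D.idx hs = D.idx h → s = x := by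
    intro s hs he
    rw [← D.pow_idx hs, he, D.pow_idx]
  have e1 : D.before t f (D.z x) = ∑ s with D.q s = D.q t,
      if h' : D.q t = D.q s then if D.idx h' < D.idx hz then f s else 0 else 0 := by
    rw [before, Finset.sum_filter]
    refine Finset.sum_congr rfl fun s _ => ?_
    by_cases hs : D.q t = D.q s
    · simp [hs.symm, ← hz]
    · simp [hs]
  have e2 : D.before t f x = ∑ s with D.q s = D.q t,
      if h' : D.q t = D.q s then if D.idx h' < D.idx h then f s else 0 else 0 := by
    rw [before, Finset.sum_filter]
    refine Finset.sum_congr rfl fun s _ => ?_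
    by_cases hs : D.q t = D.q s
    · simp [hs.symm, ← h]
    · simp [hs]
  have e3 : f x = ∑ s with D.q s = D.q t, if s = x then f s else 0 := by
    rw [Finset.sum_ite_eq', if_pos (by simp [h])]
  rw [e1, e2]
  rcases D.idx_z h with h1 | ⟨h1, h2⟩
  · rw [← Finset.sum_sub_distrib, e3]
    refine Finset.sum_congr rfl fun s hs => ?_
    have hs' : D.q t = D.q s := (Finset.mem_filter.1 hs).2.symm
    rw [dif_pos hs', dif_pos hs', h1]
    by_cases hsx : s = x
    · subst hsx
      simp
    · have : D.idx hs' ≠ D.idx h := fun h' => hsx (hinj s hs' h')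
      rw [if_neg hsx]
      by_cases hlt : D.idx hs' < D.idx h
      · rw [if_pos hlt, if_pos (by omega), sub_self]
      · rw [if_neg hlt, if_neg (by omega), sub_self]
  · rw [h1, ← Finset.sum_sub_distrib, e3, ← sub_eq_zero, ← Finset.sum_sub_distrib, ← neg_eq_zero,
      ← Finset.sum_neg_distrib, ← h0]
    refine Finset.sum_congr rfl fun s hs => ?_
    have hs' : D.q t = D.q s := (Finset.mem_filter.1 hs).2.symm
    rw [dif_pos hs', dif_pos hs', if_neg (Nat.not_lt_zero _)]
    by_cases hsx : s = x
    · subst hsx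
      simp
    · have h3 : D.idx hs' ≠ D.idx h := fun h' => hsx (hinj s hs' h')
      rw [if_neg hsx, if_pos (lt_of_le_of_ne (h2 s hs') h3)]
      simp

open Classical in
/-- A right inverse of `1 - z` on the fibre of `t`. -/
def antidiff (t : X) (φ : Finset X → A) (σ : Finset X) : A :=
  if D.Tr σ then
    -∑ x with x ∈ σ ∧ D.q x = D.q t, D.before t (fun s => φ (insert s (σ.erase x))) x
  else 0

theorem antidiff_insert {t x : X} {τ : Finset X} (hT : D.Tr τ) (hx : D.q x = D.q t)
    (hτ : D.q t ∉ τ.image D.q) (φ : Finset X → A) :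
    D.antidiff t φ (insert x τ) = -D.before t (fun s => φ (insert s τ)) x := by
  have hxτ : x ∉ τ := fun h => hτ (hx ▸ Finset.mem_image_of_mem _ h)
  rw [antidiff, if_pos (hT.insert (hx ▸ hτ))]
  have : (Finset.univ.filter fun y => y ∈ insert x τ ∧ D.q y = D.q t) = {x} := by
    ext y
    simp only [Finset.mem_filter, Finset.mem_univ, true_and, Finset.mem_insert,
      Finset.mem_singleton]
    constructor
    · rintro ⟨rfl | h, hy⟩
      · rfl
      · exact absurd (hy ▸ Finset.mem_image_of_mem _ h) hτ
    · rintro rfl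
      exact ⟨Or.inl rfl, hx⟩
  rw [this, Finset.sum_singleton, Finset.erase_insert hxτ]

theorem antidiff_mem_Sub {j : ℕ} {φ : Finset X → A} (hφ : φ ∈ D.Sub j) (t : X) :
    D.antidiff t φ ∈ D.Sub j := by
  intro σ hσ
  rw [antidiff]
  split_ifs with hT
  swap
  · rfl
  rw [Finset.sum_eq_zero, neg_zero]
  intro x hx
  obtain ⟨-, hxσ, hq⟩ := Finset.mem_filter.1 hx
  refine Finset.sum_eq_zero fun s _ => ?_
  split_ifs with h1 h2
  · refine hφ _ fun h => hσ ⟨hT, ?_⟩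
    rw [← h.2, Finset.card_insert_of_notMem, Finset.card_erase_add_one hxσ]
    intro hs
    refine hT.image_erase hxσ ?_
    rw [hq, h1.1]
    exact Finset.mem_image_of_mem _ hs
  · rfl
  · rfl

theorem sum_fibre_antidiff {t : X} {ω : Ω} (hω : ω ≠ D.q t) {φ : Finset X → A}
    (h0 : ∀ σ : Finset X, ω ∉ σ.image D.q → ∑ s with D.q s = ω, φ (insert s σ) = 0)
    {σ : Finset X} (hσ : ω ∉ σ.image D.q) :
    ∑ s with D.q s = ω, D.antidiff t φ (insert s σ) = 0 := by
  by_cases hT : D.Tr σ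
  swap
  · refine Finset.sum_eq_zero fun s _ => ?_
    rw [antidiff, if_neg fun h => hT (h.subset (Finset.subset_insert _ _))]
  have h1 : ∀ s ∈ Finset.univ.filter (fun s => D.q s = ω), D.antidiff t φ (insert s σ) =
      -∑ x with x ∈ σ ∧ D.q x = D.q t,
        D.before t (fun y => φ (insert s (insert y (σ.erase x)))) x := by
    intro s hs
    have hsω : D.q s = ω := (Finset.mem_filter.1 hs).2
    rw [antidiff, if_pos (hT.insert (hsω ▸ hσ))]
    congr 1
    refine Finset.sum_congr ?_ fun x hx => ?_
    · ext x
      simp only [Finset.mem_filter, Finset.mem_univ, true_and, Finset.mem_insert]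
      constructor
      · rintro ⟨rfl | h, hx⟩
        · exact absurd (hsω.symm.trans hx) hω
        · exact ⟨h, hx⟩
      · rintro ⟨h, hx⟩
        exact ⟨Or.inr h, hx⟩
    · obtain ⟨-, hxσ, hq⟩ := Finset.mem_filter.1 hx
      have hsx : s ≠ x := fun h => hω (by rw [← hsω, h, hq])
      rw [Finset.erase_insert_of_ne hsx]
      simp only [Finset.insert_comm s]
  rw [Finset.sum_congr rfl h1, Finset.sum_neg_distrib, neg_eq_zero, Finset.sum_comm]
  refine Finset.sum_eq_zero fun x hx => ?_
  simp only [before]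
  rw [Finset.sum_comm]
  refine Finset.sum_eq_zero fun y _ => ?_
  split_ifs with h2 h3
  · refine h0 _ ?_
    rw [Finset.image_insert, ← h2.1, Finset.mem_insert, not_or]
    exact ⟨hω, fun h => hσ (Finset.image_subset_image (Finset.erase_subset _ _) h)⟩
  · exact Finset.sum_const_zero
  · exact Finset.sum_const_zero

theorem antidiff_sub_pull {t : X} {φ : Finset X → A} (hφ : φ ∈ D.Sub (Fintype.card Ω))
    (h0 : ∀ σ : Finset X, D.q t ∉ σ.image D.q → ∑ s with D.q s = D.q t, φ (insert s σ) = 0) :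
    D.antidiff t φ - D.pull {D.q t} (D.antidiff t φ) = φ := by
  have hS := D.antidiff_mem_Sub hφ t
  ext σ
  by_cases hσ : D.Tr σ ∧ σ.card = Fintype.card Ω
  swap
  · rw [hφ σ hσ]
    exact sub_mem hS (D.pull_mem_Sub hS _) σ hσ
  obtain ⟨x, hx, hq⟩ := hσ.1.exists_mem hσ.2 (D.q t)
  obtain ⟨τ, hτ⟩ : ∃ τ, τ = σ.erase x := ⟨_, rfl⟩
  have hστ : σ = insert x τ := by rw [hτ, Finset.insert_erase hx]
  have hTτ : D.Tr τ := hσ.1.subset (hτ ▸ Finset.erase_subset _ _)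
  have hqτ : D.q t ∉ τ.image D.q := by
    rw [hτ, ← hq]
    exact hσ.1.image_erase hx
  have hρ : σ.image (D.rho {D.q t}) = insert (D.z x) τ := by
    rw [hστ, Finset.image_insert, D.image_rho_eq_self (by simpa using hqτ), rho_apply,
      if_pos (by simpa using hq)]
  rw [Pi.sub_apply, pull_apply, hρ, hστ, D.antidiff_insert hTτ hq hqτ,
    D.antidiff_insert hTτ ((D.q_z x).trans hq) hqτ, neg_sub_neg, D.before_z hq.symm (h0 τ hqτ)]

theorem sum_fibre_eq_zero_of_bd {φ : Finset X → A} (hφ : φ ∈ D.Sub (Fintype.card Ω))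
    (hb : D.bd φ = 0) {ω : Ω} {σ : Finset X} (hσ : ω ∉ σ.image D.q) :
    ∑ s with D.q s = ω, φ (insert s σ) = 0 := by
  have h1 := congrFun hb σ
  rw [bd_eq_sum_fibres, Pi.zero_apply, Finset.sum_eq_single ω] at h1
  · have h2 := congrArg (D.eps ω (σ.image D.q) • ·) h1
    simpa only [smul_smul, D.eps_sq hσ, one_smul, smul_zero] using h2
  · intro ω' _ hne
    by_cases hω' : ω' ∈ σ.image D.q
    · rw [D.eps_of_mem hω', zero_smul]
    rw [Finset.sum_eq_zero, smul_zero]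
    intro s hs
    refine hφ _ fun h => ?_
    obtain ⟨x, hx, hq⟩ := h.1.exists_mem h.2 ω
    rcases Finset.mem_insert.1 hx with rfl | hx
    · exact hne ((Finset.mem_filter.1 hs).2.symm.trans hq)
    · exact hσ (hq ▸ Finset.mem_image_of_mem _ hx)
  · exact fun h => absurd (Finset.mem_univ _) h

theorem exists_theta_eq {φ : Finset X → A} (hφ : φ ∈ D.Sub (Fintype.card Ω)) (hb : D.bd φ = 0) :
    ∃ u ∈ D.Sub (Fintype.card Ω), D.theta Finset.univ u = φ := by
  suffices h : ∀ W : Finset Ω, ∃ u ∈ D.Sub (Fintype.card Ω), D.theta W u = φ ∧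
      ∀ ω ∉ W, ∀ σ : Finset X, ω ∉ σ.image D.q → ∑ s with D.q s = ω, u (insert s σ) = 0 by
    obtain ⟨u, hu, h, -⟩ := h Finset.univ
    exact ⟨u, hu, h⟩
  intro W
  induction W using Finset.induction_on with
  | empty =>
    exact ⟨φ, hφ, by rw [theta_empty]; rfl, fun ω _ σ hσ => D.sum_fibre_eq_zero_of_bd hφ hb hσ⟩
  | insert ω W hω ih =>
    obtain ⟨u, hu, h1, h2⟩ := ih
    obtain ⟨t, rfl⟩ := D.q_surjective ω
    refine ⟨D.antidiff t u, D.antidiff_mem_Sub hu t, ?_, fun ω' hω' σ hσ => ?_⟩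
    · rw [D.theta_insert hω, end_mul_apply, ← h1]
      congr 1
      exact D.antidiff_sub_pull hu (h2 _ hω)
    · rw [Finset.mem_insert, not_or] at hω'
      exact D.sum_fibre_antidiff hω'.1 (h2 ω' hω'.2) hσ

end CyclicFibration

open scoped Pointwise

namespace CyclicFibration

variable {Q X Ω : Type} [Group Q] [MulAction Q X] [MulAction Q Ω] [Fintype X] [DecidableEq X]
  [Fintype Ω] [DecidableEq Ω] (D : CyclicFibration X Ω) {A : Type} [AddCommGroup A]

/-- The sign of the permutation induced by `g` on a finite set. -/
def chi {Q X Ω : Type} [Group Q] [MulAction Q Ω] (D : CyclicFibration X Ω) (g : Q)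
    (U : Finset Ω) : ℤ :=
  ∏ x ∈ U, ∏ y ∈ U, if D.sgn y x = 1 then D.sgn (g • x) (g • y) * D.sgn x y else 1

theorem chi_empty (g : Q) : D.chi g ∅ = 1 := rfl

theorem chi_insert (g : Q) {a : Ω} {U : Finset Ω} (ha : a ∉ U) :
    D.chi g (insert a U) = D.chi g U * (D.eps (g • a) (g • U) * D.eps a U) := by
  have hw : ∀ x y, D.sgn (g • x) (g • y) * D.sgn x y = D.sgn (g • y) (g • x) * D.sgn y x := by
    intro x y
    rw [D.sgn_swap (g • x), D.sgn_swap x, neg_mul_neg]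
  have h1 : D.eps (g • a) (g • U) = ∏ y ∈ U, D.sgn (g • a) (g • y) := by
    rw [eps, Finset.smul_finset_def, Finset.prod_image fun x _ y _ h => smul_left_cancel g h]
  rw [h1, eps, ← Finset.prod_mul_distrib, chi, Finset.prod_insert ha]
  simp only [Finset.prod_insert ha, D.sgn_self, zero_ne_one, if_false, one_mul,
    Finset.prod_mul_distrib]
  rw [← mul_assoc, mul_comm, ← chi]
  congr 1
  rw [← Finset.prod_mul_distrib, ← Finset.prod_mul_distrib]
  refine Finset.prod_congr rfl fun y hy => ?_
  have hne : a ≠ y := fun h => ha (h ▸ hy)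
  rw [hw y a, D.sgn_swap a y]
  have hs : D.sgn y a = 1 ∨ D.sgn y a = -1 := by
    have := D.sgn_sq y a hne.symm
    exact mul_self_eq_one_iff.1 this
  rcases hs with hs | hs <;> simp [hs]

theorem eps_smul_sq (g : Q) {a : Ω} {U : Finset Ω} (ha : a ∉ U) :
    D.eps (g • a) (g • U) * D.eps (g • a) (g • U) = 1 :=
  D.eps_sq (by rwa [Finset.smul_mem_smul_finset_iff])

theorem chi_one (U : Finset Ω) : D.chi (1 : Q) U = 1 := by
  induction U using Finset.induction_on with
  | empty => rfl
  | insert a U ha ih => rw [D.chi_insert _ ha, ih, one_smul, one_smul, D.eps_sq ha, one_mul]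

theorem chi_mul (g h : Q) (U : Finset Ω) : D.chi (g * h) U = D.chi g (h • U) * D.chi h U := by
  induction U using Finset.induction_on with
  | empty => simp [chi_empty]
  | insert a U ha ih =>
    have ha' : h • a ∉ h • U := by rwa [Finset.smul_mem_smul_finset_iff]
    rw [D.chi_insert _ ha, D.chi_insert _ ha, Finset.smul_finset_insert, D.chi_insert _ ha', ih,
      mul_smul, mul_smul]
    have := D.eps_smul_sq h ha
    linear_combination (-(D.chi g (h • U) * D.chi h U * D.eps (g • h • a) (g • h • U)
      * D.eps a U)) * this

theorem eps_smul_mul_chi_insert (g : Q) (a : Ω) (U : Finset Ω) :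
    D.eps (g • a) (g • U) * D.chi g (insert a U) = D.chi g U * D.eps a U := by
  by_cases ha : a ∈ U
  · rw [D.eps_of_mem ha, D.eps_of_mem (Finset.smul_mem_smul_finset ha), zero_mul, mul_zero]
  · rw [D.chi_insert g ha]
    have := D.eps_smul_sq g ha
    linear_combination (D.chi g U * D.eps a U) * this

theorem eps_smul_mul_chi (g : Q) (a : Ω) (U : Finset Ω) :
    D.eps (g • a) (g • U) * D.chi g U = D.chi g (insert a U) * D.eps a U := by
  by_cases ha : a ∈ U
  · rw [D.eps_of_mem ha, D.eps_of_mem (Finset.smul_mem_smul_finset ha), zero_mul, mul_zero]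
  · rw [D.chi_insert g ha]
    have := D.eps_sq ha
    linear_combination (-(D.chi g U * D.eps (g • a) (g • U))) * this

/-- Compatibility of a fibration with group actions. -/
structure Equivariant (Q : Type) [Group Q] {X Ω : Type} [MulAction Q X] [MulAction Q Ω]
    (D : CyclicFibration X Ω) : Prop where
  q_smul : ∀ (g : Q) (x : X), D.q (g • x) = g • D.q x
  z_smul : ∀ (g : Q) (x : X), D.z (g • x) = g • D.z x

variable {D}

theorem Equivariant.image_smul (hD : D.Equivariant Q) (g : Q) (σ : Finset X) :
    (g • σ).image D.q = g • σ.image D.q := by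
  rw [Finset.smul_finset_def, Finset.smul_finset_def, Finset.image_image, Finset.image_image]
  exact Finset.image_congr fun x _ => hD.q_smul g x

/-- The orientation cocycle on finite subsets of the total space. -/
def cocycle (hD : D.Equivariant Q) : SignCocycle Q (Finset X) where
  toFun g σ := D.chi g (σ.image D.q)
  map_one σ := D.chi_one _
  map_mul g h σ := by rw [hD.image_smul, D.chi_mul]

theorem cocycle_apply (hD : D.Equivariant Q) (g : Q) (σ : Finset X) :
    cocycle hD g σ = D.chi g (σ.image D.q) := rfl

/-- The twisted translation by `g`, with coefficients acted upon by `α`. -/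
def twist (hD : D.Equivariant Q) (g : Q) (α : A →+ A) : AddMonoid.End (Finset X → A) where
  toFun φ σ := cocycle hD g (g⁻¹ • σ) • α (φ (g⁻¹ • σ))
  map_zero' := by ext; simp
  map_add' φ ψ := by ext; simp

theorem twist_apply (hD : D.Equivariant Q) (g : Q) (α : A →+ A) (φ : Finset X → A)
    (σ : Finset X) : twist hD g α φ σ = cocycle hD g (g⁻¹ • σ) • α (φ (g⁻¹ • σ)) := rfl

theorem twist_apply_smul (hD : D.Equivariant Q) (g : Q) (α : A →+ A) (φ : Finset X → A)
    (σ : Finset X) : twist hD g α φ (g • σ) = D.chi g (σ.image D.q) • α (φ σ) := by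
  rw [twist_apply, inv_smul_smul, cocycle_apply]

theorem twist_ext {g : Q} {φ ψ : Finset X → A} (h : ∀ σ : Finset X, φ (g • σ) = ψ (g • σ)) :
    φ = ψ := by
  ext σ
  rw [← smul_inv_smul g σ]
  exact h _

theorem ins_twist (hD : D.Equivariant Q) (g : Q) (α : A →+ A) (t : X) (φ : Finset X → A) :
    D.ins (g • t) (twist hD g α φ) = twist hD g α (D.ins t φ) := by
  refine twist_ext (g := g) fun σ => ?_
  rw [ins_apply, ← Finset.smul_finset_insert, twist_apply_smul, twist_apply_smul, hD.image_smul,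
    hD.q_smul, smul_smul, Finset.image_insert, D.eps_smul_mul_chi_insert, ins_apply, map_zsmul,
    smul_smul]

theorem del_twist (hD : D.Equivariant Q) (g : Q) (α : A →+ A) (t : X) (φ : Finset X → A) :
    D.del (g • t) (twist hD g α φ) = twist hD g α (D.del t φ) := by
  refine twist_ext (g := g) fun σ => ?_
  rw [del_apply, twist_apply_smul, del_apply]
  simp only [Finset.smul_mem_smul_finset_iff]
  split_ifs with h
  · have he : (g • σ).erase (g • t) = g • σ.erase t :=
      (Finset.image_erase (MulAction.injective g) σ t).symm
    conv_rhs => rw [← Finset.insert_erase h, Finset.erase_insert (Finset.notMem_erase _ _)]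
    rw [he, twist_apply_smul, hD.image_smul, hD.q_smul, smul_smul, D.eps_smul_mul_chi, map_zsmul,
      smul_smul, Finset.image_insert]
  · rw [map_zero, smul_zero]

theorem bd_twist (hD : D.Equivariant Q) (g : Q) (α : A →+ A) (φ : Finset X → A) :
    D.bd (twist hD g α φ) = twist hD g α (D.bd φ) := by
  rw [bd_apply, bd_apply, map_sum, ← Equiv.sum_comp (MulAction.toPerm g)]
  exact Finset.sum_congr rfl fun t _ => ins_twist hD g α t φ

theorem cobd_twist (hD : D.Equivariant Q) (g : Q) (α : A →+ A) (φ : Finset X → A) :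
    D.cobd (twist hD g α φ) = twist hD g α (D.cobd φ) := by
  rw [cobd_apply, cobd_apply, map_sum, ← Equiv.sum_comp (MulAction.toPerm g)]
  exact Finset.sum_congr rfl fun t _ => del_twist hD g α t φ

theorem pull_twist (hD : D.Equivariant Q) (g : Q) (α : A →+ A) (U : Finset Ω)
    (φ : Finset X → A) : D.pull (g • U) (twist hD g α φ) = twist hD g α (D.pull U φ) := by
  refine twist_ext (g := g) fun σ => ?_
  have h : (g • σ).image (D.rho (g • U)) = g • σ.image (D.rho U) := by
    rw [Finset.smul_finset_def (s := σ), Finset.smul_finset_def (s := σ.image _),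
      Finset.image_image, Finset.image_image]
    refine Finset.image_congr fun x _ => ?_
    simp only [Function.comp_apply, rho_apply, hD.q_smul, Finset.smul_mem_smul_finset_iff]
    split_ifs
    · exact hD.z_smul g x
    · rfl
  rw [pull_apply, h, twist_apply_smul, twist_apply_smul, image_rho_image, pull_apply]

theorem theta_twist (hD : D.Equivariant Q) (g : Q) (α : A →+ A) (φ : Finset X → A) :
    D.theta Finset.univ (twist hD g α φ) = twist hD g α (D.theta Finset.univ φ) := by
  rw [theta_apply, theta_apply, map_sum, Finset.powerset_univ, ← Equiv.sum_comp (MulAction.toPerm g)]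
  refine Finset.sum_congr rfl fun U _ => ?_
  rw [MulAction.toPerm_apply, Finset.card_smul_finset, pull_twist, map_zsmul]

theorem Equivariant.tr_smul (hD : D.Equivariant Q) (g : Q) {σ : Finset X} (h : D.Tr σ) :
    D.Tr (g • σ) := by
  rw [Tr, ← Finset.card_image_iff] at h ⊢
  rw [hD.image_smul, Finset.card_smul_finset, Finset.card_smul_finset, h]

end CyclicFibration

theorem HasRes.of_submodules {R V : Type} [Ring R] [AddCommGroup V] [Module R V]
    (𝒯 : Set (Submodule R V)) (x : ℕ → ℕ)
    (h : ∀ T ∈ 𝒯, ∃ (S : Submodule R V) (F : V →ₗ[R] V), HasRes R S x ∧ S.map F = T ∧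
      S ⊓ LinearMap.ker F ∈ 𝒯) {T : Submodule R V} (hT : T ∈ 𝒯) :
    HasRes R T (fun n => ∑ i ∈ Finset.range (n + 1), x i) := by
  refine HasRes.of_class (fun N _ _ => ∃ T ∈ 𝒯, Nonempty (T ≃ₗ[R] N)) x ?_
    ⟨T, hT, ⟨LinearEquiv.refl R T⟩⟩
  rintro N _ _ ⟨T, hT, ⟨e⟩⟩
  obtain ⟨S, F, hS, rfl, hK⟩ := h T hT
  refine ⟨S, inferInstance, inferInstance, (S ⊓ LinearMap.ker F : Submodule R V), inferInstance,
    inferInstance, Submodule.inclusion inf_le_left,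
    e.toLinearMap ∘ₗ F.restrict (fun v hv => Submodule.mem_map_of_mem hv),
    ⟨_, hK, ⟨LinearEquiv.refl R _⟩⟩, hS, Submodule.inclusion_injective _, ?_, ?_⟩
  · refine e.surjective.comp ?_
    rintro ⟨_, v, hv, rfl⟩
    exact ⟨⟨v, hv⟩, rfl⟩
  · rintro ⟨v, hv⟩
    constructor
    · intro h0
      have h1 := e.injective (h0.trans (map_zero e).symm)
      exact ⟨⟨v, hv, congrArg Subtype.val h1⟩, rfl⟩
    · rintro ⟨⟨w, hw⟩, h0⟩
      obtain rfl : w = v := congrArg Subtype.val h0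
      change e _ = 0
      rw [← map_zero e]
      exact congrArg e (Subtype.ext hw.2)

namespace CyclicFibration

variable {k : Type} [Ring k] {G : Type} [Group G]
  {Q X Ω : Type} [Group Q] [MulAction Q X] [MulAction Q Ω] [Fintype X] [DecidableEq X]
  [Fintype Ω] [DecidableEq Ω] {D : CyclicFibration X Ω}
  {M : Type} [AddCommGroup M] [Module (MonoidAlgebra k G) M]

theorem single_smul_toFun (hD : D.Equivariant Q) (π : G →* Q) (g : G) (a : k)
    (φ : TwFun π (cocycle hD) M) : (single g a • φ).toFun =
      twist hD (π g) (DistribSMul.toAddMonoidHom M (single g a)) φ.toFun :=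
  funext fun l => TwFun.single_smul_apply g a φ l

/-- An operator commuting with all twisted translations is linear over the group ring. -/
def lift (k : Type) [Ring k] {M : Type} [AddCommGroup M] [Module (MonoidAlgebra k G) M]
    (hD : D.Equivariant Q) (π : G →* Q) (F : AddMonoid.End (Finset X → M))
    (hF : ∀ g α φ, F (twist hD g α φ) = twist hD g α (F φ)) :
    TwFun π (cocycle hD) M →ₗ[MonoidAlgebra k G] TwFun π (cocycle hD) M :=
  groupRingLinear
    { toFun := fun φ => ⟨F φ.toFun⟩
      map_zero' := TwFun.ext (map_zero F)
      map_add' := fun φ ψ => TwFun.ext (map_add F φ.toFun ψ.toFun) }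
    (fun a φ => TwFun.ext <| by
      change F (single (1 : G) a • φ).toFun = _
      rw [single_smul_toFun, hF, single_smul_toFun]
      rfl)
    (fun g φ => TwFun.ext <| by
      change F (single g (1 : k) • φ).toFun = _
      rw [single_smul_toFun, hF, single_smul_toFun]
      rfl)

theorem Equivariant.tr_card_smul (hD : D.Equivariant Q) (j : ℕ) (g : Q) (σ : Finset X)
    (h : D.Tr σ ∧ σ.card = j) : D.Tr (g • σ) ∧ (g • σ).card = j :=
  ⟨hD.tr_smul g h.1, by rw [Finset.card_smul_finset, h.2]⟩

/-- The functions supported on partial transversals of cardinality `j`, as a module. -/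
def subMod (k : Type) [Ring k] (hD : D.Equivariant Q) (π : G →* Q) (M : Type) [AddCommGroup M]
    [Module (MonoidAlgebra k G) M] (j : ℕ) :
    Submodule (MonoidAlgebra k G) (TwFun π (cocycle hD) M) :=
  TwFun.supp k π (cocycle hD) M {σ | D.Tr σ ∧ σ.card = j} (hD.tr_card_smul j)

theorem bd_eq_zero_of_mem_Sub_zero {φ : Finset X → M} (hφ : φ ∈ D.Sub 0) : D.bd φ = 0 := by
  rw [bd_apply]
  refine Finset.sum_eq_zero fun t _ => ?_
  ext σ
  rw [ins_apply, hφ (insert t σ), smul_zero, Pi.zero_apply]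
  rintro ⟨-, h⟩
  exact Finset.insert_ne_empty t σ (Finset.card_eq_zero.1 h)

/-- Evaluation at the empty set. -/
def evalEmpty (k : Type) [Ring k] {M : Type} [AddCommGroup M] [Module (MonoidAlgebra k G) M]
    (hD : D.Equivariant Q) (π : G →* Q) : TwFun π (cocycle hD) M →ₗ[MonoidAlgebra k G] M :=
  groupRingLinear
    { toFun := fun φ => φ ∅
      map_zero' := rfl
      map_add' := fun _ _ => rfl }
    (fun a φ => TwFun.scalar_smul_apply a φ ∅)
    (fun g φ => by
      change (single g (1 : k) • φ) ∅ = _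
      rw [TwFun.single_smul_apply, Finset.smul_finset_empty, cocycle_apply, Finset.image_empty,
        chi_empty, one_smul]
      rfl)

/-- A module has a resolution controlled by those of the modules of functions on nonempty partial
transversals. -/
theorem hasRes [Nonempty Ω] (hD : D.Equivariant Q) (π : G →* Q) (x : ℕ → ℕ)
    (hx : ∀ j, j < Fintype.card Ω → HasRes (MonoidAlgebra k G) (subMod k hD π M (j + 1)) x) :
    HasRes (MonoidAlgebra k G) M (fun n => ∑ i ∈ Finset.range (n + 1), x i) := by
  let S := subMod k hD π M
  let b := lift k hD π (M := M) D.bd (fun g α φ => bd_twist hD g α φ)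
  let c := lift k hD π (M := M) D.cobd (fun g α φ => cobd_twist hD g α φ)
  let θ := lift k hD π (M := M) (D.theta Finset.univ) (fun g α φ => theta_twist hD g α φ)
  have hb : ∀ φ, (b φ).toFun = D.bd φ.toFun := fun φ => rfl
  have hc : ∀ φ, (c φ).toFun = D.cobd φ.toFun := fun φ => rfl
  have hθ : ∀ φ, (θ φ).toFun = D.theta Finset.univ φ.toFun := fun φ => rfl
  have hker : ∀ (F : TwFun π (cocycle hD) M →ₗ[MonoidAlgebra k G] TwFun π (cocycle hD) M) φ,
      φ ∈ LinearMap.ker F ↔ (F φ).toFun = 0 :=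
    fun F φ => ⟨fun h => congrArg TwFun.toFun (LinearMap.mem_ker.1 h), fun h => TwFun.ext h⟩
  obtain ⟨m, hm⟩ : ∃ m, Fintype.card Ω = m + 1 := Nat.exists_eq_succ_of_ne_zero Fintype.card_ne_zero
  let 𝒯 : Set (Submodule (MonoidAlgebra k G) (TwFun π (cocycle hD) M)) :=
    {T | (∃ j ≤ Fintype.card Ω, S j ⊓ LinearMap.ker b = T) ∨
      ∃ j < Fintype.card Ω, (S j).map c = T}
  have hmapb : ∀ j < Fintype.card Ω, (S (j + 1)).map b = S j ⊓ LinearMap.ker b := by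
    intro j hj
    ext φ
    constructor
    · rintro ⟨ψ, hψ, rfl⟩
      refine ⟨D.bd_mem_Sub hψ, (hker _ _).2 ?_⟩
      rw [hb, hb, bd_bd]
    · rintro ⟨h1, h2⟩
      obtain ⟨w, hw, h⟩ := D.exists_bd_eq hj h1 ((hker _ _).1 h2)
      exact ⟨⟨w⟩, hw, TwFun.ext h⟩
  have key : ∀ T ∈ 𝒯, ∃ (U : Submodule (MonoidAlgebra k G) (TwFun π (cocycle hD) M))
      (F : TwFun π (cocycle hD) M →ₗ[MonoidAlgebra k G] TwFun π (cocycle hD) M),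
      HasRes (MonoidAlgebra k G) U x ∧ U.map F = T ∧ U ⊓ LinearMap.ker F ∈ 𝒯 := by
    rintro T (⟨j, hj, rfl⟩ | ⟨j, hj, rfl⟩)
    · rcases hj.lt_or_eq with hj | rfl
      · exact ⟨S (j + 1), b, hx j hj, hmapb j hj, Or.inl ⟨j + 1, hj, rfl⟩⟩
      · refine ⟨S (Fintype.card Ω), θ, ?_, ?_, Or.inr ⟨m, by omega, ?_⟩⟩
        · rw [hm]
          exact hx m (by omega)
        · ext φ
          constructor
          · rintro ⟨ψ, hψ, rfl⟩
            refine ⟨D.theta_mem_Sub hψ _, (hker _ _).2 ?_⟩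
            rw [hb, hθ, bd_theta]
          · rintro ⟨h1, h2⟩
            obtain ⟨u, hu, h⟩ := D.exists_theta_eq h1 ((hker _ _).1 h2)
            exact ⟨⟨u⟩, hu, TwFun.ext h⟩
        · ext φ
          constructor
          · rintro ⟨ψ, hψ, rfl⟩
            refine ⟨?_, (hker _ _).2 ?_⟩
            · rw [hm]
              exact D.cobd_mem_Sub hψ
            · rw [hθ, hc, theta_cobd]
          · rintro ⟨h1, h2⟩
            rw [hm] at h1
            obtain ⟨w, hw, h⟩ := D.exists_cobd_eq_of_theta hm.symm h1 ((hker _ _).1 h2)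
            exact ⟨⟨w⟩, hw, TwFun.ext h⟩
    · rcases j with _ | j
      · have hinj : S 1 ⊓ LinearMap.ker (c ∘ₗ b) = S 1 ⊓ LinearMap.ker b := by
          ext φ
          refine and_congr_right fun h1 => ?_
          rw [SetLike.mem_coe, SetLike.mem_coe, hker, hker, LinearMap.comp_apply, hc]
          exact ⟨fun h => D.eq_zero_of_cobd_eq_zero (D.bd_mem_Sub h1) h, fun h => by
            rw [h, map_zero]⟩
        refine ⟨S 1, c ∘ₗ b, hx 0 hj, ?_, Or.inl ⟨1, hj, hinj.symm⟩⟩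
        rw [Submodule.map_comp, hmapb 0 hj]
        congr 1
        exact inf_eq_left.2 fun φ hφ => (hker _ _).2 (bd_eq_zero_of_mem_Sub_zero hφ)
      · refine ⟨S (j + 1), c, hx j (by omega), rfl, Or.inr ⟨j, by omega, ?_⟩⟩
        ext φ
        constructor
        · rintro ⟨ψ, hψ, rfl⟩
          refine ⟨D.cobd_mem_Sub hψ, (hker _ _).2 ?_⟩
          rw [hc, hc, cobd_cobd]
        · rintro ⟨h1, h2⟩
          obtain ⟨w, hw, h⟩ := D.exists_cobd_eq hj h1 ((hker _ _).1 h2)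
          exact ⟨⟨w⟩, hw, TwFun.ext h⟩
  have h0 : S 0 ⊓ LinearMap.ker b ∈ 𝒯 := Or.inl ⟨0, Nat.zero_le _, rfl⟩
  refine (HasRes.of_submodules 𝒯 x key h0).of_equiv
    (LinearEquiv.ofBijective ((evalEmpty k hD π).domRestrict _) ⟨?_, ?_⟩)
  · rw [injective_iff_map_eq_zero]
    rintro ⟨φ, h1, h2⟩ h
    refine Subtype.ext (TwFun.ext (funext fun σ => ?_))
    by_cases hσ : σ = ∅
    · rw [hσ]
      exact h
    · exact h1 σ fun h' => hσ (Finset.card_eq_zero.1 h'.2)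
  · intro v
    have hv : (fun σ : Finset X => if σ = ∅ then v else 0) ∈ D.Sub 0 := by
      intro σ hσ
      refine if_neg ?_
      rintro rfl
      exact hσ ⟨by simp [Tr], rfl⟩
    refine ⟨⟨⟨fun σ => if σ = ∅ then v else 0⟩, hv,
      (hker _ _).2 (bd_eq_zero_of_mem_Sub_zero hv)⟩, ?_⟩
    change (if (∅ : Finset X) = ∅ then v else 0) = v
    exact if_pos rfl

end CyclicFibration

/-- Polynomial growth of degree less than `r`; for `r = 0`, eventual vanishing. -/
def HasGrowth : ℕ → (ℕ → ℕ) → Prop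
  | 0, x => ∃ N, ∀ n ≥ N, x n = 0
  | r + 1, x => ∃ C, ∀ n, x n ≤ C * (n + 1) ^ r

namespace HasGrowth

theorem zero_fun (r : ℕ) : HasGrowth r 0 := by
  cases r with
  | zero => exact ⟨0, fun _ _ => rfl⟩
  | succ r => exact ⟨0, fun _ => Nat.zero_le _⟩

theorem add {r : ℕ} {x y : ℕ → ℕ} (hx : HasGrowth r x) (hy : HasGrowth r y) :
    HasGrowth r (x + y) := by
  cases r with
  | zero =>
    obtain ⟨N, hN⟩ := hx
    obtain ⟨N', hN'⟩ := hy
    refine ⟨max N N', fun n hn => ?_⟩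
    rw [Pi.add_apply, hN n (le_of_max_le_left hn), hN' n (le_of_max_le_right hn)]
  | succ r =>
    obtain ⟨C, hC⟩ := hx
    obtain ⟨C', hC'⟩ := hy
    refine ⟨C + C', fun n => ?_⟩
    rw [add_mul]
    exact Nat.add_le_add (hC n) (hC' n)

theorem sum {ι : Type} {r : ℕ} (s : Finset ι) (x : ι → ℕ → ℕ) (h : ∀ i ∈ s, HasGrowth r (x i)) :
    HasGrowth r (∑ i ∈ s, x i) :=
  Finset.sum_induction _ (HasGrowth r) (fun _ _ => add) (zero_fun r) h

theorem exists_le {r : ℕ} {x : ℕ → ℕ} (hx : HasGrowth r x) :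
    ∃ C, ∀ n, x n ≤ C * (n + 1) ^ (r - 1) := by
  cases r with
  | zero =>
    obtain ⟨N, hN⟩ := hx
    refine ⟨∑ i ∈ Finset.range N, x i, fun n => ?_⟩
    rw [Nat.zero_sub, pow_zero, mul_one]
    by_cases hn : n < N
    · exact Finset.single_le_sum (fun _ _ => Nat.zero_le _) (Finset.mem_range.2 hn)
    · rw [hN n (not_lt.1 hn)]
      exact Nat.zero_le _
  | succ r => exact hx

theorem succ {r : ℕ} {x : ℕ → ℕ} (hx : HasGrowth r x) : HasGrowth (r + 1) x := by
  obtain ⟨C, hC⟩ := hx.exists_le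
  exact ⟨C, fun n => (hC n).trans
    (Nat.mul_le_mul_left C (Nat.pow_le_pow_right n.succ_pos (Nat.sub_le r 1)))⟩

theorem mono {r s : ℕ} (hrs : r ≤ s) {x : ℕ → ℕ} (hx : HasGrowth r x) : HasGrowth s x := by
  induction hrs with
  | refl => exact hx
  | step _ ih => exact ih.succ

theorem partial_sums {r : ℕ} {x : ℕ → ℕ} (hx : HasGrowth r x) :
    HasGrowth (r + 1) (fun n => ∑ i ∈ Finset.range (n + 1), x i) := by
  cases r with
  | zero =>
    obtain ⟨N, hN⟩ := hx
    refine ⟨∑ i ∈ Finset.range N, x i, fun n => ?_⟩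
    rw [pow_zero, mul_one]
    refine Finset.sum_le_sum_of_ne_zero fun i _ hi => Finset.mem_range.2 ?_
    by_contra h
    exact hi (hN i (not_lt.1 h))
  | succ r =>
    obtain ⟨C, hC⟩ := hx
    refine ⟨C, fun n => ?_⟩
    calc ∑ i ∈ Finset.range (n + 1), x i ≤ ∑ _i ∈ Finset.range (n + 1), C * (n + 1) ^ r := by
          refine Finset.sum_le_sum fun i hi => (hC i).trans ?_
          have := Finset.mem_range.1 hi
          gcongr
          omega
      _ = C * (n + 1) ^ (r + 1) := by
          rw [Finset.sum_const, Finset.card_range, smul_eq_mul]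
          ring

end HasGrowth

/-- Elementary abelian `p`-subgroups of `Q` have rank at most `r`. -/
def PRankLE (p : ℕ) (Q : Type) [Group Q] (r : ℕ) : Prop :=
  ∀ (s : ℕ) (f : Multiplicative (Fin s → ZMod p) →* Q), Function.Injective f → s ≤ r

theorem PRankLE.of_injective {p r : ℕ} {Q K : Type} [Group Q] [Group K] (h : PRankLE p Q r)
    (j : K →* Q) (hj : Function.Injective j) : PRankLE p K r :=
  fun s f hf => h s (j.comp f) (hj.comp hf)

/-- The homomorphism from `ℤ/p` determined by an element killed by `p`. -/
def zmodHom {Q : Type} [Group Q] {p : ℕ} (z : Q) (hz : z ^ p = 1) :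
    Multiplicative (ZMod p) →* Q :=
  AddMonoidHom.toMultiplicativeLeft (ZMod.lift p
    ⟨(zpowersHom Q z).toAdditiveRight, by simp [hz]⟩)

theorem zmodHom_intCast {Q : Type} [Group Q] {p : ℕ} (z : Q) (hz : z ^ p = 1) (n : ℤ) :
    zmodHom z hz (Multiplicative.ofAdd (n : ZMod p)) = z ^ n := by
  simp [zmodHom]

/-- Adjoining a central element of order `p` raises the `p`-rank of a complement. -/
theorem PRankLE.succ_le_of_central {p r : ℕ} {Q : Type} [Group Q] (h : PRankLE p Q r)
    {z : Q} (hz : z ∈ Subgroup.center Q) (hzp : orderOf z = p) (K : Subgroup Q)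
    (hK : ∀ n : ℤ, z ^ n ∈ K → z ^ n = 1) {s : ℕ} (f : Multiplicative (Fin s → ZMod p) →* K)
    (hf : Function.Injective f) : s + 1 ≤ r := by
  have hzp1 : z ^ p = 1 := hzp ▸ pow_orderOf_eq_one z
  have hcomm : ∀ (n : ℤ) (g : Q), Commute (z ^ n) g := fun n g =>
    Commute.zpow_left ((Subgroup.mem_center_iff.1 hz g).symm) n
  let t : Multiplicative (Fin (s + 1) → ZMod p) →* Multiplicative (Fin s → ZMod p) :=
    AddMonoidHom.toMultiplicative
      { toFun := fun v => Fin.tail v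
        map_zero' := rfl
        map_add' := fun _ _ => rfl }
  let e : Multiplicative (Fin (s + 1) → ZMod p) →* Multiplicative (ZMod p) :=
    AddMonoidHom.toMultiplicative (Pi.evalAddMonoidHom _ 0)
  have hex : ∀ v, ∃ n : ℤ, (n : ZMod p) = Multiplicative.toAdd (e v) ∧
      zmodHom z hzp1 (e v) = z ^ n := by
    intro v
    obtain ⟨n, hn⟩ := ZMod.intCast_surjective (Multiplicative.toAdd (e v))
    refine ⟨n, hn, ?_⟩
    rw [← zmodHom_intCast z hzp1 n, hn]
    rfl
  let F : Multiplicative (Fin (s + 1) → ZMod p) →* Q :=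
    { toFun := fun v => zmodHom z hzp1 (e v) * (f (t v) : Q)
      map_one' := by simp
      map_mul' := fun v w => by
        obtain ⟨n, -, hn⟩ := hex w
        rw [map_mul, map_mul, map_mul, map_mul, Subgroup.coe_mul, mul_assoc, mul_assoc, hn]
        congr 1
        rw [← mul_assoc, ← mul_assoc, (hcomm n _).eq] }
  have hF : Function.Injective F := by
    rw [injective_iff_map_eq_one]
    intro v hv
    obtain ⟨n, hn1, hn⟩ := hex v
    have hv' : z ^ n * (f (t v) : Q) = 1 := hn ▸ hv
    have h1 : z ^ n = 1 := by
      refine hK n ?_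
      rw [mul_eq_one_iff_eq_inv.1 hv']
      exact K.inv_mem (f (t v)).2
    rw [h1, one_mul] at hv'
    have h2 : t v = 1 := hf (by rw [map_one]; exact Subtype.ext hv')
    have h3 : e v = 1 := by
      have : (n : ZMod p) = 0 := by
        rw [ZMod.intCast_zmod_eq_zero_iff_dvd, ← hzp]
        exact orderOf_dvd_iff_zpow_eq_one.2 h1
      exact congrArg Multiplicative.ofAdd (hn1.symm.trans this)
    refine Multiplicative.toAdd.injective (funext fun j => ?_)
    refine Fin.cases ?_ (fun j => ?_) j
    · exact h3
    · exact congrFun h2 j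
  exact h (s + 1) F hF

/-- A finite group fibred over its quotient by a central cyclic subgroup. -/
def centralFibration {Q : Type} [Group Q] [Finite Q] (z : Q) :
    CyclicFibration Q (Q ⧸ Subgroup.zpowers z) where
  q := QuotientGroup.mk
  q_surjective := Quotient.mk_surjective
  z := Equiv.mulRight z
  q_z x := QuotientGroup.mk_mul_of_mem x (Subgroup.mem_zpowers z)
  exists_pow x y h := by
    have h1 : x⁻¹ * y ∈ Subgroup.zpowers z := QuotientGroup.eq.1 h
    obtain ⟨n, hn⟩ := (mem_powers_iff_mem_zpowers.2 h1)
    refine ⟨n, ?_⟩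
    have hn' : z ^ n = x⁻¹ * y := hn
    rw [Equiv.pow_mulRight, hn']
    exact mul_inv_cancel_left x y
  sgn a b := Int.sign ((Finite.equivFin _ a : ℤ) - Finite.equivFin _ b)
  sgn_self a := by simp
  sgn_swap a b := by rw [← Int.sign_neg, neg_sub]
  sgn_sq a b h := by
    have : ((Finite.equivFin _ a : ℕ) : ℤ) - (Finite.equivFin _ b : ℕ) ≠ 0 := by
      intro h'
      refine h ((Finite.equivFin _).injective (Fin.ext ?_))
      omega
    rw [← Int.sign_mul, Int.sign_eq_one_of_pos (mul_self_pos.2 this)]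

theorem centralFibration_equivariant {Q : Type} [Group Q] [Finite Q] (z : Q) :
    (centralFibration z).Equivariant Q where
  q_smul _ _ := rfl
  z_smul g x := mul_assoc g x z

theorem eq_one_of_zpow_mem_stabilizer {Q : Type} [Group Q] [Finite Q] [DecidableEq Q] {z : Q}
    (hz : z ∈ Subgroup.center Q) {σ : Finset Q} (hσ : (centralFibration z).Tr σ)
    (hne : σ.Nonempty) (n : ℤ) (hn : z ^ n ∈ MulAction.stabilizer Q σ) : z ^ n = 1 := by
  obtain ⟨x, hx⟩ := hne
  have h1 : z ^ n * x ∈ σ := by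
    rw [← MulAction.mem_stabilizer_iff.1 hn]
    exact Finset.smul_mem_smul_finset hx
  have hc : z ^ n * x = x * z ^ n :=
    Commute.zpow_left ((Subgroup.mem_center_iff.1 hz x).symm) n
  have h2 : z ^ n * x = x := by
    refine hσ h1 hx ?_
    rw [hc]
    exact QuotientGroup.mk_mul_of_mem x (Subgroup.zpow_mem_zpowers z n)
  exact mul_eq_right.1 h2

section PGroup

variable {G Q Γ : Type} [Group G] [Group Q] [Group Γ]

theorem toComap_injective {π : G →* Q} {i : Γ →* G} (hi : ∀ γ, π (i γ) = 1)
    (hinj : Function.Injective i) (K : Subgroup Q) : Function.Injective (toComap π i hi K) :=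
  fun _ _ h => hinj (congrArg Subtype.val h)

theorem map_toComap_eq_one {π : G →* Q} {i : Γ →* G} (hi : ∀ γ, π (i γ) = 1) (K : Subgroup Q)
    (γ : Γ) : π.subgroupComap K (toComap π i hi K γ) = 1 :=
  Subtype.ext (hi γ)

theorem exists_toComap_eq {π : G →* Q} {i : Γ →* G} (hi : ∀ γ, π (i γ) = 1)
    (hker : ∀ g, π g = 1 → ∃ γ, i γ = g) (K : Subgroup Q) (g : K.comap π)
    (hg : π.subgroupComap K g = 1) : ∃ γ, toComap π i hi K γ = g := by
  obtain ⟨γ, hγ⟩ := hker g (congrArg Subtype.val hg)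
  exact ⟨γ, Subtype.ext hγ⟩

theorem exists_hasGrowth_transfers (k : Type) [Ring k] (p : ℕ) [Fact p.Prime] (m : ℕ) :
    ∀ (Q : Type) [Group Q] [Finite Q], Nat.card Q = m → IsPGroup p Q → ∀ r, PRankLE p Q r →
    ∀ (G Γ : Type) [Group G] [Group Γ] (π : G →* Q) (i : Γ →* G), Function.Surjective π →
    Function.Injective i → (∀ γ, π (i γ) = 1) → (∀ g, π g = 1 → ∃ γ, i γ = g) →
    ∀ a, HasGrowth 0 a → ∃ b, HasGrowth r b ∧ Transfers k i a b := by
  induction m using Nat.strong_induction_on with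
  | _ m ih =>
  intro Q _ _ hm hQ r hr G Γ _ _ π i hπ hinj hi hker a ha
  rcases subsingleton_or_nontrivial Q with hs | hs
  · refine ⟨a, ha.mono (Nat.zero_le r), fun M _ _ hM => HasRes.of_bijective ⟨hinj, fun g => ?_⟩ hM⟩
    exact hker g (Subsingleton.elim _ _)
  classical
  have := hQ.center_nontrivial
  obtain ⟨z, hzp⟩ : ∃ z : Subgroup.center Q, orderOf z = p := by
    obtain ⟨n, hn, hcard⟩ := (hQ.to_subgroup (Subgroup.center Q)).nontrivial_iff_card.1 this
    exact exists_prime_orderOf_dvd_card' p (hcard ▸ dvd_pow_self p hn.ne')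
  have hzp' : orderOf (z : Q) = p := by rw [Subgroup.orderOf_coe, hzp]
  have hz1 : (z : Q) ≠ 1 := by
    intro h
    rw [h, orderOf_one] at hzp'
    exact (Fact.out : p.Prime).one_lt.ne hzp'
  obtain ⟨r, rfl⟩ : ∃ r', r = r' + 1 := by
    refine Nat.exists_eq_succ_of_ne_zero (Nat.one_le_iff_ne_zero.1 ?_)
    exact hr.succ_le_of_central (s := 0) z.2 hzp' ⊥ (fun _ h => h) 1
      (Function.injective_of_subsingleton _)
  let D := centralFibration (z : Q)
  let _ : Fintype Q := Fintype.ofFinite Q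
  let _ : Fintype (Q ⧸ Subgroup.zpowers (z : Q)) := Fintype.ofFinite _
  have hD : D.Equivariant Q := centralFibration_equivariant (z : Q)
  have hb : ∀ j : ℕ, ∃ b, HasGrowth r b ∧ ∀ (M : Type) [AddCommGroup M]
      [Module (MonoidAlgebra k G) M], HasRes (MonoidAlgebra k Γ) (GRst k i M) a →
      HasRes (MonoidAlgebra k G) (CyclicFibration.subMod k hD π M (j + 1)) b := by
    intro j
    refine TwFun.hasRes_supp hπ hi _ _ _ (HasGrowth r) (HasGrowth.zero_fun r)
      (fun _ _ => HasGrowth.add) ?_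
    rintro σ ⟨hσ, hcard⟩
    have hσ' : σ.Nonempty := Finset.card_pos.1 (by omega)
    have hK := eq_one_of_zpow_mem_stabilizer z.2 hσ hσ'
    set K := MulAction.stabilizer Q σ
    have hlt : Nat.card K < m := by
      rw [← hm]
      refine (Subgroup.card_le_card_group K).lt_of_ne fun h => hz1 ?_
      have := hK 1
      rw [Subgroup.eq_top_of_card_eq K h, zpow_one] at this
      exact this (Subgroup.mem_top _)
    exact ih _ hlt K rfl (hQ.to_subgroup K) r (fun s f hf =>
      Nat.le_of_succ_le_succ (hr.succ_le_of_central z.2 hzp' K hK f hf)) _ Γ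
      (π.subgroupComap K) (toComap π i hi K)
      (π.subgroupComap_surjective_of_surjective K hπ) (toComap_injective hi hinj K)
      (map_toComap_eq_one hi K) (exists_toComap_eq hi hker K) a ha
  choose b hb1 hb2 using hb
  let x := ∑ j ∈ Finset.range (Fintype.card (Q ⧸ Subgroup.zpowers (z : Q))), b j
  refine ⟨_, (HasGrowth.sum _ b fun j _ => hb1 j : HasGrowth r x).partial_sums,
    fun M _ _ hM => CyclicFibration.hasRes hD π x fun j hj => (hb2 j M hM).mono fun n => ?_⟩
  rw [show x n = ∑ j ∈ _, b j n from Finset.sum_apply n _ b]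
  exact Finset.single_le_sum (f := fun j => b j n) (fun _ _ => Nat.zero_le _)
    (Finset.mem_range.2 hj)

end PGroup

section Resolutions

variable {R : Type} [Ring R]

theorem exists_projectiveResolution {Z : ModuleCat.{0} R} (K : ChainComplex (ModuleCat.{0} R) ℕ)
    (hK : ∀ n, Projective (K.X n)) (ε : K.X 0 ⟶ Z) (w : K.d 1 0 ≫ ε = 0) (hε : Epi ε)
    (h0 : (ShortComplex.mk _ _ w).Exact)
    (hn : ∀ n, (ShortComplex.mk _ _ (K.d_comp_d (n + 2) (n + 1) n)).Exact) :
    ∃ P : ProjectiveResolution Z, P.complex = K := by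
  let π : K ⟶ (ChainComplex.single₀ (ModuleCat.{0} R)).obj Z :=
    (ChainComplex.toSingle₀Equiv _ _).symm ⟨ε, w⟩
  have hπ : π.f 0 = ε := ChainComplex.toSingle₀Equiv_symm_apply_f_zero ε w
  refine ⟨{ complex := K, projective := hK, π := π, quasiIso := ⟨fun n => ?_⟩ }, rfl⟩
  cases n with
  | zero =>
    rw [ChainComplex.quasiIsoAt₀_iff, ShortComplex.quasiIso_iff_of_zeros']
    · refine (ShortComplex.exact_and_epi_g_iff_of_iso ?_).2 ⟨h0, hε⟩
      exact ShortComplex.isoMk (Iso.refl _) (Iso.refl _) (Iso.refl _)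
        ((Category.id_comp _).trans (Category.comp_id _).symm)
        ((Category.id_comp _).trans (hπ.symm.trans (Category.comp_id _).symm))
    · exact K.shape 0 0 (by simp)
    · rfl
    · rfl
  | succ n =>
    rw [quasiIsoAt_iff_exactAt' _ _ (ChainComplex.exactAt_succ_single_obj _ _),
      HomologicalComplex.exactAt_iff' _ (n + 1 + 1) (n + 1) n (by simp) (by simp)]
    exact hn n

theorem IsProjGen.rankLE {P : Type} [AddCommGroup P] [Module R P] {n : ℕ} (h : IsProjGen R P n)
    {b : NNReal} (hb : (n : NNReal) ≤ b) : RankLE R P b := by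
  classical
  obtain ⟨-, f, hf⟩ := h
  refine ⟨Finset.univ.image fun i => f (Pi.single i 1), ?_, ?_⟩
  · rw [eq_top_iff, ← LinearMap.range_eq_top.2 hf, ← Submodule.map_top,
      ← (Pi.basisFun R (Fin n)).span_eq, Submodule.map_span, Finset.coe_image, Finset.coe_univ,
      Set.image_univ, ← Set.range_comp]
    refine Submodule.span_mono (Set.range_subset_range_iff_exists_comp.2 ⟨id, ?_⟩)
    ext i
    simp
  · refine le_trans ?_ hb
    exact_mod_cast Finset.card_image_le.trans (by simp)

/-- A module together with a bound for one of its resolutions. -/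
structure BoundedModule (R : Type) [Ring R] where
  /-- The module. -/
  obj : ModuleCat.{0} R
  /-- The bound. -/
  bound : ℕ → ℕ
  hasRes : HasRes R obj bound

namespace BoundedModule

variable (B : BoundedModule R)

theorem exists_cover : ∃ (P : ModuleCat.{0} R) (f : P →ₗ[R] B.obj), IsProjGen R P (B.bound 0) ∧
    Function.Surjective f ∧ HasRes R (LinearMap.ker f) (fun n => B.bound (n + 1)) := by
  obtain ⟨P, _, _, f, h⟩ := B.hasRes.step
  exact ⟨ModuleCat.of R P, f, h⟩

/-- The projective cover. -/
def cover : ModuleCat.{0} R := B.exists_cover.choose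

/-- The covering map. -/
def map : B.cover →ₗ[R] B.obj := B.exists_cover.choose_spec.choose

theorem isProjGen_cover : IsProjGen R B.cover (B.bound 0) :=
  B.exists_cover.choose_spec.choose_spec.1

theorem map_surjective : Function.Surjective B.map := B.exists_cover.choose_spec.choose_spec.2.1

/-- The kernel of the covering map. -/
def syzygy : BoundedModule R where
  obj := ModuleCat.of R (LinearMap.ker B.map)
  bound n := B.bound (n + 1)
  hasRes := B.exists_cover.choose_spec.choose_spec.2.2

/-- The inclusion of the syzygy. -/
def incl : B.syzygy.obj →ₗ[R] B.cover := (LinearMap.ker B.map).subtype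

theorem incl_injective : Function.Injective B.incl := Subtype.val_injective

theorem range_incl : LinearMap.range B.incl = LinearMap.ker B.map := Submodule.range_subtype _

/-- The iterated syzygies. -/
def iter : ℕ → BoundedModule R
  | 0 => B
  | n + 1 => (iter n).syzygy

theorem bound_iter (n m : ℕ) : (B.iter n).bound m = B.bound (n + m) := by
  induction n generalizing m with
  | zero => rw [Nat.zero_add]; rfl
  | succ n ih =>
    change (B.iter n).bound (m + 1) = _
    rw [ih, Nat.add_right_comm, Nat.add_assoc]

/-- The differentials of the resolution. -/
def diff (n : ℕ) : (B.iter (n + 1)).cover ⟶ (B.iter n).cover :=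
  ModuleCat.ofHom ((B.iter n).incl ∘ₗ (B.iter (n + 1)).map)

theorem range_diff (n : ℕ) : LinearMap.range (B.diff n).hom = LinearMap.ker (B.iter n).map := by
  refine Eq.trans ?_ (B.iter n).range_incl
  exact LinearMap.range_comp_of_range_eq_top _ (LinearMap.range_eq_top.2 (map_surjective _))

theorem ker_diff (n : ℕ) : LinearMap.ker (B.diff n).hom = LinearMap.ker (B.iter (n + 1)).map :=
  LinearMap.ker_comp_of_ker_eq_bot _ (LinearMap.ker_eq_bot.2 (incl_injective _))

theorem diff_comp_diff (n : ℕ) : B.diff (n + 1) ≫ B.diff n = 0 := by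
  ext x
  exact LinearMap.mem_ker.1 (((B.range_diff (n + 1)).trans (B.ker_diff n).symm).le ⟨x, rfl⟩)

/-- The complex of the resolution. -/
def complex : ChainComplex (ModuleCat.{0} R) ℕ :=
  ChainComplex.of (fun n => (B.iter n).cover) B.diff B.diff_comp_diff

theorem complex_d (n : ℕ) : B.complex.d (n + 1) n = B.diff n :=
  ChainComplex.of_d (fun n => (B.iter n).cover) B.diff n

theorem exists_projectiveResolution : ∃ P : ProjectiveResolution B.obj, P.complex = B.complex := by
  have hproj : ∀ n, Projective (B.complex.X n) := by
    intro n
    have := (B.iter n).isProjGen_cover.1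
    exact (IsProjective.iff_projective _).1 this
  refine _root_.exists_projectiveResolution B.complex hproj (ModuleCat.ofHom B.map) ?_ ?_ ?_ ?_
  · rw [complex_d]
    ext x
    exact LinearMap.mem_ker.1 ((B.range_diff 0).le ⟨x, rfl⟩)
  · exact (ModuleCat.epi_iff_surjective _).2 B.map_surjective
  · rw [ShortComplex.moduleCat_exact_iff_range_eq_ker]
    change LinearMap.range (B.complex.d 1 0).hom = LinearMap.ker B.map
    rw [complex_d]
    exact B.range_diff 0
  · intro n
    rw [ShortComplex.moduleCat_exact_iff_range_eq_ker]
    change LinearMap.range (B.complex.d (n + 2) (n + 1)).hom =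
      LinearMap.ker (B.complex.d (n + 1) n).hom
    rw [complex_d, complex_d]
    exact (B.range_diff (n + 1)).trans (B.ker_diff n).symm

end BoundedModule

theorem HasRes.complexityLE {M : ModuleCat.{0} R} {b : ℕ → ℕ} (h : HasRes R M b)
    {f : ℕ → NNReal} {C : NNReal} (hb : ∀ n, (b n : NNReal) ≤ C * f n) : ComplexityLE R M f := by
  let B : BoundedModule R := ⟨M, b, h⟩
  obtain ⟨P, hP⟩ := B.exists_projectiveResolution
  refine ⟨P, C, fun n => ?_⟩
  rw [hP]
  refine (B.iter n).isProjGen_cover.rankLE ?_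
  rw [B.bound_iter]
  exact hb n

theorem HasRes.of_projectiveResolution {N : ModuleCat.{0} R} (P : ProjectiveResolution N)
    {a : ℕ → ℕ} (ha : ∀ n, IsProjGen R (P.complex.X n) (a n)) : HasRes R N a := by
  have hstep : ∀ (n : ℕ), LinearMap.ker (P.complex.d (n + 1) n).hom =
      LinearMap.range (P.complex.d (n + 2) (n + 1)).hom := fun n =>
    ((ShortComplex.moduleCat_exact_iff_range_eq_ker _).1 (P.exact_succ n)).symm
  have hrange : ∀ n, HasRes R (LinearMap.range (P.complex.d (n + 1) n).hom)
      (fun m => a (n + 1 + m)) := by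
    intro n
    refine ⟨fun N' _ _ c => ∃ n, Nonempty (N' ≃ₗ[R] LinearMap.range (P.complex.d (n + 1) n).hom) ∧
      c = fun m => a (n + 1 + m), ⟨n, ⟨LinearEquiv.refl R _⟩, rfl⟩, ?_⟩
    rintro N' _ _ _ ⟨n, ⟨e⟩, rfl⟩
    refine ⟨P.complex.X (n + 1), inferInstance, inferInstance,
      e.symm.toLinearMap ∘ₗ (P.complex.d (n + 1) n).hom.rangeRestrict, ha (n + 1),
      e.symm.surjective.comp (LinearMap.surjective_rangeRestrict _), n + 1,
      ⟨LinearEquiv.ofEq _ _ ?_⟩, ?_⟩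
    · rw [LinearEquiv.ker_comp, LinearMap.ker_rangeRestrict, hstep]
    · ext m
      rw [Nat.add_assoc (n + 1), Nat.add_comm 1]
  have hsurj : Function.Surjective (P.π.f 0).hom :=
    (ModuleCat.epi_iff_surjective (P.π.f 0)).1 inferInstance
  let ε : P.complex.X 0 →ₗ[R] N := (P.π.f 0).hom
  refine HasRes.of_step ⟨P.complex.X 0, inferInstance, inferInstance, ε, ha 0, hsurj, ?_⟩
  have h0 : LinearMap.range (P.complex.d 1 0).hom = LinearMap.ker ε :=
    (ShortComplex.moduleCat_exact_iff_range_eq_ker _).1 P.exact₀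
  rw [← h0]
  have := hrange 0
  refine this.mono fun n => ?_
  rw [Nat.zero_add, Nat.add_comm]

end Resolutions

theorem PRankLE.of_subsingleton {p : ℕ} [Fact p.Prime] {Q : Type} [Group Q] [Subsingleton Q]
    (r : ℕ) : PRankLE p Q r := by
  intro s f hf
  rcases s with _ | s
  · exact Nat.zero_le r
  · have := hf.subsingleton
    exact absurd this (not_subsingleton _)

/-- The `p`-subgroups of rank at most `r`, for some prime `p`. -/
def IsGoodSubgroup {Q : Type} [Group Q] (r : ℕ) (K : Subgroup Q) : Prop :=
  ∃ p : ℕ, p.Prime ∧ IsPGroup p K ∧ PRankLE p K r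

theorem isGoodSubgroup_bot {Q : Type} [Group Q] (r : ℕ) : IsGoodSubgroup r (⊥ : Subgroup Q) :=
  have : Fact (Nat.Prime 2) := ⟨Nat.prime_two⟩
  ⟨2, Nat.prime_two, IsPGroup.of_bot, PRankLE.of_subsingleton r⟩

/-- Stabilizers in a coset space are conjugate into the subgroup. -/
def stabilizerHom {Q : Type} [Group Q] (K : Subgroup Q) (q : Q) :
    MulAction.stabilizer Q (q : Q ⧸ K) →* K :=
  ((MulAut.conj q⁻¹).toMonoidHom.comp (Subgroup.subtype _)).codRestrict K fun g => by
    have h : ((g.1 * q : Q) : Q ⧸ K) = q := MulAction.mem_stabilizer_iff.1 g.2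
    have h' := QuotientGroup.eq.1 h.symm
    simpa [mul_assoc] using h'

theorem stabilizerHom_injective {Q : Type} [Group Q] (K : Subgroup Q) (q : Q) :
    Function.Injective (stabilizerHom K q) := fun _ _ h =>
  Subtype.ext ((MulAut.conj q⁻¹).injective (congrArg Subtype.val h))

section Average

variable {k : Type} [Ring k] {G Q Λ : Type} [Group G] [Group Q] [MulAction Q Λ] [Fintype Λ]

/-- The inclusion of the constant functions. -/
def TwFun.const (k : Type) [Ring k] (π : G →* Q) (Λ : Type) [MulAction Q Λ] (M : Type)
    [AddCommGroup M] [Module (MonoidAlgebra k G) M] :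
    M →ₗ[MonoidAlgebra k G] TwFun π (1 : SignCocycle Q Λ) M :=
  groupRingLinear
    { toFun := fun m => ⟨fun _ => m⟩
      map_zero' := rfl
      map_add' := fun _ _ => rfl }
    (fun a m => TwFun.ext <| funext fun l =>
      (TwFun.scalar_smul_apply a (⟨fun _ => m⟩ : TwFun π (1 : SignCocycle Q Λ) M) l).symm)
    (fun g m => TwFun.ext <| funext fun l => by
      change single g (1 : k) • m =
        (single g (1 : k) • (⟨fun _ => m⟩ : TwFun π (1 : SignCocycle Q Λ) M)) l
      rw [TwFun.single_smul_apply, SignCocycle.one_apply, one_smul])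

/-- Summation against an invariant integral weight. -/
def TwFun.weightedSum (k : Type) [Ring k] (π : G →* Q) (M : Type)
    [AddCommGroup M] [Module (MonoidAlgebra k G) M] (w : Λ → ℤ) (hw : ∀ (g : Q) l, w (g • l) = w l) :
    TwFun π (1 : SignCocycle Q Λ) M →ₗ[MonoidAlgebra k G] M :=
  groupRingLinear
    { toFun := fun φ => ∑ l, w l • φ l
      map_zero' := Finset.sum_eq_zero fun _ _ => smul_zero _
      map_add' := fun φ ψ => by
        rw [← Finset.sum_add_distrib]
        exact Finset.sum_congr rfl fun l _ => smul_add _ _ _ }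
    (fun a φ => by
      change ∑ l, w l • (single (1 : G) a • φ) l = single (1 : G) a • ∑ l, w l • φ l
      rw [Finset.smul_sum]
      refine Finset.sum_congr rfl fun l _ => ?_
      rw [TwFun.scalar_smul_apply, smul_comm])
    (fun g φ => by
      change ∑ l, w l • (single g (1 : k) • φ) l = single g (1 : k) • ∑ l, w l • φ l
      rw [Finset.smul_sum, ← Equiv.sum_comp (MulAction.toPerm (π g))]
      refine Finset.sum_congr rfl fun l _ => ?_
      rw [MulAction.toPerm_apply, hw, TwFun.single_smul_apply, SignCocycle.one_apply, one_smul,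
        inv_smul_smul, smul_comm])

theorem TwFun.weightedSum_const (π : G →* Q) {M : Type} [AddCommGroup M]
    [Module (MonoidAlgebra k G) M] (w : Λ → ℤ) (hw : ∀ (g : Q) l, w (g • l) = w l) (m : M) :
    TwFun.weightedSum k π M w hw (TwFun.const k π Λ M m) = (∑ l, w l) • m :=
  Finset.sum_smul.symm

end Average

theorem isUnit_natCast_of_primes {k : Type} [Ring k] (n : ℕ) (hn : n ≠ 0)
    (h : ∀ p : ℕ, p.Prime → p ∣ n → IsUnit (p : k)) : IsUnit (n : k) := by
  induction n using Nat.recOnMul with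
  | zero => exact absurd rfl hn
  | one => simp
  | prime p hp => exact h p hp dvd_rfl
  | mul a b ha hb =>
    rw [Nat.cast_mul]
    have hab := mul_ne_zero_iff.1 hn
    exact (ha hab.1 fun p hp hd => h p hp (hd.mul_right b)).mul
      (hb hab.2 fun p hp hd => h p hp (hd.mul_left a))

/-- An integral combination of the indices of the good subgroups is invertible in `k`. -/
theorem exists_weight {k Q : Type} [Ring k] [Group Q] [Finite Q] {r : ℕ}
    (hr : ∀ p : ℕ, p.Prime → ¬ IsUnit (p : k) → PRankLE p Q r)
    [Fintype {K : Subgroup Q // IsGoodSubgroup r K}] :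
    ∃ w : {K : Subgroup Q // IsGoodSubgroup r K} → ℤ,
      IsUnit (((∑ K, w K * (K.1.index : ℤ) : ℤ)) : k) := by
  let I : Ideal ℤ := Ideal.span (Set.range fun K : {K : Subgroup Q // IsGoodSubgroup r K} =>
    (K.1.index : ℤ))
  obtain ⟨g, hg⟩ : ∃ g : ℤ, I = Ideal.span {g} := (IsPrincipalIdealRing.principal I).1
  have hgI : g ∈ I := hg ▸ Ideal.mem_span_singleton_self g
  have hdvd : ∀ K : Subgroup Q, IsGoodSubgroup r K → g ∣ (K.index : ℤ) := fun K hK => by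
    rw [← Ideal.mem_span_singleton, ← hg]
    exact Ideal.subset_span ⟨⟨K, hK⟩, rfl⟩
  obtain ⟨w, hw⟩ := (Submodule.mem_span_range_iff_exists_fun ℤ).1 hgI
  have hw' : ∑ K, w K * (K.1.index : ℤ) = g := hw
  refine ⟨w, ?_⟩
  rw [hw']
  have hnat : IsUnit (g.natAbs : k) := by
    refine isUnit_natCast_of_primes _ ?_ fun p hp hpg => ?_
    · intro h0
      have h1 := hdvd ⊥ (isGoodSubgroup_bot r)
      rw [Int.natAbs_eq_zero.1 h0, zero_dvd_iff, Nat.cast_eq_zero] at h1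
      exact Subgroup.FiniteIndex.index_ne_zero h1
    · by_contra hpk
      have : Fact p.Prime := ⟨hp⟩
      obtain ⟨S⟩ : Nonempty (Sylow p Q) := inferInstance
      have h1 := hdvd S ⟨p, hp, S.2, (hr p hp hpk).of_injective _ (Subgroup.subtype_injective _)⟩
      exact S.not_dvd_index (hpg.trans (Int.natAbs_dvd_natAbs.2 h1))
  rcases Int.natAbs_eq g with h | h
  · rw [h, Int.cast_natCast]
    exact hnat
  · rw [h, Int.cast_neg, Int.cast_natCast]
    exact hnat.neg

theorem smul_bijective_of_isUnit {k G : Type} [Ring k] [Group G] {M : Type} [AddCommGroup M]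
    [Module (MonoidAlgebra k G) M] {n : ℤ} (hn : IsUnit (n : k)) :
    Function.Bijective fun m : M => n • m := by
  have h : IsUnit (n : MonoidAlgebra k G) := by
    have := hn.map (MonoidAlgebra.singleOneRingHom : k →+* MonoidAlgebra k G)
    rwa [map_intCast] at this
  have h' : (fun m : M => n • m) = fun m => (n : MonoidAlgebra k G) • m :=
    funext fun m => (Int.cast_smul_eq_zsmul _ n m).symm
  rw [h']
  exact MulAction.bijective h.unit

/-- A module with a section is a direct summand. -/
def prodKerEquiv {R M N : Type} [Ring R] [AddCommGroup M] [AddCommGroup N] [Module R M]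
    [Module R N] (c : M →ₗ[R] N) (s : N →ₗ[R] M) (h : s ∘ₗ c = LinearMap.id) :
    N ≃ₗ[R] M × LinearMap.ker s :=
  (lequivProdOfRightSplitExact (j := (LinearMap.ker s).subtype) Subtype.val_injective
    (Submodule.range_subtype _) h).symm ≪≫ₗ LinearEquiv.prodComm R _ _

theorem exists_hasRes_prod {k : Type} [Ring k] {G Q Γ : Type} [Group G] [Group Q] [Finite Q]
    [Group Γ] {r : ℕ} (hr : ∀ p : ℕ, p.Prime → ¬ IsUnit (p : k) → PRankLE p Q r)
    (π : G →* Q) (i : Γ →* G) (hπ : Function.Surjective π) (hinj : Function.Injective i)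
    (hi : ∀ γ, π (i γ) = 1) (hker : ∀ g, π g = 1 → ∃ γ, i γ = g) {a : ℕ → ℕ}
    (ha : HasGrowth 0 a) (M : Type) [AddCommGroup M] [Module (MonoidAlgebra k G) M]
    (hM : HasRes (MonoidAlgebra k Γ) (GRst k i M) a) :
    ∃ (N : Type) (_ : AddCommGroup N) (_ : Module (MonoidAlgebra k G) N) (b : ℕ → ℕ),
      HasGrowth r b ∧ HasRes (MonoidAlgebra k G) (M × N) b := by
  classical
  let ι := {K : Subgroup Q // IsGoodSubgroup r K}
  let _ : Fintype ι := Fintype.ofFinite ι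
  let _ : ∀ K : ι, Fintype (Q ⧸ K.1) := fun K => Fintype.ofFinite _
  let Λ := Σ K : ι, Q ⧸ K.1
  obtain ⟨w, hw⟩ := exists_weight hr
  obtain ⟨b, hb, hres⟩ := TwFun.hasRes_supp (k := k) hπ hi (1 : SignCocycle Q Λ) (a := a) Set.univ
    (fun _ _ _ => Set.mem_univ _) (HasGrowth r) (HasGrowth.zero_fun r) (fun _ _ => HasGrowth.add) (by
      rintro ⟨⟨K, p, hp, hK, hKr⟩, x⟩ -
      obtain ⟨q, rfl⟩ := QuotientGroup.mk_surjective x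
      have : Fact p.Prime := ⟨hp⟩
      set l : Λ := ⟨⟨K, p, hp, hK, hKr⟩, (q : Q ⧸ K)⟩
      have hstab : MulAction.stabilizer Q l = MulAction.stabilizer Q (q : Q ⧸ K) := by
        ext g
        rw [MulAction.mem_stabilizer_iff, MulAction.mem_stabilizer_iff]
        constructor
        · intro h
          exact eq_of_heq (Sigma.mk.inj h).2
        · intro h
          exact congrArg (Sigma.mk _) h
      rw [hstab]
      set S := MulAction.stabilizer Q (q : Q ⧸ K)
      exact exists_hasGrowth_transfers k p _ S rfl
        (hK.of_injective _ (stabilizerHom_injective K q)) r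
        (hKr.of_injective _ (stabilizerHom_injective K q)) _ Γ (π.subgroupComap S)
        (toComap π i hi S) (π.subgroupComap_surjective_of_surjective S hπ)
        (toComap_injective hi hinj S) (map_toComap_eq_one hi S) (exists_toComap_eq hi hker S) a ha)
  let c := TwFun.const k π Λ M
  let s := TwFun.weightedSum k π M (fun l : Λ => w l.1) (fun _ _ => rfl)
  have hsum : ∑ l : Λ, w l.1 = ∑ K, w K * (K.1.index : ℤ) := by
    rw [Fintype.sum_sigma]
    refine Finset.sum_congr rfl fun K _ => ?_
    change ∑ _x : Q ⧸ K.1, w K = _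
    rw [Finset.sum_const, Finset.card_univ, nsmul_eq_mul, mul_comm, Subgroup.index,
      Nat.card_eq_fintype_card]
  have hsc : ∀ m, (s ∘ₗ c) m = (∑ K, w K * (K.1.index : ℤ)) • m := fun m =>
    (TwFun.weightedSum_const π (fun l : Λ => w l.1) (fun _ _ => rfl) m).trans (by rw [hsum])
  have hbij : Function.Bijective (s ∘ₗ c) := by
    rw [show ⇑(s ∘ₗ c) = _ from funext hsc]
    exact smul_bijective_of_isUnit (k := k) (G := G) hw
  let e := LinearEquiv.ofBijective (s ∘ₗ c) hbij
  have hid : (e.symm.toLinearMap ∘ₗ s) ∘ₗ c = LinearMap.id := by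
    ext m
    exact e.symm_apply_apply m
  refine ⟨LinearMap.ker (e.symm.toLinearMap ∘ₗ s), inferInstance, inferInstance, b, hb, ?_⟩
  refine HasRes.of_equiv (prodKerEquiv c _ hid) ((hres M hM).of_equiv ?_)
  refine LinearEquiv.ofTop _ (eq_top_iff.2 fun φ _ => ?_)
  exact TwFun.mem_supp.2 fun l hl => absurd (Set.mem_univ l) hl

theorem Module.Finite.exists_isProjGen {R P : Type} [Ring R] [AddCommGroup P] [Module R P]
    [Module.Finite R P] (hP : Module.Projective R P) : ∃ n, IsProjGen R P n := by
  obtain ⟨n, f, hf⟩ := Module.Finite.exists_fin' R P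
  exact ⟨n, hP, f, hf⟩

theorem pRankLE_of_sSup {k Q : Type} [Ring k] [Group Q] [Finite Q] (p : ℕ) (hp : p.Prime)
    (hpk : ¬ IsUnit (p : k)) :
    PRankLE p Q (sSup {r : ℕ | ∃ p : ℕ, p.Prime ∧ ¬ IsUnit ((p : k)) ∧
      ∃ K : Subgroup Q, Nonempty (K ≃* Multiplicative (Fin r → ZMod p))}) := by
  intro s f hf
  refine le_csSup ⟨Nat.card Q, ?_⟩
    ⟨p, hp, hpk, f.range, ⟨(MonoidHom.ofInjective hf).symm⟩⟩
  rintro r ⟨p, hp, -, K, ⟨e⟩⟩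
  have hcard : Nat.card K = p ^ r := by
    rw [Nat.card_congr (e.toEquiv.trans Multiplicative.toAdd), Nat.card_fun, Nat.card_zmod,
      Nat.card_fin]
  exact ((Nat.lt_pow_self hp.one_lt).le.trans hcard.ge).trans (Subgroup.card_le_card_group K)

/-- If `H ⊴ G` has finite index and `M` has a finite-length resolution by finitely
generated projective `kH`-modules, and `d` is the largest rank of an elementary abelian
`p`-subgroup of `G/H` over primes `p` not invertible in `k`, then
`cds_{kG}(M) ≤ (n+1)^{d-1}`. -/
theorem cds_of_finite_resolution_over_subgroup
    (k : Type) [Ring k] (G : Type) [Group G]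
    (H : Subgroup G) [H.Normal] [H.FiniteIndex]
    (M : ModuleCat.{0} (MonoidAlgebra k G))
    (P : ProjectiveResolution (resMod k H M))
    (hfg : ∀ n, Module.Finite (MonoidAlgebra k H) (P.complex.X n))
    (hfl : ∃ l : ℕ, ∀ n, l < n → Subsingleton (P.complex.X n))
    (d : ℕ)
    (hd : d = sSup {r : ℕ | ∃ p : ℕ, p.Prime ∧ ¬ IsUnit ((p : k)) ∧
      ∃ Q : Subgroup (G ⧸ H), Nonempty (Q ≃* Multiplicative (Fin r → ZMod p))}) :
    CdsLE (MonoidAlgebra k G) M (fun n => ((n : NNReal) + 1) ^ (d - 1)) := by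
  obtain ⟨l, hl⟩ := hfl
  have hgen : ∀ n, ∃ m, IsProjGen (MonoidAlgebra k H) (P.complex.X n) m ∧ (l < n → m = 0) := by
    intro n
    by_cases hn : l < n
    · have := hl n hn
      exact ⟨0, isProjGen_of_subsingleton, fun _ => rfl⟩
    · obtain ⟨m, hm⟩ := Module.Finite.exists_isProjGen
        ((IsProjective.iff_projective (P.complex.X n)).2 (P.projective n))
      exact ⟨m, hm, fun h => absurd h hn⟩
  choose a ha ha0 using hgen
  let e : resMod k H M ≃ₗ[MonoidAlgebra k H] GRst k H.subtype M :=
    { Rst.equiv (MonoidAlgebra.mapDomainRingHom k H.subtype) (M := M) with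
      map_smul' := fun _ _ => rfl }
  have hM : HasRes (MonoidAlgebra k H) (GRst k H.subtype M) a :=
    (HasRes.of_projectiveResolution P ha).of_equiv e
  obtain ⟨N, _, _, b, hb, hN⟩ := exists_hasRes_prod (r := d)
    (fun p hp hpk => hd ▸ pRankLE_of_sSup p hp hpk) (QuotientGroup.mk' H) H.subtype
    (QuotientGroup.mk'_surjective H) H.subtype_injective
    (fun γ => (QuotientGroup.eq_one_iff _).2 γ.2)
    (fun g hg => ⟨⟨g, (QuotientGroup.eq_one_iff g).1 hg⟩, rfl⟩)
    (⟨l + 1, fun n hn => ha0 n hn⟩ : HasGrowth 0 a) M hM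
  obtain ⟨C, hC⟩ := hb.exists_le
  refine ⟨ModuleCat.of _ N, HasRes.complexityLE (b := b) (C := C) hN fun n => ?_⟩
  exact_mod_cast hC n
end
end

section
/- Let p and r be distinct primes and n ≥ 2. Then every subgroup of SL(n, ℤ/p) which is an elementary abelian r-group has rank at most n−1; equivalently, every such subgroup has order at most r^{n−1}. -/
open Module

/-- A pairwise commuting family of semisimple endomorphisms of a finite-dimensional space over
an algebraically closed field is simultaneously diagonalizable. -/
theorem exists_basis_apply_eq_smul_of_commute_of_isSemisimple
    {ι K V : Type*} [Field K] [IsAlgClosed K] [AddCommGroup V] [Module K V]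
    [FiniteDimensional K V] {d : ℕ} (hd : finrank K V = d) (f : ι → End K V)
    (hcomm : Pairwise fun i j => Commute (f i) (f j)) (hss : ∀ i, (f i).IsSemisimple) :
    ∃ (b : Basis (Fin d) K V) (χ : Fin d → ι → K),
      ∀ k i, f i (b k) = χ k i • b k := by
  have htop := End.iSup_iInf_maxGenEigenspace_eq_top_of_iSup_maxGenEigenspace_eq_top_of_commute
    f hcomm (fun i => End.iSup_maxGenEigenspace_eq_top (f i))
  let S : Set V := {v | ∃ χ : ι → K, ∀ i, f i v = χ i • v}
  have hS : ⊤ ≤ Submodule.span K S := by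
    rw [← htop]
    refine iSup_le fun χ v hv => Submodule.subset_span ⟨χ, fun i => ?_⟩
    have hvi := (Submodule.mem_iInf _).1 hv i
    rw [(hss i).isFinitelySemisimple.maxGenEigenspace_eq_eigenspace] at hvi
    exact End.mem_eigenspace_iff.1 hvi
  let b₀ := Basis.ofSpan hS
  let b := b₀.reindex (Finite.equivFinOfCardEq ((finrank_eq_nat_card_basis b₀).symm.trans hd))
  have hb : ∀ k, b k ∈ S := fun k => by
    rw [Basis.reindex_apply]
    exact Basis.ofSpan_subset hS ⟨_, rfl⟩
  choose χ hχ using hb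
  exact ⟨b, χ, hχ⟩

/-- An endomorphism with `f ^ r = 1`, where `r` is invertible in the field, is semisimple. -/
theorem Module.End.isSemisimple_of_pow_eq_one {K V : Type*} [Field K] [AddCommGroup V]
    [Module K V] {r : ℕ} (hr : (r : K) ≠ 0) {f : End K V} (hf : f ^ r = 1) :
    f.IsSemisimple :=
  End.isSemisimple_of_squarefree_aeval_eq_zero
    (Polynomial.X_pow_sub_one_separable_iff.2 hr).squarefree (by simp [hf])

/-- A commutative group of exponent dividing `r` which acts faithfully with determinant one on a
space of dimension `m + 1` over an algebraically closed field in which `r ≠ 0` has order at most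
`r ^ m`. -/
theorem card_le_pow_of_injective_of_det_eq_one
    {G K V : Type*} [Group G] [Field K] [IsAlgClosed K] [AddCommGroup V] [Module K V]
    [FiniteDimensional K V] {m r : ℕ} (hV : finrank K V = m + 1) (hr : (r : K) ≠ 0)
    (ρ : G →* End K V) (hρ : Function.Injective ρ) (hdet : ∀ g, LinearMap.det (ρ g) = 1)
    (hcomm : ∀ g h : G, Commute g h) (hpow : ∀ g : G, g ^ r = 1) :
    Nat.card G ≤ r ^ m := by
  have hρpow : ∀ g, ρ g ^ r = 1 := fun g => by rw [← map_pow, hpow, map_one]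
  obtain ⟨b, χ, hχ⟩ := exists_basis_apply_eq_smul_of_commute_of_isSemisimple hV ρ
    (fun g h _ => (hcomm g h).map ρ) (fun g => End.isSemisimple_of_pow_eq_one hr (hρpow g))
  have hχpow : ∀ k g, χ k g ^ r = 1 := fun k g => by
    have hiter : ∀ j : ℕ, (ρ g ^ j) (b k) = χ k g ^ j • b k := fun j => by
      induction j with
      | zero => simp
      | succ j ih => rw [pow_succ', End.mul_apply, ih, map_smul, hχ, smul_smul, pow_succ]
    have h := hiter r
    rw [hρpow, End.one_apply] at h
    exact (smul_left_injective K (b.ne_zero k) (by simpa using h)).symm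
  have hr0 : 0 < r := Nat.pos_of_ne_zero (by rintro rfl; simp at hr)
  have hprod : ∀ g, ∏ k, χ k g = 1 := fun g => by
    have hdiag : LinearMap.toMatrix b b (ρ g) = Matrix.diagonal fun k => χ k g := by
      ext i j
      rw [LinearMap.toMatrix_apply, hχ, map_smul, Basis.repr_self]
      by_cases hij : i = j
      · subst hij; simp
      · simp [Matrix.diagonal_apply_ne _ hij, Finsupp.single_eq_of_ne hij]
    rw [← Matrix.det_diagonal, ← hdiag, LinearMap.det_toMatrix, hdet]
  let Φ : G → Fin m → Polynomial.nthRootsFinset r (1 : K) := fun g k =>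
    ⟨χ k.castSucc g, (Polynomial.mem_nthRootsFinset hr0 _).2 (hχpow _ g)⟩
  have hΦ : Function.Injective Φ := fun g h hgh => by
    have hinit : ∀ k : Fin m, χ k.castSucc g = χ k.castSucc h := fun k =>
      congrArg Subtype.val (congrFun hgh k)
    have hlast : χ (Fin.last m) g = χ (Fin.last m) h := by
      have hg := hprod g
      have hh := hprod h
      rw [Fin.prod_univ_castSucc] at hg hh
      rw [Finset.prod_congr rfl fun k _ => hinit k] at hg
      exact mul_left_cancel₀ (left_ne_zero_of_mul_eq_one hh) (hg.trans hh.symm)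
    refine hρ (b.ext fun k => ?_)
    rw [hχ, hχ]
    congr 1
    exact Fin.lastCases hlast hinit k
  calc Nat.card G ≤ Nat.card (Fin m → Polynomial.nthRootsFinset r (1 : K)) :=
        Nat.card_le_card_of_injective Φ hΦ
    _ = (Polynomial.nthRootsFinset r (1 : K)).card ^ m := by simp
    _ ≤ r ^ m := by
        gcongr
        classical
        rw [Polynomial.nthRootsFinset_def]
        exact (Multiset.toFinset_card_le _).trans (Polynomial.card_nthRoots r 1)

/-- Every elementary abelian `r`-subgroup of `SL(n, ℤ/p)`, where `r` and `p` are distinct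
primes and `n ≥ 2`, has rank at most `n - 1`; equivalently, it has order at most
`r ^ (n - 1)`. -/
theorem rank_le_of_elementary_abelian_subgroup_SL
    (p r : ℕ) (hp : p.Prime) (hr : r.Prime) (hpr : p ≠ r)
    (n : ℕ) (hn : 2 ≤ n)
    (E : Subgroup (Matrix.SpecialLinearGroup (Fin n) (ZMod p)))
    (s : ℕ) (hE : Nonempty (E ≃* Multiplicative (Fin s → ZMod r))) :
    s ≤ n - 1 ∧ Nat.card E ≤ r ^ (n - 1) := by
  obtain ⟨e⟩ := hE
  have := Fact.mk hp
  let K := AlgebraicClosure (ZMod p)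
  have : CharP K p := charP_of_injective_algebraMap (algebraMap (ZMod p) K).injective p
  have hrK : (r : K) ≠ 0 := fun h =>
    hpr ((Nat.prime_dvd_prime_iff_eq hp hr).1 ((CharP.cast_eq_zero_iff K p r).1 h))
  let ρ : E →* End K (Fin n → K) :=
    (Matrix.toLinAlgEquiv' : Matrix (Fin n) (Fin n) K ≃ₐ[K] _).toMonoidHom.comp
      (Matrix.SpecialLinearGroup.coeMonoidHom.comp
        ((Matrix.SpecialLinearGroup.map (algebraMap (ZMod p) K)).comp E.subtype))
  have hcard : Nat.card E ≤ r ^ (n - 1) := by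
    refine card_le_pow_of_injective_of_det_eq_one (K := K) (V := Fin n → K) ?_ hrK ρ ?_ ?_ ?_ ?_
    · rw [finrank_fin_fun]
      lia
    · intro g h hgh
      have hmap := Matrix.toLinAlgEquiv'.injective hgh
      exact Subtype.ext (Subtype.ext
        (Matrix.map_injective (algebraMap (ZMod p) K).injective hmap))
    · intro g
      exact (LinearMap.det_toLin' _).trans
        (Matrix.SpecialLinearGroup.map (algebraMap (ZMod p) K) g.1).2
    · intro g h
      apply e.injective
      rw [map_mul, map_mul, mul_comm]
    · intro g
      apply e.injective
      rw [map_pow, map_one]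
      apply Multiplicative.toAdd.injective
      ext i
      simp
  refine ⟨?_, hcard⟩
  have hEcard : Nat.card E = r ^ s := by
    rw [Nat.card_congr (e.toEquiv.trans Multiplicative.toAdd)]
    rw [Nat.card_fun, Nat.card_zmod, Nat.card_fin]
  rwa [hEcard, Nat.pow_le_pow_iff_right hr.one_lt] at hcard
end
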